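/- Let n ≥ 1 and let E ⊂ ℝ^{n+1} be an n-dimensional uniformly rectifiable set, and let 𝔻(E) be a Christ–David dyadic system on E. Then there exist constants c₀ ∈ (0,1) and C ≥ 1, depending only on n and the UR character of E, such that for every Q ∈ 𝔻(E) there is an open set Ω̃ = Ω̃_Q ⊂ ℝ^{n+1} ∖ E with: (1) C^{-1} diam Q ≤ diam Ω̃ ≤ C diam Q; (2) ∂Ω̃ is n-dimensional ADR with constant at most C; (3) Ω̃ satisfies the strong 2-sided corkscrew condition with constant at least c₀; (4) H^n(∂Ω̃ ∩ Q) ≥ c₀ σ(Q); and (5) every connected component of Ω̃ is an NTA domain with n-dimensional ADR boundary, with NTA and ADR constants controlled by C. -/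

import Mathlib

open Metric MeasureTheory Set
open scoped NNReal ENNReal

noncomputable section

/-- `ℝ^{n+1}` -/
abbrev Euc (n : ℕ) : Type := EuclideanSpace ℝ (Fin (n + 1))

/-- The distance between two subsets of `ℝ^{n+1}`. -/
def sDist {n : ℕ} (A B : Set (Euc n)) : ℝ := sInf (Set.image2 dist A B)

/-- `E ⊆ ℝ^{n+1}` is an `n`-dimensional Ahlfors-David regular set with constant `C`. -/
def IsADR (n : ℕ) (E : Set (Euc n)) (C : ℝ) : Prop :=
  IsClosed E ∧ 1 ≤ C ∧ ∀ x ∈ E, ∀ r : ℝ, 0 < r → ENNReal.ofReal r < EMetric.diam E →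
    ENNReal.ofReal (C⁻¹ * r ^ n) ≤ μH[(n : ℝ)] (E ∩ ball x r) ∧
      μH[(n : ℝ)] (E ∩ ball x r) ≤ ENNReal.ofReal (C * r ^ n)

/-- `E ⊆ ℝ^{n+1}` is `n`-dimensional uniformly rectifiable, with UR character
`(θ, M₀)` together with the ADR constant `C`. -/
def IsUR (n : ℕ) (E : Set (Euc n)) (C θ : ℝ) (M₀ : ℝ≥0) : Prop :=
  IsADR n E C ∧ 0 < θ ∧ ∀ x ∈ E, ∀ r : ℝ, 0 < r → ENNReal.ofReal r < EMetric.diam E →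
    ∃ ρ : EuclideanSpace ℝ (Fin n) → Euc n, LipschitzWith M₀ ρ ∧
      ENNReal.ofReal (θ * r ^ n) ≤ μH[(n : ℝ)] (E ∩ ball x r ∩ ρ '' ball 0 r)

/-- A Christ–David dyadic system on an `n`-dimensional ADR set `E ⊆ ℝ^{n+1}`:
for each `k : ℤ` a collection `cubes k` of Borel subsets of `E` ("dyadic cubes of
generation `k`", of length `ℓ(Q) = 2^{-k}`) covering `E`, nested across generations,
with unique ancestors, `diam Q ≤ C₁ 2^{-k}`, each cube containing a surface ball
`Δ(ctr k Q, a₀ 2^{-k})`, and with small boundary regions. -/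
structure ChristDavid (n : ℕ) (E : Set (Euc n)) where
  cubes : ℤ → Set (Set (Euc n))
  a₀ : ℝ
  γ : ℝ
  C₁ : ℝ
  a₀_pos : 0 < a₀
  γ_pos : 0 < γ
  C₁_pos : 0 < C₁
  measSet : ∀ ⦃k : ℤ⦄ ⦃Q : Set (Euc n)⦄, Q ∈ cubes k → MeasurableSet Q
  subset_E : ∀ ⦃k : ℤ⦄ ⦃Q : Set (Euc n)⦄, Q ∈ cubes k → Q ⊆ E
  cover : ∀ k : ℤ, ⋃₀ cubes k = E
  nested : ∀ ⦃k m : ℤ⦄, k ≤ m → ∀ ⦃Q⦄, Q ∈ cubes k → ∀ ⦃Q'⦄, Q' ∈ cubes m →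
    Q' ⊆ Q ∨ Q' ∩ Q = ∅
  ancestor : ∀ ⦃k : ℤ⦄ ⦃Q⦄, Q ∈ cubes k → ∀ m : ℤ, m < k →
    ∃! Q'' : Set (Euc n), Q'' ∈ cubes m ∧ Q ⊆ Q''
  diam_le : ∀ ⦃k : ℤ⦄ ⦃Q⦄, Q ∈ cubes k → Metric.diam Q ≤ C₁ * (2 : ℝ) ^ (-k)
  ctr : ℤ → Set (Euc n) → Euc n
  ctr_mem : ∀ ⦃k : ℤ⦄ ⦃Q⦄, Q ∈ cubes k → ctr k Q ∈ Q
  ctr_ball : ∀ ⦃k : ℤ⦄ ⦃Q⦄, Q ∈ cubes k → E ∩ ball (ctr k Q) (a₀ * (2 : ℝ) ^ (-k)) ⊆ Q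
  small_boundary : ∀ ⦃k : ℤ⦄ ⦃Q⦄, Q ∈ cubes k → ∀ ϱ : ℝ, 0 < ϱ → ϱ < a₀ →
    μH[(n : ℝ)] {x ∈ Q | Metric.infDist x (E \ Q) ≤ ϱ * (2 : ℝ) ^ (-k)} ≤
      ENNReal.ofReal (C₁ * ϱ ^ γ) * μH[(n : ℝ)] Q

/-- A dyadic cube of the system `D`: a generation `k` together with a member of
`D.cubes k`. -/
structure CDCube {n : ℕ} {E : Set (Euc n)} (D : ChristDavid n E) where
  k : ℤ
  set : Set (Euc n)
  mem : set ∈ D.cubes k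

/-- The length `ℓ(Q) = 2^{-k(Q)}` of a dyadic cube. -/
def CDCube.len {n : ℕ} {E : Set (Euc n)} {D : ChristDavid n E} (Q : CDCube D) : ℝ :=
  (2 : ℝ) ^ (-Q.k)

/-- `X₁, X₂` are centers of two corkscrew balls of radius `c * r` inside `B(x, r)`,
lying in two distinct connected components of `Fᶜ`. -/
def CorkscrewPair {n : ℕ} (F : Set (Euc n)) (x : Euc n) (r c : ℝ) (X₁ X₂ : Euc n) : Prop :=
  ball X₁ (c * r) ⊆ ball x r ∧ ball X₂ (c * r) ⊆ ball x r ∧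
  ball X₁ (c * r) ⊆ Fᶜ ∧ ball X₂ (c * r) ⊆ Fᶜ ∧
  connectedComponentIn Fᶜ X₁ ≠ connectedComponentIn Fᶜ X₂

/-- The 2-sided corkscrew condition (Condition B) with constant `c` for the open set `Ω`. -/
def TwoSidedCorkscrew {n : ℕ} (Ω : Set (Euc n)) (c : ℝ) : Prop :=
  ∀ x ∈ frontier Ω, ∀ r : ℝ, 0 < r → ENNReal.ofReal r < EMetric.diam (frontier Ω) →
    ∃ X₁ X₂ : Euc n, CorkscrewPair (frontier Ω) x r c X₁ X₂

/-- The strong 2-sided corkscrew condition with constant `c`: in addition one of the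
two corkscrew balls lies in `Ω`. -/
def StrongTwoSidedCorkscrew {n : ℕ} (Ω : Set (Euc n)) (c : ℝ) : Prop :=
  ∀ x ∈ frontier Ω, ∀ r : ℝ, 0 < r → ENNReal.ofReal r < EMetric.diam (frontier Ω) →
    ∃ X₁ X₂ : Euc n, CorkscrewPair (frontier Ω) x r c X₁ X₂ ∧
      (ball X₁ (c * r) ⊆ Ω ∨ ball X₂ (c * r) ⊆ Ω)

/-- The Harnack chain condition for `Ω`, with comparability constant `C` and with at
most `Nb Λ` balls in a chain joining points at distance `< Λ ρ` which are `ρ`-far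
from `∂Ω`. -/
def HarnackChainCond {n : ℕ} (Ω : Set (Euc n)) (C : ℝ) (Nb : ℝ → ℕ) : Prop :=
  1 ≤ C ∧ ∀ ρ : ℝ, 0 < ρ → ∀ Λ : ℝ, 1 ≤ Λ → ∀ X ∈ Ω, ∀ X' ∈ Ω,
    ρ ≤ Metric.infDist X (frontier Ω) → ρ ≤ Metric.infDist X' (frontier Ω) →
    dist X X' < Λ * ρ →
    ∃ N : ℕ, 0 < N ∧ N ≤ Nb Λ ∧ ∃ (ctr : ℕ → Euc n) (rad : ℕ → ℝ),
      X ∈ ball (ctr 0) (rad 0) ∧ X' ∈ ball (ctr (N - 1)) (rad (N - 1)) ∧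
      (∀ i < N, 0 < rad i ∧ ball (ctr i) (rad i) ⊆ Ω ∧
        C⁻¹ * Metric.diam (ball (ctr i) (rad i)) ≤ sDist (ball (ctr i) (rad i)) (frontier Ω) ∧
        sDist (ball (ctr i) (rad i)) (frontier Ω) ≤ C * Metric.diam (ball (ctr i) (rad i))) ∧
      ∀ i : ℕ, i + 1 < N → (ball (ctr i) (rad i) ∩ ball (ctr (i + 1)) (rad (i + 1))).Nonempty

/-- `Ω` is an NTA domain, with corkscrew constant `c` and Harnack chain constants
`(C, Nb)`. -/
def IsNTA {n : ℕ} (Ω : Set (Euc n)) (c C : ℝ) (Nb : ℝ → ℕ) : Prop :=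
  IsOpen Ω ∧ IsConnected Ω ∧ HarnackChainCond Ω C Nb ∧ StrongTwoSidedCorkscrew Ω c

open scoped RealInnerProductSpace

lemma ediam_eq' {n : ℕ} (E : Set (Euc n)) : EMetric.diam E = ediam E := rfl

lemma card_disjoint_balls {n : ℕ} {ι : Type*} (T : Finset ι) (c : ι → Euc n) {s R : ℝ} {z : Euc n}
    (hs : 0 < s) (hR : 0 < R)
    (hd : (T : Set ι).PairwiseDisjoint (fun i => ball (c i) s))
    (hsub : ∀ i ∈ T, ball (c i) s ⊆ ball z R) : (T.card : ℝ) * s ^ (n + 1) ≤ R ^ (n + 1) := by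
  set μ : Measure (Euc n) := volume
  have h1 : μ (⋃ i ∈ T, ball (c i) s) = ∑ i ∈ T, μ (ball (c i) s) :=
    measure_biUnion_finset hd (fun _ _ => measurableSet_ball)
  have h2 : μ (⋃ i ∈ T, ball (c i) s) ≤ μ (ball z R) :=
    measure_mono (iUnion₂_subset hsub)
  have hfr : Module.finrank ℝ (Euc n) = n + 1 := by simp
  rw [h1] at h2
  simp only [Measure.addHaar_ball_of_pos μ _ hs, Measure.addHaar_ball_of_pos μ _ hR, hfr,
    Finset.sum_const, nsmul_eq_mul] at h2
  rw [← mul_assoc] at h2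
  have h3 := (ENNReal.mul_le_mul_iff_left (measure_ball_pos μ (0 : Euc n) one_pos).ne'
    measure_ball_lt_top.ne).1 h2
  rw [← ENNReal.ofReal_natCast, ← ENNReal.ofReal_mul (by positivity)] at h3
  exact (ENNReal.ofReal_le_ofReal_iff (by positivity)).1 h3

lemma card_separated {n : ℕ} (T : Finset (Euc n)) {s R : ℝ} {z : Euc n}
    (hs : 0 < s) (hR : 0 < R)
    (hd : ∀ x ∈ T, ∀ y ∈ T, x ≠ y → s ≤ dist x y)
    (hsub : ∀ x ∈ T, x ∈ ball z R) : (T.card : ℝ) ≤ (1 + 2 * R / s) ^ (n + 1) := by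
  have h := card_disjoint_balls T (fun x => x) (s := s / 2) (R := R + s / 2) (z := z)
    (by positivity) (by positivity) ?_ ?_
  · have e : (1 + 2 * R / s) = (R + s / 2) / (s / 2) := by field_simp; ring
    rw [e, div_pow, le_div_iff₀ (by positivity)]
    exact h
  · intro x hx y hy hxy
    exact ball_disjoint_ball (by have := hd x hx y hy hxy; linarith)
  · intro x hx
    apply ball_subset_ball'
    have := mem_ball.1 (hsub x hx)
    linarith

lemma exists_net {n : ℕ} (A : Set (Euc n)) {s R : ℝ} {z : Euc n} (hs : 0 < s) (hR : 0 < R)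
    (hA : A ⊆ ball z R) : ∃ T : Finset (Euc n), (T : Set (Euc n)) ⊆ A ∧
      (∀ x ∈ T, ∀ y ∈ T, x ≠ y → s ≤ dist x y) ∧ (∀ x ∈ A, ∃ t ∈ T, dist x t < s) ∧
      (T.card : ℝ) ≤ (1 + 2 * R / s) ^ (n + 1) := by
  classical
  let P : ℕ → Prop := fun k => ∃ T : Finset (Euc n), T.card = k ∧ (T : Set (Euc n)) ⊆ A ∧
      (∀ x ∈ T, ∀ y ∈ T, x ≠ y → s ≤ dist x y)
  have hb : ∀ T : Finset (Euc n), (T : Set (Euc n)) ⊆ A →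
      (∀ x ∈ T, ∀ y ∈ T, x ≠ y → s ≤ dist x y) → (T.card : ℝ) ≤ (1 + 2 * R / s) ^ (n + 1) :=
    fun T h1 h2 => card_separated T hs hR h2 (fun x hx => hA (h1 hx))
  set b := ⌊(1 + 2 * R / s) ^ (n + 1)⌋₊
  have hP0 : P 0 := ⟨∅, by simp⟩
  have hPm := Nat.findGreatest_spec (P := P) (Nat.zero_le b) hP0
  obtain ⟨T, hc, hTA, hsep⟩ := hPm
  refine ⟨T, hTA, hsep, ?_, hb T hTA hsep⟩
  intro x hx
  by_contra! hcon
  have hxT : x ∉ T := fun h => by have := hcon x h; simp at this; linarith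
  have hP' : P (T.card + 1) := by
    refine ⟨insert x T, by rw [Finset.card_insert_of_notMem hxT], ?_, ?_⟩
    · simp only [Finset.coe_insert]; exact insert_subset hx hTA
    · intro u hu v hv huv
      simp only [Finset.mem_insert] at hu hv
      rcases hu with rfl | hu <;> rcases hv with rfl | hv
      · exact absurd rfl huv
      · exact hcon v hv
      · rw [dist_comm]; exact hcon u hu
      · exact hsep u hu v hv huv
  have hle : T.card + 1 ≤ b := by
    obtain ⟨T', hc', h1', h2'⟩ := hP'
    rw [← hc']
    exact Nat.le_floor (hb T' h1' h2')
  have := Nat.le_findGreatest hle hP'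
  omega

lemma upper_global (n : ℕ) (C : ℝ) : ∃ C' : ℝ, 1 ≤ C' ∧ ∀ E : Set (Euc n), IsADR n E C →
    E.Nontrivial → ∀ (z : Euc n) (R : ℝ), 0 < R →
      μH[(n : ℝ)] (E ∩ ball z R) ≤ ENNReal.ofReal (C' * R ^ n) := by
  refine ⟨max 1 (9 ^ (n + 1) * (2 ^ n * C)), le_max_left _ _, ?_⟩
  intro E hE hnt z R hR
  obtain ⟨hcl, hC, hreg⟩ := hE
  have key : μH[(n : ℝ)] (E ∩ ball z R) ≤ ENNReal.ofReal (9 ^ (n + 1) * (2 ^ n * C) * R ^ n) := by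
    by_cases hbig : ENNReal.ofReal (2 * R) < EMetric.diam E
    · rcases (E ∩ ball z R).eq_empty_or_nonempty with h | ⟨x, hxE, hxz⟩
      · simp [h]
      · have hsub : E ∩ ball z R ⊆ E ∩ ball x (2 * R) := by
          apply inter_subset_inter_right
          apply ball_subset_ball'
          rw [dist_comm]; have := mem_ball.1 hxz; linarith
        refine (measure_mono hsub).trans ((hreg x hxE _ (by positivity) hbig).2.trans ?_)
        apply ENNReal.ofReal_le_ofReal
        rw [mul_pow]
        have : (1:ℝ) ≤ 9 ^ (n+1) := one_le_pow₀ (by norm_num)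
        have h0 : 0 ≤ 2 ^ n * C * R ^ n := by positivity
        nlinarith
    · rw [not_lt, ediam_eq'] at hbig
      have hbd : Bornology.IsBounded E := isBounded_iff_ediam_ne_top.2
        (ne_top_of_le_ne_top ENNReal.ofReal_ne_top hbig)
      set d := diam E with hd
      have hed : ediam E = ENNReal.ofReal d := by
        rw [hd, diam, ENNReal.ofReal_toReal (isBounded_iff_ediam_ne_top.1 hbd)]
      have hdpos : 0 < d := Metric.diam_pos hnt hbd
      have hdR : d ≤ 2 * R := by
        rw [hed] at hbig
        exact (ENNReal.ofReal_le_ofReal_iff (by positivity)).1 hbig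
      obtain ⟨x, hx⟩ := hnt.nonempty
      have hEb : E ⊆ ball x (2 * d) := fun y hy => by
        have := dist_le_diam_of_mem hbd hy hx
        simp only [mem_ball]; linarith
      obtain ⟨T, hTE, -, hcov, hcard⟩ := exists_net E (s := d / 2) (by positivity)
        (by positivity) hEb
      have hsub : E ∩ ball z R ⊆ ⋃ t ∈ T, E ∩ ball t (d / 2) := by
        rintro y ⟨hy, -⟩
        obtain ⟨t, ht, hyt⟩ := hcov y hy
        exact mem_iUnion₂.2 ⟨t, ht, hy, hyt⟩
      calc μH[(n : ℝ)] (E ∩ ball z R) ≤ ∑ t ∈ T, μH[(n : ℝ)] (E ∩ ball t (d / 2)) :=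
            (measure_mono hsub).trans (measure_biUnion_finset_le _ _)
        _ ≤ ∑ t ∈ T, ENNReal.ofReal (C * R ^ n) := by
            apply Finset.sum_le_sum
            intro t ht
            refine (hreg t (hTE ht) (d / 2) (by positivity) ?_).2.trans ?_
            · rw [ediam_eq', hed]
              exact (ENNReal.ofReal_lt_ofReal_iff hdpos).2 (by linarith)
            · apply ENNReal.ofReal_le_ofReal
              gcongr; linarith
        _ = ENNReal.ofReal (T.card * (C * R ^ n)) := by
            rw [Finset.sum_const, nsmul_eq_mul, ENNReal.ofReal_mul (p := (T.card : ℝ)) (by positivity),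
              ENNReal.ofReal_natCast]
        _ ≤ _ := by
            apply ENNReal.ofReal_le_ofReal
            have e : 1 + 2 * (2 * d) / (d / 2) = 9 := by field_simp; norm_num
            rw [e] at hcard
            have h2 : (1:ℝ) ≤ 2 ^ n := one_le_pow₀ (by norm_num)
            have h0 : 0 ≤ C * R ^ n := by positivity
            calc (T.card : ℝ) * (C * R ^ n) ≤ 9 ^ (n+1) * (C * R ^ n) := by gcongr
              _ ≤ 9 ^ (n+1) * (2 ^ n * (C * R ^ n)) := by
                  apply mul_le_mul_of_nonneg_left _ (by positivity)
                  nlinarith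
              _ = _ := by ring
  refine key.trans (ENNReal.ofReal_le_ofReal ?_)
  gcongr
  exact le_max_right _ _

/-- n-dimensional measure of the unit ball -/
def cn (n : ℕ) : ℝ := (μH[(n : ℝ)] (ball (0 : EuclideanSpace ℝ (Fin n)) 1)).toReal

lemma haar_hd (n : ℕ) : (μH[(n : ℝ)] : Measure (EuclideanSpace ℝ (Fin n))).IsAddHaarMeasure := by
  have h := isAddHaarMeasure_hausdorffMeasure (E := EuclideanSpace ℝ (Fin n))
  simpa using h

lemma cn_pos (n : ℕ) : 0 < cn n := by
  have := haar_hd n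
  exact ENNReal.toReal_pos (measure_ball_pos _ _ one_pos).ne' measure_ball_lt_top.ne

lemma hd_ball {n : ℕ} (w : EuclideanSpace ℝ (Fin n)) {r : ℝ} (hr : 0 < r) :
    μH[(n : ℝ)] (ball w r) = ENNReal.ofReal (cn n * r ^ n) := by
  have := haar_hd n
  rw [Measure.addHaar_ball_of_pos _ _ hr, cn, mul_comm, ENNReal.ofReal_mul ENNReal.toReal_nonneg,
    ENNReal.ofReal_toReal measure_ball_lt_top.ne]
  simp

lemma exists_proj {n : ℕ} (e : Euc n) (he : ‖e‖ = 1) :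
    ∃ π : Euc n →L[ℝ] EuclideanSpace ℝ (Fin n), (∀ x, ‖x‖ ^ 2 = ‖π x‖ ^ 2 + ⟪x, e⟫ ^ 2) ∧ π e = 0 ∧
      ∀ w, ∃ x, π x = w ∧ ‖x‖ = ‖w‖ := by
  have he0 : e ≠ 0 := by rintro rfl; simp at he
  have : Fact (Module.finrank ℝ (Euc n) = n + 1) := ⟨by simp⟩
  let b := OrthonormalBasis.fromOrthogonalSpanSingleton (𝕜 := ℝ) n he0
  let P := (ℝ ∙ e)ᗮ.orthogonalProjectionOnto
  refine ⟨(b.repr.toContinuousLinearEquiv : _ →L[ℝ] _).comp P, ?_, ?_, ?_⟩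
  · intro x
    rw [Submodule.norm_sq_eq_add_norm_sq_projection x (ℝ ∙ e), add_comm]
    congr 1
    · simp [P]
    · rw [← Submodule.norm_coe, Submodule.coe_orthogonalProjectionOnto_apply, Submodule.starProjection_unit_singleton ℝ he, norm_smul, he,
        real_inner_comm]
      simp
  · have : P e = 0 := by
      apply Submodule.orthogonalProjectionOnto_apply_of_mem_orthogonal
      simp
    simp [this]
  · intro w
    refine ⟨((b.repr.symm w : (ℝ ∙ e)ᗮ) : Euc n), ?_, ?_⟩
    · have h := Submodule.orthogonalProjectionOnto_mem_subspace_eq_self (b.repr.symm w)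
      simp [P, h]
    · rw [Submodule.norm_coe, LinearIsometryEquiv.norm_map]

lemma lip_of_proj {n : ℕ} {e : Euc n} {π : Euc n →L[ℝ] EuclideanSpace ℝ (Fin n)}
    (h : ∀ x, ‖x‖ ^ 2 = ‖π x‖ ^ 2 + ⟪x, e⟫ ^ 2) (x : Euc n) : ‖π x‖ ≤ ‖x‖ := by
  apply (sq_le_sq₀ (norm_nonneg _) (norm_nonneg _)).1
  nlinarith [h x, sq_nonneg ⟪x, e⟫]

lemma hd_image_le {n : ℕ} {π : Euc n →L[ℝ] EuclideanSpace ℝ (Fin n)}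
    (h : ∀ x, ‖π x‖ ≤ ‖x‖) (A : Set (Euc n)) : μH[(n : ℝ)] (π '' A) ≤ μH[(n : ℝ)] A := by
  have hl : LipschitzWith 1 π := LipschitzWith.of_dist_le_mul fun x y => by
    rw [dist_eq_norm, dist_eq_norm, ← map_sub]; simpa using h (x - y)
  have := hl.hausdorffMeasure_image_le (d := (n : ℝ)) (by positivity) A
  simpa using this

lemma hd_le_of_antilip {n m : ℕ} {K R : ℝ} (hK : 0 < K) (hR : 0 < R)
    (f : EuclideanSpace ℝ (Fin m) → EuclideanSpace ℝ (Fin n)) (A : Set (EuclideanSpace ℝ (Fin m)))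
    (hf : ∀ x ∈ A, ∀ y ∈ A, dist x y ≤ K * dist (f x) (f y)) {w : EuclideanSpace ℝ (Fin n)}
    (hA : ∀ x ∈ A, f x ∈ ball w R) :
    μH[(n : ℝ)] A ≤ ENNReal.ofReal (K ^ n * (cn n * R ^ n)) := by
  rcases A.eq_empty_or_nonempty with h | ⟨x0, hx0⟩
  · simp [h]
  have hex : ∀ u : EuclideanSpace ℝ (Fin n), ∃ x, u ∈ f '' A → x ∈ A ∧ f x = u := by
    intro u
    by_cases hu : u ∈ f '' A
    · obtain ⟨x, hx⟩ := hu; exact ⟨x, fun _ => hx⟩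
    · exact ⟨x0, fun h => absurd h hu⟩
  choose g hg using hex
  have hl : LipschitzOnWith K.toNNReal g (f '' A) := by
    apply LipschitzOnWith.of_dist_le_mul
    intro u hu v hv
    have := hf _ (hg u hu).1 _ (hg v hv).1
    rw [(hg u hu).2, (hg v hv).2] at this
    rwa [Real.coe_toNNReal _ hK.le]
  have hAg : A ⊆ g '' (f '' A) := by
    intro x hx
    refine ⟨f x, mem_image_of_mem _ hx, ?_⟩
    have h1 := hg (f x) (mem_image_of_mem _ hx)
    have := hf _ h1.1 _ hx
    rw [h1.2] at this
    simpa using this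
  have h1 := hl.hausdorffMeasure_image_le (d := (n : ℝ)) (by positivity)
  have h2 : μH[(n : ℝ)] (f '' A) ≤ μH[(n : ℝ)] (ball w R) :=
    measure_mono (by rintro _ ⟨x, hx, rfl⟩; exact hA x hx)
  rw [hd_ball w hR] at h2
  refine (measure_mono hAg).trans (h1.trans ?_)
  rw [ENNReal.ofReal_mul (by positivity), ENNReal.ofReal_pow hK.le]
  simp only [ENNReal.rpow_natCast]
  gcongr
  exact le_rfl

lemma lower_of_components {n : ℕ} (F : Set (Euc n)) {x X₁ X₂ : Euc n} {r ρ : ℝ} (hρ : 0 < ρ)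
    (h1 : ball X₁ ρ ⊆ ball x r) (h2 : ball X₂ ρ ⊆ ball x r) (h3 : ball X₁ ρ ⊆ Fᶜ)
    (h4 : ball X₂ ρ ⊆ Fᶜ) (hne : connectedComponentIn Fᶜ X₁ ≠ connectedComponentIn Fᶜ X₂) :
    ENNReal.ofReal (cn n * ρ ^ n) ≤ μH[(n : ℝ)] (F ∩ ball x r) := by
  have hX : X₂ - X₁ ≠ 0 := by
    intro h; rw [sub_eq_zero] at h; exact hne (by rw [h])
  set v := X₂ - X₁ with hv
  set e := (‖v‖)⁻¹ • v with he
  have hvn : 0 < ‖v‖ := norm_pos_iff.2 hX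
  have hen : ‖e‖ = 1 := by
    rw [he, norm_smul, norm_inv, norm_norm, inv_mul_cancel₀ hvn.ne']
  obtain ⟨π, hπ, hπe, hsurj⟩ := exists_proj e hen
  have hπv : π v = 0 := by
    have : v = ‖v‖ • e := by rw [he, smul_smul, mul_inv_cancel₀ hvn.ne', one_smul]
    rw [this, map_smul, hπe, smul_zero]
  have hsub : ball (π X₁) ρ ⊆ π '' (F ∩ ball x r) := by
    intro w hw
    obtain ⟨u, hu, hun⟩ := hsurj (w - π X₁)
    have huρ : ‖u‖ < ρ := by rw [hun]; simpa [dist_eq_norm] using hw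
    have m1 : X₁ + u ∈ ball X₁ ρ := by simpa using huρ
    have m2 : X₂ + u ∈ ball X₂ ρ := by simpa using huρ
    have hex : ∃ f ∈ segment ℝ (X₁ + u) (X₂ + u), f ∈ F := by
      by_contra! hcon
      apply hne
      have c1 : X₁ + u ∈ connectedComponentIn Fᶜ X₁ :=
        (convex_ball X₁ ρ).isPreconnected.subset_connectedComponentIn (mem_ball_self hρ) h3 m1
      have c2 : X₂ + u ∈ connectedComponentIn Fᶜ X₂ :=
        (convex_ball X₂ ρ).isPreconnected.subset_connectedComponentIn (mem_ball_self hρ) h4 m2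
      have c3 : X₂ + u ∈ connectedComponentIn Fᶜ (X₁ + u) :=
        (convex_segment (X₁ + u) (X₂ + u)).isPreconnected.subset_connectedComponentIn
          (left_mem_segment _ _ _) (fun f hf => hcon f hf) (right_mem_segment _ _ _)
      rw [connectedComponentIn_eq c1, connectedComponentIn_eq c3, ← connectedComponentIn_eq c2]
    obtain ⟨f, hf, hfF⟩ := hex
    refine ⟨f, ⟨hfF, (convex_ball x r).segment_subset (h1 m1) (h2 m2) hf⟩, ?_⟩
    rw [segment_eq_image'] at hf
    obtain ⟨t, -, rfl⟩ := hf
    have : X₂ + u - (X₁ + u) = v := by rw [hv]; abel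
    simp only [this, map_add, map_smul, hπv, smul_zero, hu]
    abel
  calc _ = μH[(n : ℝ)] (ball (π X₁) ρ) := (hd_ball _ hρ).symm
    _ ≤ μH[(n : ℝ)] (π '' (F ∩ ball x r)) := measure_mono hsub
    _ ≤ _ := hd_image_le (lip_of_proj hπ) _

lemma component_subset_of_frontier {n : ℕ} {F Ω : Set (Euc n)} (hΩ : IsOpen Ω)
    (hF : frontier Ω ⊆ F) {X : Euc n} (hX : X ∈ Ω) : connectedComponentIn Fᶜ X ⊆ Ω := by
  by_cases hXF : X ∈ Fᶜ
  · have hpre := isPreconnected_connectedComponentIn (x := X) (F := Fᶜ)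
    apply hpre.subset_left_of_subset_union hΩ (isClosed_closure (s := Ω)).isOpen_compl
    · exact disjoint_compl_right.mono_right (compl_subset_compl.2 subset_closure)
    · intro y hy
      have hyF := connectedComponentIn_subset _ _ hy
      by_cases hy1 : y ∈ Ω
      · exact Or.inl hy1
      · right
        intro hy2
        exact hyF (hF ⟨hy2, by rwa [hΩ.interior_eq]⟩)
    · exact ⟨X, mem_connectedComponentIn hXF, hX⟩
  · simp [connectedComponentIn_eq_empty hXF]

lemma segment_meets_frontier {n : ℕ} {Ω : Set (Euc n)} {x y : Euc n} (hx : x ∈ Ω) (hy : y ∉ Ω) :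
    ∃ z ∈ segment ℝ x y, z ∈ frontier Ω := by
  have h := (convex_segment x y).isPreconnected
  by_contra! hcon
  have h2 := h (interior Ω) (closure Ω)ᶜ isOpen_interior isClosed_closure.isOpen_compl
    (fun z hz => by
      by_cases h1 : z ∈ closure Ω
      · left
        by_contra h3
        exact hcon z hz ⟨h1, h3⟩
      · exact Or.inr h1)
    ⟨x, left_mem_segment _ _ _, by
      by_contra h3
      exact hcon x (left_mem_segment _ _ _) ⟨subset_closure hx, h3⟩⟩
    ⟨y, right_mem_segment _ _ _, fun h3 =>
      hcon y (right_mem_segment _ _ _) ⟨h3, fun h4 => hy (interior_subset h4)⟩⟩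
  obtain ⟨z, -, hz1, hz2⟩ := h2
  exact hz2 (subset_closure (interior_subset hz1))

structure IsStar {n : ℕ} (κ : ℝ) (Ω : Set (Euc n)) (y : Euc n) (s : ℝ) : Prop where
  κpos : 0 < κ
  κle : κ ≤ 1
  op : IsOpen Ω
  spos : 0 < s
  sub : Ω ⊆ ball y s
  sup : ball y (κ * s) ⊆ Ω
  star : ∀ x ∈ Ω, ∀ b ∈ ball y (κ * s), ∀ t : ℝ, 0 ≤ t → t ≤ 1 → x + t • (b - x) ∈ Ω

lemma isStar_ball {n : ℕ} {κ : ℝ} (h0 : 0 < κ) (h1 : κ ≤ 1) (y : Euc n) {s : ℝ} (hs : 0 < s) :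
    IsStar κ (ball y s) y s := by
  have hsub : ball y (κ * s) ⊆ ball y s := ball_subset_ball (by nlinarith)
  refine ⟨h0, h1, isOpen_ball, hs, subset_rfl, hsub, ?_⟩
  intro x hx b hb t ht0 ht1
  exact (convex_ball y s).add_smul_sub_mem hx (hsub hb) ⟨ht0, ht1⟩

lemma infDist_ge_of_ball {n : ℕ} {Ω : Set (Euc n)} (hΩ : IsOpen Ω) (hne : (frontier Ω).Nonempty)
    {p : Euc n} {a : ℝ} (h : ball p a ⊆ Ω) : a ≤ infDist p (frontier Ω) := by
  rw [le_infDist hne]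
  intro f hf
  by_contra! hlt
  have : f ∈ Ω := h (by rw [mem_ball, dist_comm]; exact hlt)
  exact (hΩ.frontier_eq ▸ hf).2 this

lemma ball_infDist_subset {n : ℕ} {Ω : Set (Euc n)} {c : Euc n} (hc : c ∈ Ω) :
    ball c (infDist c (frontier Ω)) ⊆ Ω := by
  intro p hp
  by_contra hpΩ
  obtain ⟨f, hf, hfr⟩ := segment_meets_frontier hc hpΩ
  have h1 := infDist_le_dist_of_mem (x := c) hfr
  have hr : c ∈ ball c (infDist c (frontier Ω)) :=
    mem_ball_self (lt_of_le_of_lt dist_nonneg (mem_ball.1 hp))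
  have h2 := (convex_ball c _).segment_subset hr hp hf
  rw [mem_ball, dist_comm] at h2
  linarith

lemma comp_ne {n : ℕ} {F Ω : Set (Euc n)} (hΩ : IsOpen Ω) (hF : frontier Ω ⊆ F) {X₁ X₂ : Euc n}
    (h1 : X₁ ∈ Ω) (h2 : X₂ ∉ Ω) (h3 : X₂ ∉ F) :
    connectedComponentIn Fᶜ X₁ ≠ connectedComponentIn Fᶜ X₂ := by
  intro h
  have : X₂ ∈ connectedComponentIn Fᶜ X₁ := by rw [h]; exact mem_connectedComponentIn h3
  exact h2 (component_subset_of_frontier hΩ hF h1 this)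

lemma isADR_of {n : ℕ} {Ω : Set (Euc n)} {c K : ℝ} (hc : 0 < c) (hcs : StrongTwoSidedCorkscrew Ω c)
    (hu : ∀ z ∈ frontier Ω, ∀ R : ℝ, 0 < R →
      μH[(n : ℝ)] (frontier Ω ∩ ball z R) ≤ ENNReal.ofReal (K * R ^ n)) {C : ℝ} (hC : 1 ≤ C)
    (hKC : K ≤ C) (hcC : (cn n * c ^ n)⁻¹ ≤ C) : IsADR n (frontier Ω) C := by
  refine ⟨isClosed_frontier, hC, ?_⟩
  intro x hx r hr hrd
  constructor
  · obtain ⟨X₁, X₂, ⟨h1, h2, h3, h4, h5⟩, -⟩ := hcs x hx r hr hrd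
    refine le_trans ?_ (lower_of_components _ (by positivity) h1 h2 h3 h4 h5)
    apply ENNReal.ofReal_le_ofReal
    rw [mul_pow, ← mul_assoc]
    have := cn_pos n
    have h6 : C⁻¹ ≤ cn n * c ^ n := by
      rw [inv_le_comm₀ (by positivity) (by positivity)]; exact hcC
    gcongr
  · refine (hu x hx r hr).trans (ENNReal.ofReal_le_ofReal ?_)
    gcongr

/-! Harnack chains -/

def Linked {n : ℕ} (Ω : Set (Euc n)) (m : ℝ) (k : ℕ) (X X' : Euc n) : Prop :=
  ∃ c : ℕ → Euc n, c 0 = X ∧ c k = X' ∧ (∀ i ≤ k, c i ∈ Ω ∧ m ≤ infDist (c i) (frontier Ω)) ∧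
    ∀ i < k, dist (c i) (c (i + 1)) < m / 2

lemma Linked.trans {n : ℕ} {Ω : Set (Euc n)} {m : ℝ} {k l : ℕ} {X Y Z : Euc n}
    (h1 : Linked Ω m k X Y) (h2 : Linked Ω m l Y Z) : Linked Ω m (k + l) X Z := by
  obtain ⟨c, c0, ck, c1, c2⟩ := h1
  obtain ⟨d, d0, dl, d1, d2⟩ := h2
  refine ⟨fun i => if i ≤ k then c i else d (i - k), by simp [c0], ?_, ?_, ?_⟩
  · by_cases hl : l = 0
    · subst hl; simp [ck, ← dl, d0]
    · simp [hl, dl]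
  · intro i hi
    by_cases h : i ≤ k
    · simpa [h] using c1 i h
    · simpa [h] using d1 (i - k) (by omega)
  · intro i hi
    by_cases h : i + 1 ≤ k
    · have h' : i ≤ k := by omega
      simpa [h, h'] using c2 i (by omega)
    · by_cases h' : i ≤ k
      · have hik : i = k := by omega
        subst hik
        have := d2 0 (by omega)
        simp only [le_refl, if_true, h, if_false, ck, ← d0]
        simpa using this
      · have := d2 (i - k) (by omega)
        simp only [h, h', if_false]
        rwa [show i + 1 - k = i - k + 1 by omega]

lemma linked_segment {n : ℕ} {Ω : Set (Euc n)} {m L : ℝ} (hm : 0 < m) {X X' : Euc n}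
    (hL : dist X X' ≤ L) (h : ∀ t : ℝ, 0 ≤ t → t ≤ 1 → X + t • (X' - X) ∈ Ω ∧
      m ≤ infDist (X + t • (X' - X)) (frontier Ω)) : Linked Ω m (⌊2 * L / m⌋₊ + 1) X X' := by
  set k := ⌊2 * L / m⌋₊ + 1 with hk
  have hkpos : (0 : ℝ) < k := by positivity
  refine ⟨fun i => X + ((i : ℝ) / k) • (X' - X), by simp, ?_, ?_, ?_⟩
  · simp
  · intro i hi
    apply h _ (by positivity)
    rw [div_le_one hkpos]; exact_mod_cast hi
  · intro i hi
    have e : X + ((i : ℝ) / k) • (X' - X) - (X + (((i + 1 : ℕ) : ℝ) / k) • (X' - X)) =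
        (-(1 / (k : ℝ))) • (X' - X) := by
      rw [add_sub_add_left_eq_sub, ← sub_smul]; congr 1; push_cast; field_simp; ring
    rw [dist_eq_norm, e, norm_smul, ← dist_eq_norm, dist_comm X' X, norm_neg, Real.norm_eq_abs,
      abs_of_pos (by positivity)]
    have h1 : 2 * L / m < k := by rw [hk]; push_cast; exact Nat.lt_floor_add_one _
    rw [div_lt_iff₀ hm] at h1
    rw [one_div, inv_mul_lt_iff₀ hkpos]
    nlinarith

lemma diam_ball' {n : ℕ} (c : Euc n) {r : ℝ} (hr : 0 < r) : Metric.diam (ball c r) = 2 * r := by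
  rw [← Metric.diam_closure, closure_ball c hr.ne']
  exact Metric.diam_closedBall_eq c hr.le

lemma chain_of_linked {n : ℕ} {Ω : Set (Euc n)} (hne : (frontier Ω).Nonempty)
    {m : ℝ} (hm : 0 < m) {k : ℕ} {X X' : Euc n} (h : Linked Ω m k X X') :
    ∃ (ctr : ℕ → Euc n) (rad : ℕ → ℝ),
      X ∈ ball (ctr 0) (rad 0) ∧ X' ∈ ball (ctr (k + 1 - 1)) (rad (k + 1 - 1)) ∧
      (∀ i < k + 1, 0 < rad i ∧ ball (ctr i) (rad i) ⊆ Ω ∧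
        (2 : ℝ)⁻¹ * Metric.diam (ball (ctr i) (rad i)) ≤ sDist (ball (ctr i) (rad i)) (frontier Ω) ∧
        sDist (ball (ctr i) (rad i)) (frontier Ω) ≤ 2 * Metric.diam (ball (ctr i) (rad i))) ∧
      ∀ i : ℕ, i + 1 < k + 1 →
        (ball (ctr i) (rad i) ∩ ball (ctr (i + 1)) (rad (i + 1))).Nonempty := by
  obtain ⟨c, c0, ck, c1, c2⟩ := h
  refine ⟨c, fun i => infDist (c i) (frontier Ω) / 4, ?_, ?_, ?_, ?_⟩
  · have := (c1 0 (by omega)).2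
    rw [← c0]; exact mem_ball_self (by linarith)
  · have := (c1 k le_rfl).2
    simp only [Nat.add_sub_cancel]
    rw [← ck]; exact mem_ball_self (by linarith)
  · intro i hi
    obtain ⟨hΩ, hδ⟩ := c1 i (by omega)
    set δ := infDist (c i) (frontier Ω) with hδd
    have hδpos : 0 < δ := by linarith
    refine ⟨by linarith, (ball_subset_ball (by linarith)).trans (ball_infDist_subset hΩ), ?_, ?_⟩
    · rw [diam_ball' _ (by linarith)]
      apply le_csInf
      · obtain ⟨f, hf⟩ := hne
        exact ⟨_, mem_image2_of_mem (mem_ball_self (x := c i) (by linarith : 0 < δ / 4)) hf⟩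
      · rintro _ ⟨p, hp, f, hf, rfl⟩
        have h1 := infDist_le_dist_of_mem (x := c i) hf
        have h2 := dist_triangle_left (c i) f p
        rw [mem_ball] at hp
        linarith
    · rw [diam_ball' _ (by linarith)]
      have : sDist (ball (c i) (δ / 4)) (frontier Ω) ≤ δ := by
        rw [hδd, le_infDist hne, ← hδd]
        intro f hf
        apply csInf_le ⟨0, ?_⟩ (mem_image2_of_mem (mem_ball_self (by linarith)) hf)
        rintro _ ⟨p, hp, f, hf, rfl⟩
        exact dist_nonneg
      linarith
  · intro i hi
    have h1 := (c1 i (by omega)).2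
    have h2 := (c1 (i + 1) (by omega)).2
    have h3 := c2 i (by omega)
    refine ⟨midpoint ℝ (c i) (c (i + 1)), ?_, ?_⟩
    · rw [mem_ball, dist_midpoint_left]; norm_num; linarith
    · rw [mem_ball, dist_midpoint_right]; norm_num; linarith

namespace IsStar

variable {n : ℕ} {κ : ℝ} {Ω : Set (Euc n)} {y : Euc n} {s : ℝ}

lemma y_mem (h : IsStar κ Ω y s) : y ∈ Ω := h.sup (mem_ball_self (mul_pos h.κpos h.spos))

lemma dist_le (h : IsStar κ Ω y s) {x : Euc n} (hx : x ∈ closure Ω) : dist x y ≤ s :=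
  (closure_ball_subset_closedBall (closure_mono h.sub hx))

lemma s1 (h : IsStar κ Ω y s) {x : Euc n} (hx : x ∈ closure Ω) {t : ℝ} (ht0 : 0 < t) (ht1 : t ≤ 1) :
    ball (x + t • (y - x)) (t * (κ * s)) ⊆ Ω := by
  intro p hp
  rw [mem_ball, dist_eq_norm] at hp
  obtain ⟨x', hx', hd⟩ := Metric.mem_closure_iff.1 hx _ (sub_pos.2 hp)
  rw [dist_eq_norm] at hd
  have hb : x' + t⁻¹ • (p - x') ∈ ball y (κ * s) := by
    have e : x' + t⁻¹ • (p - x') - y =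
        t⁻¹ • ((p - (x + t • (y - x))) + (1 - t) • (x - x')) := by
      rw [smul_add, smul_sub, smul_sub t⁻¹ p (x + _), smul_add, smul_smul, smul_smul,
        inv_mul_cancel₀ ht0.ne', one_smul, mul_sub, inv_mul_cancel₀ ht0.ne']
      simp only [sub_smul, smul_sub, one_smul, mul_one]
      abel
    rw [mem_ball, dist_eq_norm, e, norm_smul, norm_inv, Real.norm_of_nonneg ht0.le,
      inv_mul_lt_iff₀ ht0]
    refine (norm_add_le _ _).trans_lt ?_
    rw [norm_smul, Real.norm_of_nonneg (by linarith)]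
    nlinarith [norm_nonneg (x - x')]
  have := h.star x' hx' _ hb t ht0.le ht1
  rwa [add_sub_cancel_left, smul_smul, mul_inv_cancel₀ ht0.ne', one_smul,
    add_sub_cancel] at this

lemma s2 (h : IsStar κ Ω y s) {x : Euc n} (hx : x ∉ Ω) {t : ℝ} (ht0 : 0 < t) :
    Disjoint (ball (x + t • (x - y)) (t * (κ * s))) Ω := by
  rw [Set.disjoint_left]
  intro p hp hpΩ
  rw [mem_ball, dist_eq_norm] at hp
  apply hx
  have hb : x + t⁻¹ • (x - p) ∈ ball y (κ * s) := by
    have e : x + t⁻¹ • (x - p) - y = (-t⁻¹) • (p - (x + t • (x - y))) := by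
      rw [neg_smul, smul_sub, smul_sub t⁻¹ p, smul_add, smul_smul, inv_mul_cancel₀ ht0.ne',
        one_smul]
      abel
    rw [mem_ball, dist_eq_norm, e, norm_smul, norm_neg, norm_inv, Real.norm_of_nonneg ht0.le,
      inv_mul_lt_iff₀ ht0]
    exact hp
  have := h.star p hpΩ _ hb (t / (1 + t)) (by positivity)
    (by rw [div_le_one (by positivity)]; linarith)
  have e2 : p + (t / (1 + t)) • (x + t⁻¹ • (x - p) - p) = x := by
    have : x + t⁻¹ • (x - p) - p = (1 + t⁻¹) • (x - p) := by
      rw [add_smul, one_smul]; abel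
    rw [this, smul_smul, show t / (1 + t) * (1 + t⁻¹) = 1 by field_simp; ring, one_smul]
    abel
  rwa [e2] at this

lemma inner_ball (h : IsStar κ Ω y s) {x : Euc n} (hx : x ∈ closure Ω) {r : ℝ} (hr : 0 < r)
    (hrs : r ≤ 2 * s) : ∃ X, ball X (κ / 2 * r) ⊆ Ω ∧ ball X (κ / 2 * r) ⊆ ball x r := by
  have hs := h.spos
  have ht : 0 < r / (2 * s) := by positivity
  have e : r / (2 * s) * (κ * s) = κ / 2 * r := by field_simp
  refine ⟨x + (r / (2 * s)) • (y - x), ?_, ?_⟩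
  · rw [← e]; exact h.s1 hx ht (by rw [div_le_one (by positivity)]; exact hrs)
  · apply ball_subset_ball'
    rw [dist_eq_norm, add_sub_cancel_left, norm_smul, Real.norm_of_nonneg ht.le, ← dist_eq_norm,
      dist_comm]
    have h1 := h.dist_le hx
    have h2 : r / (2 * s) * dist x y ≤ r / 2 := by
      calc _ ≤ r / (2 * s) * s := by gcongr
        _ = r / 2 := by field_simp
    nlinarith [h.κle]

lemma outer_ball (h : IsStar κ Ω y s) {x : Euc n} (hx : x ∈ closure Ω) (hx' : x ∉ Ω) {r : ℝ}
    (hr : 0 < r) : ∃ X, Disjoint (ball X (κ / 2 * r)) Ω ∧ ball X (κ / 2 * r) ⊆ ball x r := by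
  have hs := h.spos
  have ht : 0 < r / (2 * s) := by positivity
  have e : r / (2 * s) * (κ * s) = κ / 2 * r := by field_simp
  refine ⟨x + (r / (2 * s)) • (x - y), ?_, ?_⟩
  · rw [← e]; exact h.s2 hx' ht
  · apply ball_subset_ball'
    rw [dist_eq_norm, add_sub_cancel_left, norm_smul, Real.norm_of_nonneg ht.le, ← dist_eq_norm]
    have h1 := h.dist_le hx
    have h2 : r / (2 * s) * dist x y ≤ r / 2 := by
      calc _ ≤ r / (2 * s) * s := by gcongr
        _ = r / 2 := by field_simp
    nlinarith [h.κle]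

lemma isConnected (h : IsStar κ Ω y s) : IsConnected Ω := by
  refine ⟨⟨y, h.y_mem⟩, ?_⟩
  have : StarConvex ℝ y Ω := by
    rw [starConvex_iff_segment_subset]
    intro x hx
    rw [segment_symm, segment_eq_image']
    rintro _ ⟨t, ht, rfl⟩
    exact h.star x hx y (mem_ball_self (mul_pos h.κpos h.spos)) t ht.1 ht.2
  exact (this.isPathConnected h.y_mem).isConnected.isPreconnected

lemma ediam_frontier_le (h : IsStar κ Ω y s) : ediam (frontier Ω) ≤ ENNReal.ofReal (2 * s) := by
  apply ediam_le
  intro a ha b hb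
  rw [edist_dist]
  apply ENNReal.ofReal_le_ofReal
  have h1 := h.dist_le ha.1
  have h2 := h.dist_le hb.1
  linarith [dist_triangle_right a b y]

lemma corkscrew (h : IsStar κ Ω y s) : StrongTwoSidedCorkscrew Ω (κ / 2) := by
  intro x hx r hr hrd
  have hκ := h.κpos
  have hx' : x ∉ Ω := (h.op.frontier_eq ▸ hx).2
  have hrs : r ≤ 2 * s := by
    have := hrd.trans_le h.ediam_frontier_le
    exact ((ENNReal.ofReal_lt_ofReal_iff (by have := h.spos; positivity)).1 this).le
  obtain ⟨X₁, a1, a2⟩ := h.inner_ball hx.1 hr hrs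
  obtain ⟨X₂, b1, b2⟩ := h.outer_ball hx.1 hx' hr
  have b3 : ball X₂ (κ / 2 * r) ⊆ (frontier Ω)ᶜ := fun p hp hf =>
    Set.disjoint_left.1 (b1.closure_right isOpen_ball) hp hf.1
  refine ⟨X₁, X₂, ⟨a2, b2, ?_, b3, ?_⟩, Or.inl a1⟩
  · intro p hp hf
    exact (h.op.frontier_eq ▸ hf).2 (a1 hp)
  · have m1 := mem_ball_self (x := X₁) (by positivity : 0 < κ / 2 * r)
    have m2 := mem_ball_self (x := X₂) (by positivity : 0 < κ / 2 * r)
    exact comp_ne h.op subset_rfl (a1 m1) (Set.disjoint_left.1 b1 m2) (b3 m2)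

lemma harnack (h : IsStar κ Ω y s) :
    HarnackChainCond Ω 2 (fun Λ => 3 * (⌊8 * Λ / κ ^ 2⌋₊ + 1) + 1) := by
  refine ⟨by norm_num, ?_⟩
  intro ρ hρ Λ hΛ X hX X' hX' hδ hδ' hd
  have hκ := h.κpos
  have hκ1 := h.κle
  have hs := h.spos
  have hne : (frontier Ω).Nonempty := by
    by_contra hcon
    rw [not_nonempty_iff_eq_empty] at hcon
    simp [hcon] at hδ; linarith
  set m := κ * ρ / 2 with hm
  have hmpos : 0 < m := by positivity
  set L := 2 * Λ * ρ / κ with hL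
  set T := min 1 (2 * Λ * ρ / (κ * s)) with hT
  have hT0 : 0 < T := lt_min one_pos (by positivity)
  have hT1 : T ≤ 1 := min_le_left _ _
  -- δ ≤ s
  have hδs : ∀ Z ∈ Ω, ρ ≤ infDist Z (frontier Ω) → ρ ≤ s := by
    intro Z hZ hρZ
    have h1 : ball Z ρ ⊆ ball y s :=
      (ball_subset_ball hρZ).trans ((ball_infDist_subset hZ).trans h.sub)
    have h2 := diam_mono h1 isBounded_ball
    rw [diam_ball' _ hρ, diam_ball' _ hs] at h2
    linarith
  have hpath : ∀ Z ∈ Ω, ρ ≤ infDist Z (frontier Ω) → ∀ t : ℝ, 0 ≤ t → t ≤ 1 →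
      Z + t • (y - Z) ∈ Ω ∧ m ≤ infDist (Z + t • (y - Z)) (frontier Ω) := by
    intro Z hZ hρZ t ht0 ht1
    have hρs := hδs Z hZ hρZ
    refine ⟨h.star Z hZ y (mem_ball_self (by positivity)) t ht0 ht1, ?_⟩
    rcases le_total t (1 / 2) with ht | ht
    · have : ball (Z + t • (y - Z)) ((1 - t) * ρ) ⊆ Ω := by
        intro p hp
        have h1t : 0 < 1 - t := by linarith
        have hw : Z + (1 - t)⁻¹ • (p - (Z + t • (y - Z))) ∈ Ω := by
          apply ball_infDist_subset hZ
          rw [mem_ball, dist_eq_norm, add_sub_cancel_left, norm_smul, norm_inv,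
            Real.norm_of_nonneg h1t.le, inv_mul_lt_iff₀ h1t, ← dist_eq_norm]
          exact (mem_ball.1 hp).trans_le (by gcongr)
        have := h.star _ hw y (mem_ball_self (by positivity)) t ht0 ht1
        convert this using 1
        set q := p - (Z + t • (y - Z)) with hq
        have hp' : p = q + (Z + t • (y - Z)) := by rw [hq]; abel
        rw [hp', ← sub_sub, smul_sub t (y - Z), smul_smul]
        have e : q = (1 - t)⁻¹ • q - (t * (1 - t)⁻¹) • q := by
          rw [← sub_smul, show (1 - t)⁻¹ - t * (1 - t)⁻¹ = 1 by field_simp, one_smul]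
        nth_rewrite 1 [e]
        abel
      have := infDist_ge_of_ball h.op hne this
      have : m ≤ (1 - t) * ρ := by rw [hm]; nlinarith
      linarith
    · have := infDist_ge_of_ball h.op hne (h.s1 (subset_closure hZ) (by linarith : 0 < t) ht1)
      have : m ≤ t * (κ * s) := by
        rw [hm]
        have : κ * ρ ≤ κ * s := by gcongr
        nlinarith [mul_pos hκ hs]
      linarith
  have hTs : T * s ≤ L := by
    calc T * s ≤ 2 * Λ * ρ / (κ * s) * s := by gcongr; exact min_le_right _ _
      _ = L := by rw [hL]; field_simp
  have hleg : ∀ Z ∈ Ω, ρ ≤ infDist Z (frontier Ω) →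
      Linked Ω m (⌊2 * L / m⌋₊ + 1) Z (Z + T • (y - Z)) := by
    intro Z hZ hρZ
    apply linked_segment hmpos
    · rw [dist_eq_norm, sub_add_cancel_left, norm_neg, norm_smul, Real.norm_of_nonneg hT0.le,
        ← dist_eq_norm, dist_comm]
      exact le_trans (by gcongr; exact h.dist_le (subset_closure hZ)) hTs
    · intro t ht0 ht1
      rw [add_sub_cancel_left, smul_smul]
      exact hpath Z hZ hρZ _ (by positivity) (by nlinarith)
  have hlegr : ∀ Z ∈ Ω, ρ ≤ infDist Z (frontier Ω) →
      Linked Ω m (⌊2 * L / m⌋₊ + 1) (Z + T • (y - Z)) Z := by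
    intro Z hZ hρZ
    apply linked_segment hmpos
    · rw [dist_eq_norm, add_sub_cancel_left, norm_smul, Real.norm_of_nonneg hT0.le,
        ← dist_eq_norm, dist_comm]
      exact le_trans (by gcongr; exact h.dist_le (subset_closure hZ)) hTs
    · intro t ht0 ht1
      have e : Z + T • (y - Z) + t • (Z - (Z + T • (y - Z))) = Z + ((1 - t) * T) • (y - Z) := by
        rw [sub_add_cancel_left, smul_neg, smul_smul, sub_mul, sub_smul, one_mul]; abel
      rw [e]
      exact hpath Z hZ hρZ _ (mul_nonneg (by linarith) hT0.le) (by nlinarith)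
  have hmid : Linked Ω m (⌊2 * L / m⌋₊ + 1) (X + T • (y - X)) (X' + T • (y - X')) := by
    have e0 : X' + T • (y - X') - (X + T • (y - X)) = (1 - T) • (X' - X) := by
      simp only [smul_sub, sub_smul, one_smul]; abel
    have hdd : dist (X + T • (y - X)) (X' + T • (y - X')) ≤ (1 - T) * (Λ * ρ) := by
      rw [dist_comm, dist_eq_norm, e0, norm_smul, Real.norm_of_nonneg (by linarith),
        ← dist_eq_norm, dist_comm]
      gcongr
    have hΛρL : Λ * ρ ≤ L := by
      rw [hL, le_div_iff₀ hκ]; nlinarith [mul_pos (by linarith : 0 < Λ) hρ]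
    apply linked_segment hmpos
    · refine hdd.trans ?_
      nlinarith [mul_pos (by linarith : 0 < Λ) hρ]
    · intro t ht0 ht1
      have hball := h.s1 (subset_closure hX) hT0 hT1
      have hsub : ball (X + T • (y - X) + t • (X' + T • (y - X') - (X + T • (y - X)))) m ⊆ Ω := by
        refine Subset.trans (ball_subset_ball' ?_) hball
        rw [dist_eq_norm, add_sub_cancel_left, norm_smul, Real.norm_of_nonneg ht0,
          ← dist_eq_norm, dist_comm]
        have h1 : t * dist (X + T • (y - X)) (X' + T • (y - X')) ≤ (1 - T) * (Λ * ρ) := by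
          refine le_trans ?_ hdd
          nlinarith [dist_nonneg (x := X + T • (y - X)) (y := X' + T • (y - X'))]
        refine (add_le_add_right h1 m).trans ?_
        have hρs := hδs X hX hδ
        have hΛρ : ρ ≤ Λ * ρ := by nlinarith
        rcases le_total 1 (2 * Λ * ρ / (κ * s)) with h1 | h1
        · have : T = 1 := min_eq_left h1
          rw [this, hm]
          have : κ * ρ ≤ κ * s := by gcongr
          nlinarith [mul_pos hκ hs]
        · have : T = 2 * Λ * ρ / (κ * s) := min_eq_right h1
          have h3 : T * (κ * s) = 2 * Λ * ρ := by rw [this]; field_simp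
          rw [h3, hm]
          nlinarith
      exact ⟨hsub (mem_ball_self hmpos), infDist_ge_of_ball h.op hne hsub⟩
  have hall := ((hleg X hX hδ).trans hmid).trans (hlegr X' hX' hδ')
  have e3 : 2 * L / m = 8 * Λ / κ ^ 2 := by rw [hL, hm]; field_simp; norm_num
  rw [e3] at hall
  refine ⟨_, Nat.succ_pos _, ?_, chain_of_linked hne hmpos hall⟩
  simp only; omega

/-- surface upper bound constant for star domains -/
def sc (n : ℕ) (κ : ℝ) : ℝ := (1 + 16 / κ) ^ (n + 1) * ((6 / κ) ^ n * cn n)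

lemma upper_local (h : IsStar κ Ω y s) {z : Euc n} (hz : z ∈ frontier Ω) {R : ℝ} (hR : 0 < R)
    (hRs : R ≤ κ * s / 2) :
    μH[(n : ℝ)] (frontier Ω ∩ ball z R) ≤ ENNReal.ofReal ((3 / κ) ^ n * (cn n * R ^ n)) := by
  have hκ := h.κpos
  have hκ1 := h.κle
  have hs := h.spos
  have hfr : ∀ x ∈ frontier Ω, x ∉ Ω := fun x hx => (h.op.frontier_eq ▸ hx).2
  have hzy : κ * s ≤ ‖z - y‖ := by
    by_contra! hlt
    exact hfr z hz (h.sup (by rwa [mem_ball, dist_eq_norm]))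
  have hzs : ‖z - y‖ ≤ s := by rw [← dist_eq_norm]; exact h.dist_le hz.1
  have hzp : 0 < ‖z - y‖ := by nlinarith [mul_pos hκ hs]
  set D := ‖z - y‖ with hD
  set e := D⁻¹ • (z - y) with he
  have hen : ‖e‖ = 1 := by
    rw [he, norm_smul, norm_inv, hD, norm_norm, inv_mul_cancel₀ hzp.ne']
  have hDe : D • e = z - y := by rw [he, smul_smul, mul_inv_cancel₀ hzp.ne', one_smul]
  obtain ⟨π, hπ, hπe, -⟩ := exists_proj e hen
  have key : ∀ x ∈ frontier Ω ∩ ball z R, ∀ x' ∈ frontier Ω ∩ ball z R,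
      -⟪x' - x, e⟫ ≤ 2 / κ * ‖π (x' - x)‖ := by
    intro x hx x' hx'
    set w := x' - x with hw
    set τ := -⟪w, e⟫ with hτ
    by_contra! hcon
    have hτ0 : 0 < τ := lt_of_le_of_lt (by positivity) hcon
    set t := τ / D with ht
    have ht0 : 0 < t := by positivity
    have hxz := mem_ball.1 hx.2
    have hxz' := mem_ball.1 hx'.2
    have hwn : ‖w‖ ≤ κ * s := by
      rw [hw, ← dist_eq_norm]; linarith [dist_triangle_right x' x z]
    have hτw : τ ≤ ‖w‖ := by
      have := abs_real_inner_le_norm w e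
      rw [hen, mul_one] at this
      linarith [neg_abs_le ⟪w, e⟫]
    have ht1 : t ≤ 1 := by rw [ht, div_le_one hzp]; linarith
    apply hfr x' hx'.1
    apply h.s1 hx.1.1 ht0 ht1
    rw [mem_ball, dist_eq_norm]
    have e1 : x' - (x + t • (y - x)) = (w + τ • e) + t • (x - z) := by
      have : τ • e = t • (z - y) := by
        rw [he, smul_smul, ht, div_eq_mul_inv]
      rw [this, hw]; simp only [smul_sub]; abel
    have e2 : ‖w + τ • e‖ = ‖π w‖ := by
      have h1 := hπ (w + τ • e)
      rw [map_add, map_smul, hπe, smul_zero, add_zero, inner_add_left, inner_smul_left,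
        real_inner_self_eq_norm_sq, hen] at h1
      have h2 : ⟪w, e⟫ + (starRingEnd ℝ) τ * 1 ^ 2 = 0 := by simp [hτ]
      rw [h2] at h1
      have h3 : ‖w + τ • e‖ ^ 2 = ‖π w‖ ^ 2 := by rw [h1]; ring
      exact (pow_left_inj₀ (norm_nonneg _) (norm_nonneg _) two_ne_zero).1 h3
    rw [e1]
    refine (norm_add_le _ _).trans_lt ?_
    rw [e2, norm_smul, Real.norm_of_nonneg ht0.le, ← dist_eq_norm]
    have h5 : ‖π w‖ < τ * κ / 2 := by
      have : 2 / κ * ‖π w‖ = ‖π w‖ / (κ / 2) := by field_simp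
      rw [this, div_lt_iff₀ (by positivity)] at hcon
      linarith
    have h6 : τ ≤ t * s := by
      rw [ht, div_mul_eq_mul_div, le_div_iff₀ hzp]; gcongr
    have h7 : t * dist x z ≤ t * (κ * s / 2) := by gcongr; linarith
    nlinarith
  have hanti : ∀ x ∈ frontier Ω ∩ ball z R, ∀ x' ∈ frontier Ω ∩ ball z R,
      dist x x' ≤ 3 / κ * dist (π x) (π x') := by
    intro x hx x' hx'
    have k1 := key x hx x' hx'
    have k2 := key x' hx' x hx
    have e3 : π (x - x') = -π (x' - x) := by rw [← map_neg, neg_sub]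
    have e4 : x - x' = -(x' - x) := by abel
    rw [e3, norm_neg, e4, inner_neg_left, neg_neg] at k2
    rw [dist_comm, dist_eq_norm, dist_comm, dist_eq_norm, ← map_sub]
    set w := x' - x
    have h1 := hπ w
    have hsq : ⟪w, e⟫ ^ 2 ≤ (2 / κ * ‖π w‖) ^ 2 := sq_le_sq' (by linarith) k2
    have hκ' : 1 ≤ 1 / κ := by rw [le_div_iff₀ hκ]; linarith
    apply (sq_le_sq₀ (norm_nonneg _) (by positivity)).1
    have e5 : (3 / κ * ‖π w‖) ^ 2 = 9 * (1 / κ * ‖π w‖) ^ 2 := by ring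
    have e6 : (2 / κ * ‖π w‖) ^ 2 = 4 * (1 / κ * ‖π w‖) ^ 2 := by ring
    have h8 : ‖π w‖ ^ 2 ≤ (1 / κ * ‖π w‖) ^ 2 := by
      apply pow_le_pow_left₀ (norm_nonneg _)
      nlinarith [norm_nonneg (π w)]
    nlinarith [sq_nonneg (1 / κ * ‖π w‖)]
  exact hd_le_of_antilip (by positivity) hR π _ hanti (w := π z) (fun x hx => by
    have := lip_of_proj hπ (x - z)
    rw [map_sub] at this
    have h3 := mem_ball.1 hx.2
    rw [mem_ball, dist_eq_norm]
    rw [dist_eq_norm] at h3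
    linarith)

lemma upper (h : IsStar κ Ω y s) (z : Euc n) {R : ℝ} (hR : 0 < R) :
    μH[(n : ℝ)] (frontier Ω ∩ ball z R) ≤ ENNReal.ofReal (sc n κ * R ^ n) := by
  have hκ := h.κpos
  have hs := h.spos
  have hcn := cn_pos n
  have h016 : 0 < 16 / κ := by positivity
  have h16 : (1:ℝ) ≤ (1 + 16 / κ) ^ (n + 1) := one_le_pow₀ (by linarith)
  have e36 : ∀ R : ℝ, (3 / κ) ^ n * (cn n * (2 * R) ^ n) = (6 / κ) ^ n * cn n * R ^ n := by
    intro R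
    rw [mul_pow, show (6 / κ) = 3 / κ * 2 by ring, mul_pow]; ring
  rcases le_total R (κ * s / 4) with hsm | hbig
  · rcases (frontier Ω ∩ ball z R).eq_empty_or_nonempty with h0 | ⟨z', hz', hzz⟩
    · simp [h0]
    · have hsub : frontier Ω ∩ ball z R ⊆ frontier Ω ∩ ball z' (2 * R) := by
        apply inter_subset_inter_right
        apply ball_subset_ball'
        rw [dist_comm]; have := mem_ball.1 hzz; linarith
      refine (measure_mono hsub).trans ((h.upper_local hz' (by positivity) (by linarith)).trans ?_)
      apply ENNReal.ofReal_le_ofReal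
      rw [e36, sc]
      have : 0 ≤ (6 / κ) ^ n * cn n * R ^ n := by positivity
      nlinarith
  · have hsubset : frontier Ω ⊆ ball y (2 * s) := fun x hx => by
      have := h.dist_le hx.1
      rw [mem_ball]; linarith
    obtain ⟨T, hT, -, hcov, hcard⟩ := exists_net (frontier Ω) (s := κ * s / 4) (by positivity)
      (by positivity) hsubset
    have hsub : frontier Ω ∩ ball z R ⊆ ⋃ t ∈ T, frontier Ω ∩ ball t (κ * s / 4) := by
      rintro p ⟨hp, -⟩
      obtain ⟨t, ht, hyt⟩ := hcov p hp
      exact mem_iUnion₂.2 ⟨t, ht, hp, hyt⟩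
    calc μH[(n : ℝ)] (frontier Ω ∩ ball z R)
        ≤ ∑ t ∈ T, μH[(n : ℝ)] (frontier Ω ∩ ball t (κ * s / 4)) :=
          (measure_mono hsub).trans (measure_biUnion_finset_le _ _)
      _ ≤ ∑ t ∈ T, ENNReal.ofReal ((6 / κ) ^ n * cn n * R ^ n) := by
          apply Finset.sum_le_sum
          intro t ht
          refine (h.upper_local (hT ht) (by positivity)
            (by nlinarith [mul_pos hκ hs])).trans ?_
          apply ENNReal.ofReal_le_ofReal
          rw [← e36]
          gcongr
          linarith
      _ = ENNReal.ofReal (T.card * ((6 / κ) ^ n * cn n * R ^ n)) := by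
          rw [Finset.sum_const, nsmul_eq_mul, ENNReal.ofReal_mul (p := (T.card : ℝ)) (by positivity),
              ENNReal.ofReal_natCast]
      _ ≤ _ := by
          apply ENNReal.ofReal_le_ofReal
          have e : 1 + 2 * (2 * s) / (κ * s / 4) = 1 + 16 / κ := by field_simp; norm_num
          rw [e] at hcard
          rw [sc, mul_assoc ((1 + 16 / κ) ^ (n + 1))]
          gcongr

end IsStar

structure StarFamily {n : ℕ} (κ c1 C2 CE : ℝ) (E Y : Set (Euc n)) (ι : Type) (Ω : ι → Set (Euc n))
    (y : ι → Euc n) (s : ι → ℝ) (Dd : ℝ≥0∞) : Prop where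
  c1pos : 0 < c1
  c1le : c1 ≤ 1
  C2ge : 1 ≤ C2
  CEpos : 0 ≤ CE
  cl : IsClosed E
  up : ∀ (z : Euc n) (R : ℝ), 0 < R → μH[(n : ℝ)] (E ∩ ball z R) ≤ ENNReal.ofReal (CE * R ^ n)
  YE : Y ⊆ E
  Dpos : 0 < Dd
  star : ∀ i, IsStar κ (Ω i) (y i) (s i)
  disj : ∀ i j, i ≠ j → Disjoint (Ω i) (Ω j)
  sub : ∀ i, Disjoint (Ω i) E
  near : ∀ i, ∃ e ∈ Y, dist e (y i) ≤ C2 * s i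
  cork : ∀ e ∈ Y, ∀ r : ℝ, 0 < r → ENNReal.ofReal r ≤ Dd →
    ∃ i X, ball X (c1 * r) ⊆ Ω i ∧ ball X (c1 * r) ⊆ ball e r
  pack : ∀ (z : Euc n) (R : ℝ), 0 < R → ∀ T : Finset ι, (∀ i ∈ T, s i ≤ R ∧ y i ∈ ball z R) →
    ∑ i ∈ T, (s i) ^ n ≤ C2 * R ^ n
  diam : ediam (⋃ i, Ω i) ≤ ENNReal.ofReal C2 * Dd

lemma StrongTwoSidedCorkscrew.mono {n : ℕ} {Ω : Set (Euc n)} {c c' : ℝ} (hc : c' ≤ c)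
    (h : StrongTwoSidedCorkscrew Ω c) : StrongTwoSidedCorkscrew Ω c' := by
  intro x hx r hr hrd
  obtain ⟨X₁, X₂, ⟨h1, h2, h3, h4, h5⟩, h6⟩ := h x hx r hr hrd
  have hs : ∀ X : Euc n, ball X (c' * r) ⊆ ball X (c * r) := fun X =>
    ball_subset_ball (by gcongr)
  exact ⟨X₁, X₂, ⟨(hs _).trans h1, (hs _).trans h2, (hs _).trans h3, (hs _).trans h4, h5⟩,
    h6.imp (fun h => (hs _).trans h) (fun h => (hs _).trans h)⟩

namespace StarFamily

variable {n : ℕ} {κ c1 C2 CE : ℝ} {E Y : Set (Euc n)} {ι : Type} {Ω : ι → Set (Euc n)}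
    {y : ι → Euc n} {s : ι → ℝ} {Dd : ℝ≥0∞}

lemma isOpen (h : StarFamily κ c1 C2 CE E Y ι Ω y s Dd) : IsOpen (⋃ i, Ω i) :=
  isOpen_iUnion fun i => (h.star i).op

lemma subE (h : StarFamily κ c1 C2 CE E Y ι Ω y s Dd) : (⋃ i, Ω i) ⊆ Eᶜ :=
  iUnion_subset fun i => (h.sub i).subset_compl_right

lemma Ysub (h : StarFamily κ c1 C2 CE E Y ι Ω y s Dd) : Y ⊆ frontier (⋃ i, Ω i) := by
  intro e he
  rw [h.isOpen.frontier_eq]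
  refine ⟨?_, fun h2 => h.subE h2 (h.YE he)⟩
  rw [Metric.mem_closure_iff]
  intro ε hε
  obtain ⟨r, hr0, hr⟩ : ∃ r : ℝ, 0 < r ∧ ENNReal.ofReal r ≤ Dd := by
    rcases eq_or_ne Dd ⊤ with h1 | h1
    · exact ⟨1, one_pos, by simp [h1]⟩
    · exact ⟨Dd.toReal, ENNReal.toReal_pos h.Dpos.ne' h1, by rw [ENNReal.ofReal_toReal h1]⟩
  obtain ⟨i, X, h1, h2⟩ := h.cork e he (min ε r) (lt_min hε hr0)
    ((ENNReal.ofReal_le_ofReal (min_le_right _ _)).trans hr)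
  have hX := mem_ball_self (x := X) (mul_pos h.c1pos (lt_min hε hr0))
  refine ⟨X, mem_iUnion.2 ⟨i, h1 hX⟩, ?_⟩
  have := mem_ball.1 (h2 hX)
  rw [dist_comm]
  exact this.trans_le (min_le_left _ _)

lemma frontier_sub (h : StarFamily κ c1 C2 CE E Y ι Ω y s Dd) (i : ι) :
    frontier (Ω i) ⊆ frontier (⋃ i, Ω i) := by
  intro x hx
  rw [(h.star i).op.frontier_eq] at hx
  rw [h.isOpen.frontier_eq]
  refine ⟨closure_mono (subset_iUnion Ω i) hx.1, ?_⟩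
  rw [mem_iUnion]
  rintro ⟨j, hj⟩
  by_cases hij : i = j
  · subst hij; exact hx.2 hj
  · exact Set.disjoint_left.1 ((h.disj i j hij).closure_left (h.star j).op) hx.1 hj

lemma component (h : StarFamily κ c1 C2 CE E Y ι Ω y s Dd) {X : Euc n} (hX : X ∈ ⋃ i, Ω i) :
    ∃ i, connectedComponentIn (⋃ i, Ω i) X = Ω i := by
  obtain ⟨i, hi⟩ := mem_iUnion.1 hX
  refine ⟨i, Subset.antisymm ?_ ?_⟩
  · apply isPreconnected_connectedComponentIn.subset_left_of_subset_union (h.star i).op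
      (isOpen_iUnion fun j => isOpen_iUnion fun _ : j ≠ i => (h.star j).op)
    · rw [disjoint_iUnion_right]; intro j
      rw [disjoint_iUnion_right]; intro hj
      exact h.disj i j hj.symm
    · intro p hp
      obtain ⟨j, hj⟩ := mem_iUnion.1 (connectedComponentIn_subset _ _ hp)
      by_cases hji : j = i
      · subst hji; exact Or.inl hj
      · exact Or.inr (mem_iUnion₂.2 ⟨j, hji, hj⟩)
    · exact ⟨X, mem_connectedComponentIn hX, hi⟩
  · exact (h.star i).isConnected.isPreconnected.subset_connectedComponentIn hi
      (subset_iUnion Ω i)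

lemma find (h : StarFamily κ c1 C2 CE E Y ι Ω y s Dd) {x : Euc n} (hx : x ∈ closure (⋃ i, Ω i))
    {r : ℝ} (hr : 0 < r) (hrD : ENNReal.ofReal (r / C2) ≤ Dd) :
    ∃ k, ∃ X ∈ Ω k, dist X x < r / 8 ∧ c1 / (100 * C2) * r ≤ s k := by
  have hC := h.C2ge
  have hc := h.c1pos
  have hc1 := h.c1le
  obtain ⟨p, hp, hpx⟩ := Metric.mem_closure_iff.1 hx (1 / (100 * C2) * r) (by positivity)
  obtain ⟨i, hi⟩ := mem_iUnion.1 hp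
  have hsm : 1 / (100 * C2) * r ≤ r / 100 := by
    rw [div_mul_eq_mul_div, one_mul]; gcongr; linarith
  rcases le_or_gt (1 / (100 * C2) * r) (s i) with h1 | h1
  · refine ⟨i, p, hi, by rw [dist_comm]; linarith, le_trans ?_ h1⟩
    gcongr
  · obtain ⟨e, heY, he⟩ := h.near i
    have hpy := mem_ball.1 ((h.star i).sub hi)
    have hs := (h.star i).spos
    have h2 : C2 * s i ≤ r / 100 := by
      calc C2 * s i ≤ C2 * (1 / (100 * C2) * r) := by gcongr
        _ = r / 100 := by field_simp
    have hex : dist e x ≤ 3 * r / 100 := by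
      have := dist_triangle4 e (y i) p x
      rw [dist_comm (y i) p, dist_comm p x] at this
      linarith
    have hle : r / (50 * C2) ≤ r / C2 := by gcongr; linarith
    have hr50 : r / (50 * C2) ≤ r / 50 := by gcongr; linarith
    obtain ⟨k, X, k1, k2⟩ := h.cork e heY (r / (50 * C2)) (by positivity)
      ((ENNReal.ofReal_le_ofReal hle).trans hrD)
    have hρ : 0 < c1 * (r / (50 * C2)) := by positivity
    have hX := mem_ball_self (x := X) hρ
    have hXe := mem_ball.1 (k2 hX)
    refine ⟨k, X, k1 hX, ?_, ?_⟩
    · linarith [dist_triangle X e x]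
    · have h3 := diam_mono (k1.trans (h.star k).sub) isBounded_ball
      rw [diam_ball' _ hρ, diam_ball' _ (h.star k).spos] at h3
      have e1 : c1 / (100 * C2) * r = c1 * (r / (50 * C2)) / 2 := by field_simp; norm_num
      linarith

/-- the corkscrew constant -/
def c0 (κ c1 C2 : ℝ) : ℝ := κ / 2 * (c1 / (100 * C2) * (κ / 8))

lemma corkscrew (h : StarFamily κ c1 C2 CE E Y ι Ω y s Dd) (hκ : 0 < κ) (hκ1 : κ ≤ 1) :
    StrongTwoSidedCorkscrew (⋃ i, Ω i) (c0 κ c1 C2) := by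
  intro x hx r hr hrd
  have hC := h.C2ge
  have hc := h.c1pos
  have hc1 := h.c1le
  set β := c1 / (100 * C2) with hβ
  have hβ0 : 0 < β := by positivity
  have hβ1 : β ≤ 1 / 100 := by
    rw [hβ]; gcongr; linarith
  have hfr := h.isOpen.frontier_eq ▸ hx
  have hrD : ENNReal.ofReal (r / C2) ≤ Dd := by
    have h1 : ediam (frontier (⋃ i, Ω i)) ≤ ediam (⋃ i, Ω i) := by
      calc _ ≤ ediam (closure (⋃ i, Ω i)) := ediam_mono frontier_subset_closure
        _ = _ := ediam_closure _
    have h2 := hrd.le.trans (h1.trans h.diam)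
    rw [ENNReal.ofReal_div_of_pos (by linarith)]
    exact ENNReal.div_le_of_le_mul' h2
  obtain ⟨k, X, hXk, hXx, hsk⟩ := h.find hfr.1 hr hrD
  rw [← hβ] at hsk
  have hxk : x ∉ Ω k := fun h1 => hfr.2 (mem_iUnion.2 ⟨k, h1⟩)
  obtain ⟨x1, hx1s, hx1⟩ := segment_meets_frontier hXk hxk
  have hx1x : dist x1 x < r / 8 := by
    have := (convex_ball x (r / 8)).segment_subset (mem_ball.2 hXx)
      (mem_ball_self (by positivity)) hx1s
    exact this
  have hx1' := (h.star k).op.frontier_eq ▸ hx1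
  have hsp := (h.star k).spos
  obtain ⟨X₁, a1, a2⟩ := (h.star k).inner_ball hx1'.1 (r := β * r) (by positivity) (by linarith)
  obtain ⟨X', b1, b2⟩ := (h.star k).outer_ball hx1'.1 hx1'.2 (r := r / 2) (by positivity)
  have hc0 : c0 κ c1 C2 * r = κ / 2 * (β * r) * (κ / 8) := by rw [c0, ← hβ]; ring
  have hκβ : 0 < κ / 2 * (β * r) := by positivity
  have hc0a : c0 κ c1 C2 * r ≤ κ / 2 * (β * r) := by rw [hc0]; nlinarith
  have hc0pos : 0 < c0 κ c1 C2 * r := by rw [hc0]; positivity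
  have hβr : β * r ≤ r / 100 := by nlinarith
  have hc0b : c0 κ c1 C2 * r ≤ κ * r / 8 := by
    rw [hc0]
    have : κ / 2 * (β * r) ≤ r := by nlinarith
    nlinarith
  have A1 : ball X₁ (c0 κ c1 C2 * r) ⊆ Ω k := (ball_subset_ball hc0a).trans a1
  have A2 : ball X₁ (c0 κ c1 C2 * r) ⊆ ball x r :=
    (ball_subset_ball hc0a).trans (a2.trans (ball_subset_ball' (by linarith)))
  have Anotfr : ∀ j, ∀ p ∈ Ω j, p ∉ frontier (⋃ i, Ω i) := fun j p hp hf =>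
    (h.isOpen.frontier_eq ▸ hf).2 (mem_iUnion.2 ⟨j, hp⟩)
  have B2 : ball X' (κ / 2 * (r / 2)) ⊆ ball x r := b2.trans (ball_subset_ball' (by linarith))
  have mX1 : X₁ ∈ Ω k := A1 (mem_ball_self hc0pos)
  suffices hsuf : ∃ X₂, ball X₂ (c0 κ c1 C2 * r) ⊆ ball x r ∧
      ball X₂ (c0 κ c1 C2 * r) ⊆ (frontier (⋃ i, Ω i))ᶜ ∧ X₂ ∉ Ω k by
    obtain ⟨X₂, u1, u2, u3⟩ := hsuf
    refine ⟨X₁, X₂, ⟨A2, u1, fun p hp => Anotfr k p (A1 hp), u2, ?_⟩,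
      Or.inl (A1.trans (subset_iUnion Ω k))⟩
    exact comp_ne (h.star k).op (h.frontier_sub k) mX1 u3 (u2 (mem_ball_self hc0pos))
  by_cases hA : Disjoint (ball X' (κ * r / 8)) (⋃ i, Ω i)
  · refine ⟨X', (ball_subset_ball (by linarith)).trans B2, ?_, ?_⟩
    · intro p hp hf
      exact Set.disjoint_left.1 (hA.closure_right isOpen_ball) (ball_subset_ball hc0b hp) hf.1
    · exact Set.disjoint_left.1 b1 (mem_ball_self (by positivity))
  · rw [Set.not_disjoint_iff] at hA
    obtain ⟨p, hp1, hp2⟩ := hA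
    obtain ⟨m, Xm, hXm, hXmp, hsm⟩ := h.find (subset_closure hp2) (r := κ / 8 * r) (by positivity)
      (le_trans (ENNReal.ofReal_le_ofReal (by gcongr; nlinarith)) hrD)
    rw [← hβ] at hsm
    have hspm := (h.star m).spos
    obtain ⟨X₂, d1, d2⟩ := (h.star m).inner_ball (subset_closure hXm) (r := β * (κ / 8 * r))
      (by positivity) (by linarith)
    have hc0c : κ / 2 * (β * (κ / 8 * r)) = c0 κ c1 C2 * r := by rw [hc0]; ring
    rw [hc0c] at d1 d2
    have hXmX' : dist Xm X' < κ / 2 * (r / 2) := by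
      have := dist_triangle Xm p X'
      have := mem_ball.1 hp1
      nlinarith
    have hmk : m ≠ k := by
      rintro rfl
      exact Set.disjoint_left.1 b1 (mem_ball.2 hXmX') hXm
    refine ⟨X₂, d2.trans (ball_subset_ball' ?_), fun q hq => Anotfr m q (d1 hq),
      Set.disjoint_left.1 (h.disj m k hmk) (d1 (mem_ball_self hc0pos))⟩
    have hb := mem_ball.1 (b2 (mem_ball.2 hXmX'))
    have h9 : β * (κ / 8 * r) ≤ r / 100 := by
      have : κ / 8 * r ≤ r := by nlinarith
      nlinarith
    linarith [dist_triangle Xm x1 x]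

lemma count (h : StarFamily κ c1 C2 CE E Y ι Ω y s Dd) (hκ : 0 < κ) {z : Euc n} {R : ℝ} (hR : 0 < R)
    (T : Finset ι) (hT : ∀ i ∈ T, R ≤ s i ∧ (Ω i ∩ ball z R).Nonempty) :
    (T.card : ℝ) ≤ (4 / κ) ^ (n + 1) := by
  have : ∀ i : ι, ∃ X, i ∈ T → ball X (κ / 2 * R) ⊆ Ω i ∧ ball X (κ / 2 * R) ⊆ ball z (2 * R) := by
    intro i
    by_cases hi : i ∈ T
    · obtain ⟨h1, p, hp, hpz⟩ := hT i hi
      obtain ⟨X, hX1, hX2⟩ := (h.star i).inner_ball (subset_closure hp) hR (by linarith)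
      refine ⟨X, fun _ => ⟨hX1, hX2.trans (ball_subset_ball' ?_)⟩⟩
      have := mem_ball.1 hpz
      linarith
    · exact ⟨z, fun h => absurd h hi⟩
  choose c hc using this
  have := card_disjoint_balls T c (s := κ / 2 * R) (R := 2 * R) (z := z) (by positivity)
    (by positivity) (fun i hi j hj hij => (h.disj i j hij).mono (hc i hi).1 (hc j hj).1)
    (fun i hi => (hc i hi).2)
  rw [← le_div_iff₀ (by positivity), ← div_pow] at this
  have e : 2 * R / (κ / 2 * R) = 4 / κ := by field_simp; norm_num
  rwa [e] at this

lemma frontier_cover (h : StarFamily κ c1 C2 CE E Y ι Ω y s Dd) (hκ : 0 < κ) :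
    frontier (⋃ i, Ω i) ⊆ E ∪ ⋃ i, frontier (Ω i) := by
  intro x hx
  by_cases hxE : x ∈ E
  · exact Or.inl hxE
  right
  rw [h.isOpen.frontier_eq] at hx
  have hC := h.C2ge
  obtain ⟨δ, hδ, hball⟩ := Metric.isOpen_iff.1 h.cl.isOpen_compl x hxE
  set R := δ / (4 * C2) with hR
  have hR0 : 0 < R := by positivity
  have hRδ : R ≤ δ / 4 := by rw [hR]; gcongr; linarith
  have hCR : C2 * R = δ / 4 := by rw [hR]; field_simp
  let S : Set ι := {i | (Ω i ∩ ball x R).Nonempty}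
  have hS : ∀ i ∈ S, R ≤ s i := by
    rintro i ⟨p, hp, hpx⟩
    by_contra! hlt
    obtain ⟨e, he, hey⟩ := h.near i
    refine hball (a := e) ?_ (h.YE he)
    have h1 := mem_ball.1 ((h.star i).sub hp)
    have h2 := mem_ball.1 hpx
    have h3 := dist_triangle4 e (y i) p x
    rw [dist_comm (y i) p] at h3
    have h4 : C2 * s i ≤ C2 * R := by gcongr
    rw [mem_ball]; linarith
  have hfin : S.Finite := by
    by_contra hinf
    obtain ⟨T, hT1, hT2⟩ := Set.Infinite.exists_subset_card_eq hinf (⌊(4 / κ) ^ (n + 1)⌋₊ + 1)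
    have := h.count hκ hR0 T (fun i hi => ⟨hS i (hT1 hi), hT1 hi⟩)
    rw [hT2] at this
    have h2 := Nat.lt_floor_add_one ((4 / κ) ^ (n + 1))
    push_cast at this
    linarith
  have hxc : x ∈ closure (⋃ i ∈ S, Ω i) := by
    rw [Metric.mem_closure_iff]
    intro ε hε
    obtain ⟨p, hp, hpx⟩ := Metric.mem_closure_iff.1 hx.1 (min ε R) (lt_min hε hR0)
    obtain ⟨i, hi⟩ := mem_iUnion.1 hp
    refine ⟨p, mem_iUnion₂.2 ⟨i, ⟨p, hi, ?_⟩, hi⟩, hpx.trans_le (min_le_left _ _)⟩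
    rw [mem_ball, dist_comm]
    exact hpx.trans_le (min_le_right _ _)
  rw [hfin.closure_biUnion] at hxc
  obtain ⟨i, -, hi⟩ := mem_iUnion₂.1 hxc
  refine mem_iUnion.2 ⟨i, ?_⟩
  rw [(h.star i).op.frontier_eq]
  exact ⟨hi, fun h2 => hx.2 (mem_iUnion.2 ⟨i, h2⟩)⟩

/-- the upper constant -/
def cup (n : ℕ) (κ C2 CE : ℝ) : ℝ :=
  CE + (IsStar.sc n κ * 2 ^ n * (C2 * 2 ^ n) + (4 / κ) ^ (n + 1) * IsStar.sc n κ)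

lemma sc_nonneg (n : ℕ) (hκ : 0 < κ) : 0 ≤ IsStar.sc n κ := by
  have := cn_pos n
  unfold IsStar.sc; positivity

lemma upper [Countable ι] (h : StarFamily κ c1 C2 CE E Y ι Ω y s Dd) (hκ : 0 < κ) (z : Euc n)
    {R : ℝ} (hR : 0 < R) :
    μH[(n : ℝ)] (frontier (⋃ i, Ω i) ∩ ball z R) ≤ ENNReal.ofReal (cup n κ C2 CE * R ^ n) := by
  classical
  have hC := h.C2ge
  have hsc := sc_nonneg n hκ
  have hsub : frontier (⋃ i, Ω i) ∩ ball z R ⊆ (E ∩ ball z R) ∪ ⋃ i, (frontier (Ω i) ∩ ball z R) := by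
    rintro x ⟨hx, hxz⟩
    rcases h.frontier_cover hκ hx with h1 | h1
    · exact Or.inl ⟨h1, hxz⟩
    · obtain ⟨i, hi⟩ := mem_iUnion.1 h1
      exact Or.inr (mem_iUnion.2 ⟨i, hi, hxz⟩)
  have hsum : μH[(n : ℝ)] (⋃ i, (frontier (Ω i) ∩ ball z R)) ≤ ENNReal.ofReal
      ((IsStar.sc n κ * 2 ^ n * (C2 * 2 ^ n) + (4 / κ) ^ (n + 1) * IsStar.sc n κ) * R ^ n) := by
    refine (measure_iUnion_le _).trans ?_
    rw [ENNReal.tsum_eq_iSup_sum]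
    apply iSup_le
    intro T
    set f : ι → ℝ := fun i => if (frontier (Ω i) ∩ ball z R).Nonempty then
      (if s i < R then IsStar.sc n κ * 2 ^ n * s i ^ n else IsStar.sc n κ * R ^ n) else 0 with hf
    have hf0 : ∀ i, 0 ≤ f i := by
      intro i
      have := (h.star i).spos
      simp only [hf]; split_ifs <;> positivity
    have h1 : ∀ i ∈ T, μH[(n : ℝ)] (frontier (Ω i) ∩ ball z R) ≤ ENNReal.ofReal (f i) := by
      intro i _
      by_cases hne : (frontier (Ω i) ∩ ball z R).Nonempty
      · by_cases hsi : s i < R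
        · simp only [hf, hne, hsi, if_true]
          have hs := (h.star i).spos
          have hle : frontier (Ω i) ∩ ball z R ⊆ frontier (Ω i) ∩ ball (y i) (2 * s i) := by
            rintro p ⟨hp, -⟩
            refine ⟨hp, ?_⟩
            have := (h.star i).dist_le hp.1
            rw [mem_ball]; linarith
          refine (measure_mono hle).trans (((h.star i).upper (y i) (by positivity)).trans ?_)
          rw [mul_pow, mul_assoc]
        · simp only [hf, hne, hsi, if_true, if_false]
          exact (h.star i).upper z hR
      · rw [not_nonempty_iff_eq_empty.1 hne]; simp
    refine (Finset.sum_le_sum h1).trans ?_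
    rw [← ENNReal.ofReal_sum_of_nonneg (fun i _ => hf0 i)]
    apply ENNReal.ofReal_le_ofReal
    set T0 := T.filter (fun i => (frontier (Ω i) ∩ ball z R).Nonempty) with hT0
    have e1 : ∑ i ∈ T, f i = ∑ i ∈ T0, (if s i < R then IsStar.sc n κ * 2 ^ n * s i ^ n
        else IsStar.sc n κ * R ^ n) := by
      rw [hT0, Finset.sum_filter]
    rw [e1, Finset.sum_ite]
    have h2 : ∑ i ∈ T0.filter (fun i => s i < R), IsStar.sc n κ * 2 ^ n * s i ^ n ≤
        IsStar.sc n κ * 2 ^ n * (C2 * 2 ^ n) * R ^ n := by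
      rw [← Finset.mul_sum, mul_assoc (IsStar.sc n κ * 2 ^ n)]
      have := h.pack z (2 * R) (by positivity) (T0.filter (fun i => s i < R)) ?_
      · rw [mul_assoc C2, ← mul_pow]
        exact mul_le_mul_of_nonneg_left this (by positivity)
      · intro i hi
        simp only [hT0, Finset.mem_filter] at hi
        obtain ⟨⟨-, p, hp, hpz⟩, hsR⟩ := hi
        refine ⟨by linarith, ?_⟩
        have h3 := (h.star i).dist_le hp.1
        have h4 := mem_ball.1 hpz
        rw [mem_ball]
        linarith [dist_triangle_left (y i) z p]
    have h3 : ∑ i ∈ T0.filter (fun i => ¬ s i < R), IsStar.sc n κ * R ^ n ≤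
        (4 / κ) ^ (n + 1) * IsStar.sc n κ * R ^ n := by
      rw [Finset.sum_const, nsmul_eq_mul, mul_assoc]
      apply mul_le_mul_of_nonneg_right _ (by positivity)
      apply h.count hκ hR (z := z)
      intro i hi
      simp only [hT0, Finset.mem_filter, not_lt] at hi
      obtain ⟨⟨-, p, hp, hpz⟩, hsR⟩ := hi
      refine ⟨hsR, ?_⟩
      have := mem_closure_iff.1 hp.1 _ isOpen_ball hpz
      rwa [inter_comm]
    linarith
  calc _ ≤ μH[(n : ℝ)] (E ∩ ball z R) + μH[(n : ℝ)] (⋃ i, (frontier (Ω i) ∩ ball z R)) :=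
        (measure_mono hsub).trans (measure_union_le _ _)
    _ ≤ _ := add_le_add (h.up z R hR) hsum
    _ = _ := by
      have := h.CEpos
      rw [← ENNReal.ofReal_add (by positivity) (by positivity), cup]
      congr 1; ring

end StarFamily

theorem assembly (n : ℕ) {κ c1 C2 CE : ℝ} (hκ : 0 < κ) (hκ1 : κ ≤ 1) (hc1 : 0 < c1) (hc1' : c1 ≤ 1)
    (hC2 : 1 ≤ C2) :
    ∃ (c₀ C : ℝ) (Nb : ℝ → ℕ), 0 < c₀ ∧ c₀ < 1 ∧ 1 ≤ C ∧
      ∀ (E Y : Set (Euc n)) (ι : Type) (Ω : ι → Set (Euc n)) (y : ι → Euc n) (s : ι → ℝ) (Dd : ℝ≥0∞),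
        Countable ι → StarFamily κ c1 C2 CE E Y ι Ω y s Dd →
        IsOpen (⋃ i, Ω i) ∧ (⋃ i, Ω i) ⊆ Eᶜ ∧ IsADR n (frontier (⋃ i, Ω i)) C ∧
        StrongTwoSidedCorkscrew (⋃ i, Ω i) c₀ ∧ Y ⊆ frontier (⋃ i, Ω i) ∧
        ∀ X ∈ ⋃ i, Ω i, IsNTA (connectedComponentIn (⋃ i, Ω i) X) c₀ C Nb ∧
              IsADR n (frontier (connectedComponentIn (⋃ i, Ω i) X)) C := by
  have hcn := cn_pos n
  have hc0 : 0 < StarFamily.c0 κ c1 C2 := by unfold StarFamily.c0; positivity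
  have hb : c1 / (100 * C2) ≤ 1 := by rw [div_le_one (by positivity)]; linarith
  have hb0 : 0 < c1 / (100 * C2) := by positivity
  have hc0κ : StarFamily.c0 κ c1 C2 ≤ κ / 2 := by
    unfold StarFamily.c0
    have : c1 / (100 * C2) * (κ / 8) ≤ 1 := by nlinarith
    nlinarith
  set C := max 2 (max (StarFamily.cup n κ C2 CE) (max (cn n * StarFamily.c0 κ c1 C2 ^ n)⁻¹
    (IsStar.sc n κ))) with hC
  have hC2' : 2 ≤ C := le_max_left _ _
  have hCup : StarFamily.cup n κ C2 CE ≤ C := (le_max_left _ _).trans (le_max_right _ _)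
  have hCc : (cn n * StarFamily.c0 κ c1 C2 ^ n)⁻¹ ≤ C :=
    (le_max_left _ _).trans ((le_max_right _ _).trans (le_max_right _ _))
  have hCsc : IsStar.sc n κ ≤ C :=
    (le_max_right _ _).trans ((le_max_right _ _).trans (le_max_right _ _))
  refine ⟨StarFamily.c0 κ c1 C2, C, fun Λ => 3 * (⌊8 * Λ / κ ^ 2⌋₊ + 1) + 1, hc0, by linarith,
    by linarith, ?_⟩
  intro E Y ι Ω y s Dd hcount h
  have hcork := h.corkscrew hκ hκ1
  refine ⟨h.isOpen, h.subE, isADR_of hc0 hcork (fun z _ R hR => h.upper hκ z hR) (by linarith)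
    hCup hCc, hcork, h.Ysub, ?_⟩
  intro X hX
  obtain ⟨i, hi⟩ := h.component hX
  rw [hi]
  have hci := (h.star i).corkscrew.mono hc0κ
  refine ⟨⟨(h.star i).op, (h.star i).isConnected, ?_, hci⟩,
    isADR_of hc0 hci (fun z _ R hR => (h.star i).upper z hR) (by linarith) hCsc hCc⟩
  obtain ⟨-, hh⟩ := (h.star i).harnack
  refine ⟨by linarith, ?_⟩
  intro ρ hρ Λ hΛ X hX X' hX' h1 h2 h3
  obtain ⟨N, N0, N1, ctr, rad, g1, g2, g3, g4⟩ := hh ρ hρ Λ hΛ X hX X' hX' h1 h2 h3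
  refine ⟨N, N0, N1, ctr, rad, g1, g2, fun i hi => ?_, g4⟩
  obtain ⟨k1, k2, k3, k4⟩ := g3 i hi
  have hd := Metric.diam_nonneg (s := ball (ctr i) (rad i))
  refine ⟨k1, k2, le_trans ?_ k3, k4.trans ?_⟩
  · gcongr
  · gcongr

def Slab {n : ℕ} (E : Set (Euc n)) (v : Euc n) (r : ℝ) (x : Euc n) : Prop :=
  ∀ y ∈ E, dist y x < r → |⟪y - x, v⟫| ≤ r / 10

def RunV {n : ℕ} (E : Set (Euc n)) (v : Euc n) (r : ℝ) (i j : ℕ) (x : Euc n) : Prop :=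
  ∀ t, i ≤ t → t ≤ j → Slab E v (r / 2 ^ t) x

def Run {n : ℕ} (E : Set (Euc n)) (V : Finset (Euc n)) (r : ℝ) (i j : ℕ) (x : Euc n) : Prop :=
  ∃ v ∈ V, RunV E v r i j x

def GoodK {n : ℕ} (E : Set (Euc n)) (V : Finset (Euc n)) (r : ℝ) (N K : ℕ) (x : Euc n) : Prop :=
  ∃ P : Finset ℕ, P.card ≤ N ∧ ∀ i j, i < j → j ≤ K → (∀ p ∈ P, p ≤ i ∨ j < p) → Run E V r i j x

def KEY (n : ℕ) (CE θ : ℝ) (M₀ : ℝ≥0) (V : Finset (Euc n)) : Prop :=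
  ∃ c : ℝ, 0 < c ∧ ∃ N : ℕ, ∀ E : Set (Euc n), IsUR n E CE θ M₀ → ∀ y ∈ E, ∀ r : ℝ, 0 < r →
    ENNReal.ofReal r < ediam E →
    ENNReal.ofReal (c * r ^ n) ≤ μH[(n : ℝ)] {x ∈ E ∩ ball y r | ∀ K, GoodK E V r N K x}

lemma slab_measurable {n : ℕ} (E : Set (Euc n)) (v : Euc n) (r : ℝ) : Measurable (Slab E v r) := by
  rw [← measurableSet_setOf]
  have : {x | Slab E v r x} = ⋂ y ∈ E, {x | dist y x < r ∧ r / 10 < |⟪y - x, v⟫|}ᶜ := by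
    ext x
    simp [Slab]
  rw [this]
  apply IsClosed.measurableSet
  refine isClosed_biInter fun y _ => IsOpen.isClosed_compl ?_
  have h1 : IsOpen {x : Euc n | dist y x < r} := isOpen_lt (by fun_prop) (by fun_prop)
  have h2 : IsOpen {x : Euc n | r / 10 < |⟪y - x, v⟫|} := isOpen_lt (by fun_prop) (by fun_prop)
  exact h1.inter h2

lemma runV_measurable {n : ℕ} (E : Set (Euc n)) (v : Euc n) (r : ℝ) (i j : ℕ) :
    Measurable (RunV E v r i j) := by
  unfold RunV
  refine Measurable.forall fun t => Measurable.imp measurable_const (Measurable.imp measurable_const ?_)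
  exact slab_measurable E v _

lemma run_measurable {n : ℕ} (E : Set (Euc n)) (V : Finset (Euc n)) (r : ℝ) (i j : ℕ) :
    Measurable (Run E V r i j) := by
  rw [← measurableSet_setOf]
  have : {x | Run E V r i j x} = ⋃ v ∈ V, {x | RunV E v r i j x} := by ext x; simp [Run]
  rw [this]
  exact Finset.measurableSet_biUnion _ fun v _ => measurableSet_setOf.2 (runV_measurable E v r i j)

lemma goodK_measurable {n : ℕ} (E : Set (Euc n)) (V : Finset (Euc n)) (r : ℝ) (N K : ℕ) :
    Measurable (GoodK E V r N K) := by
  unfold GoodK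
  refine Measurable.exists fun P => Measurable.and measurable_const ?_
  refine Measurable.forall fun i => Measurable.forall fun j => Measurable.imp measurable_const
    (Measurable.imp measurable_const (Measurable.imp measurable_const ?_))
  exact run_measurable E V r i j

lemma runV_shift {n : ℕ} {E : Set (Euc n)} {v : Euc n} {r : ℝ} {k i j : ℕ} {x : Euc n}
    (h : RunV E v (r / 2 ^ k) i j x) : RunV E v r (k + i) (k + j) x := by
  intro t h1 h2
  have := h (t - k) (by omega) (by omega)
  rwa [div_div, ← pow_add, show k + (t - k) = t by omega] at this

lemma runV_unshift {n : ℕ} {E : Set (Euc n)} {v : Euc n} {r : ℝ} {k i j : ℕ} {x : Euc n}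
    (h : RunV E v r (k + i) (k + j) x) : RunV E v (r / 2 ^ k) i j x := by
  intro t h1 h2
  rw [div_div, ← pow_add]
  exact h (k + t) (by omega) (by omega)

lemma goodK_unshift {n : ℕ} {E : Set (Euc n)} {V : Finset (Euc n)} {r : ℝ} {k N K : ℕ} {x : Euc n}
    (h : GoodK E V (r / 2 ^ k) N K x) : GoodK E V r (N + k) (K + k) x := by
  classical
  obtain ⟨P, hP, h⟩ := h
  refine ⟨P.image (· + k) ∪ Finset.Icc 1 k, ?_, ?_⟩
  · refine (Finset.card_union_le _ _).trans ?_
    have := Finset.card_image_le (s := P) (f := (· + k))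
    simp only [Nat.card_Icc]; omega
  · intro i j hij hjK hp
    have hik : k ≤ i := by
      by_contra! hlt
      have := hp (i + 1) (by simp; omega)
      omega
    obtain ⟨v, hv, hr⟩ := h (i - k) (j - k) (by omega) (by omega) (fun p hpP => by
      have := hp (p + k) (by simp [hpP])
      omega)
    refine ⟨v, hv, ?_⟩
    have := runV_shift hr
    rwa [show k + (i - k) = i by omega, show k + (j - k) = j by omega] at this

lemma goodK_mono {n : ℕ} {E : Set (Euc n)} {V : Finset (Euc n)} {r : ℝ} {N K K' : ℕ} {x : Euc n}
    (hK : K ≤ K') (h : GoodK E V r N K' x) : GoodK E V r N K x := by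
  obtain ⟨P, hP, h⟩ := h
  exact ⟨P, hP, fun i j h1 h2 h3 => h i j h1 (h2.trans hK) h3⟩

lemma free_ball (n : ℕ) (CE : ℝ) : ∃ c : ℝ, 0 < c ∧ c ≤ 1 / 4 ∧ ∀ E : Set (Euc n), IsADR n E CE →
    ∀ x ∈ E, ∀ r : ℝ, 0 < r → ENNReal.ofReal r < ediam E →
      ∃ X, Disjoint (ball X (c * r)) E ∧ ball X (c * r) ⊆ ball x (r / 2) := by
  rcases lt_or_ge CE 1 with hlt | hCE
  · exact ⟨1 / 4, by norm_num, le_rfl, fun E hE => absurd hE.2.1 (not_le.2 hlt)⟩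
  set K : ℝ := 16 ^ (n + 1) * CE ^ 2 with hK
  have hK0 : 1 ≤ K := by
    have : (1:ℝ) ≤ 16 ^ (n + 1) := one_le_pow₀ (by norm_num)
    have : (1:ℝ) ≤ CE ^ 2 := one_le_pow₀ hCE
    rw [hK]; nlinarith
  refine ⟨1 / (8 * K), by positivity, by gcongr; linarith, ?_⟩
  intro E hE x hx r hr hrd
  set η := 1 / (8 * K) with hη
  have hη0 : 0 < η := by positivity
  have hη8 : η ≤ 1 / 8 := by rw [hη]; gcongr; linarith
  by_contra! hcon
  obtain ⟨T, hTA, hsep, hcov, -⟩ := exists_net (ball x (r / 4)) (s := 4 * (η * r)) (R := r / 4) (z := x)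
    (by positivity) (by positivity) subset_rfl
  have hex : ∀ X : Euc n, ∃ e, X ∈ T → e ∈ E ∧ dist e X < η * r := by
    intro X
    by_cases hX : X ∈ T
    · have h1 := mem_ball.1 (hTA hX)
      by_contra! h2
      refine hcon X ?_ (ball_subset_ball' ?_)
      · rw [Set.disjoint_left]
        intro e he heE
        have := h2 e
        rw [mem_ball] at he
        exact absurd (this.2 heE) (not_le.2 he)
      · nlinarith
    · exact ⟨x, fun h => absurd h hX⟩
  choose e he using hex
  have hcard : (1 / 4 : ℝ) ^ (n + 1) ≤ T.card * (4 * η) ^ (n + 1) := by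
    have h1 : volume (ball x (r / 4)) ≤ ∑ t ∈ T, volume (ball t (4 * (η * r))) :=
      (measure_mono (fun p hp => by
        obtain ⟨t, ht, h⟩ := hcov p hp
        exact mem_iUnion₂.2 ⟨t, ht, h⟩)).trans (measure_biUnion_finset_le T fun t => ball t (4 * (η * r)))
    have hfr : Module.finrank ℝ (Euc n) = n + 1 := by simp
    simp only [Measure.addHaar_ball_of_pos volume _ (by positivity : 0 < r / 4),
      Measure.addHaar_ball_of_pos volume _ (by positivity : 0 < 4 * (η * r)), hfr,
      Finset.sum_const, nsmul_eq_mul] at h1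
    rw [← mul_assoc] at h1
    have h3 := (ENNReal.mul_le_mul_iff_left (measure_ball_pos volume (0 : Euc n) one_pos).ne'
      measure_ball_lt_top.ne).1 h1
    rw [← ENNReal.ofReal_natCast, ← ENNReal.ofReal_mul (by positivity)] at h3
    have h4 := (ENNReal.ofReal_le_ofReal_iff (by positivity)).1 h3
    have e1 : r / 4 = 1 / 4 * r := by ring
    have e2 : 4 * (η * r) = 4 * η * r := by ring
    rw [e1, e2, mul_pow, mul_pow _ r, ← mul_assoc] at h4
    exact le_of_mul_le_mul_right h4 (by positivity)
  have hmeas : (T.card : ℝ) * (CE⁻¹ * (η * r) ^ n) ≤ CE * r ^ n := by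
    have h1 : ∑ t ∈ T, μH[(n : ℝ)] (E ∩ ball (e t) (η * r)) ≤ μH[(n : ℝ)] (E ∩ ball x r) := by
      rw [← measure_biUnion_finset]
      · apply measure_mono
        refine iUnion₂_subset fun t ht => inter_subset_inter_right _ (ball_subset_ball' ?_)
        have h2 := (he t ht).2
        have h3 := mem_ball.1 (hTA ht)
        nlinarith [dist_triangle (e t) t x]
      · intro t ht t' ht' htt
        apply (ball_disjoint_ball _).mono inter_subset_right inter_subset_right
        have h1 := hsep t ht t' ht' htt
        have h2 := (he t ht).2
        have h3 := (he t' ht').2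
        have h4 := dist_triangle4 t (e t) (e t') t'
        rw [dist_comm t (e t)] at h4
        linarith
      · intro t _
        exact hE.1.measurableSet.inter measurableSet_ball
    have h2 : ∑ t ∈ T, ENNReal.ofReal (CE⁻¹ * (η * r) ^ n) ≤ ENNReal.ofReal (CE * r ^ n) := by
      refine (Finset.sum_le_sum fun t ht => ?_).trans (h1.trans (hE.2.2 x hx r hr hrd).2)
      refine (hE.2.2 _ (he t ht).1 _ (by positivity) (lt_of_le_of_lt ?_ hrd)).1
      apply ENNReal.ofReal_le_ofReal
      nlinarith
    rw [Finset.sum_const, nsmul_eq_mul, ← ENNReal.ofReal_natCast,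
      ← ENNReal.ofReal_mul (by positivity)] at h2
    exact (ENNReal.ofReal_le_ofReal_iff (by positivity)).1 h2
  have h5 : (T.card : ℝ) * η ^ n ≤ CE ^ 2 := by
    have e3 : (T.card : ℝ) * (CE⁻¹ * (η * r) ^ n) = (T.card * η ^ n * CE⁻¹) * r ^ n := by
      rw [mul_pow]; ring
    rw [e3] at hmeas
    have := le_of_mul_le_mul_right hmeas (by positivity)
    rw [← div_eq_mul_inv, div_le_iff₀ (by positivity)] at this
    nlinarith
  have h6 : (1:ℝ) ≤ 16 ^ (n + 1) * CE ^ 2 * η := by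
    have e4 : (T.card : ℝ) * (4 * η) ^ (n + 1) = 4 ^ (n + 1) * (T.card * η ^ n) * η := by
      rw [mul_pow, pow_succ η]; ring
    rw [e4, div_pow, one_pow, div_le_iff₀ (by positivity)] at hcard
    have e5 : (16:ℝ) ^ (n + 1) = 4 ^ (n + 1) * 4 ^ (n + 1) := by rw [← mul_pow]; norm_num
    rw [e5]
    calc (1:ℝ) ≤ 4 ^ (n + 1) * (T.card * η ^ n) * η * 4 ^ (n + 1) := hcard
      _ ≤ 4 ^ (n + 1) * (CE ^ 2) * η * 4 ^ (n + 1) := by gcongr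
      _ = _ := by ring
  rw [← hK, hη] at h6
  have : K * (1 / (8 * K)) = 1 / 8 := by field_simp
  rw [this] at h6
  norm_num at h6

lemma cone_dom {n : ℕ} {E S : Set (Euc n)} {v x : Euc n} {ρ : ℝ} (hρ : 0 < ρ) (hv : ‖v‖ = 1)
    (hS : S ⊆ ball x (ρ / 32)) (hne : ∃ x' ∈ S, RunV E v ρ 0 3 x') :
    ∃ Ω : Set (Euc n), IsStar (1 / 32) Ω (x + (ρ / 4) • v) ρ ∧ Disjoint Ω E ∧ Ω ⊆ ball x (ρ / 2) ∧
      ∀ x' ∈ S, ∀ j, RunV E v ρ 0 (j + 3) x' → ∃ q ∈ Ω, dist q x' < ρ / 2 ^ j / 4 := by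
  set y0 := x + (ρ / 4) • v with hy0
  set p : Euc n → ℕ → Euc n := fun x' L => x' + (ρ / 2 ^ L) • v with hp
  set Ω : Set (Euc n) := {q | ∃ x' ∈ S, ∃ L, 2 ≤ L ∧ RunV E v ρ 0 L x' ∧ ∃ t : ℝ, 0 < t ∧ t ≤ 1 ∧
    q ∈ ball (p x' L + t • (y0 - p x' L)) (t * (ρ / 32))} with hΩ
  have hkey : ∀ x' ∈ S, ∀ L, 2 ≤ L → ∀ t : ℝ, 0 < t → t ≤ 1 →
      ∀ q ∈ ball (p x' L + t • (y0 - p x' L)) (t * (ρ / 32)),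
      3 / 5 * dist q x' ≤ ⟪q - x', v⟫ ∧ ρ / 2 ^ (L + 1) ≤ dist q x' ∧ dist q x' ≤ 5 * ρ / 16 := by
    intro x' hx' L hL t ht0 ht1 q hq
    set ρL := ρ / 2 ^ L with hρL
    have hρL0 : 0 < ρL := by positivity
    have hρL4 : ρL ≤ ρ / 4 := by
      rw [hρL]
      have : (2:ℝ) ^ 2 ≤ 2 ^ L := pow_le_pow_right₀ (by norm_num) hL
      gcongr; linarith
    set lam := (1 - t) * ρL + t * (ρ / 4) with hlam
    have hlamL : ρL ≤ lam := by rw [hlam]; nlinarith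
    have hlam4 : lam ≤ ρ / 4 := by rw [hlam]; nlinarith
    have htlam : t * (ρ / 4) ≤ lam := by rw [hlam]; nlinarith
    set err := (q - (p x' L + t • (y0 - p x' L))) + t • (x - x') with herr
    have e1 : q - x' = lam • v + err := by
      rw [herr, hlam, hp, hy0]
      simp only [smul_add, smul_sub, add_smul, sub_smul, one_smul, mul_smul, sub_mul, one_mul]
      abel
    have herrn : ‖err‖ ≤ lam / 4 := by
      have h1 := mem_ball.1 hq
      rw [dist_eq_norm] at h1
      have h2 := mem_ball.1 (hS hx')
      have h3 : ‖t • (x - x')‖ ≤ t * (ρ / 32) := by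
        rw [norm_smul, Real.norm_of_nonneg ht0.le, ← dist_eq_norm, dist_comm]
        gcongr
      have := norm_add_le (q - (p x' L + t • (y0 - p x' L))) (t • (x - x'))
      linarith
    have hlv : ‖lam • v‖ = lam := by
      rw [norm_smul, hv, mul_one, Real.norm_of_nonneg (by linarith)]
    have hub : ‖q - x'‖ ≤ 5 / 4 * lam := by
      rw [e1]; have := norm_add_le (lam • v) err; linarith
    have hlb : 3 / 4 * lam ≤ ⟪q - x', v⟫ := by
      rw [e1, inner_add_left, inner_smul_left, real_inner_self_eq_norm_sq, hv]
      have := abs_real_inner_le_norm err v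
      rw [hv, mul_one] at this
      have h3 := neg_abs_le ⟪err, v⟫
      simp
      linarith
    have hle : ⟪q - x', v⟫ ≤ ‖q - x'‖ := by
      have := abs_real_inner_le_norm (q - x') v
      rw [hv, mul_one] at this
      linarith [le_abs_self ⟪q - x', v⟫]
    rw [dist_eq_norm]
    refine ⟨by linarith, ?_, by linarith⟩
    have : ρ / 2 ^ (L + 1) = ρL / 2 := by rw [hρL, pow_succ]; field_simp
    linarith
  have hball : ball y0 (1 / 32 * ρ) ⊆ Ω := by
    intro q hq
    obtain ⟨x', hx', hr⟩ := hne
    refine ⟨x', hx', 3, by norm_num, hr, 1, one_pos, le_rfl, ?_⟩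
    rw [one_smul, add_sub_cancel, one_mul]
    rwa [one_div_mul_eq_div] at hq
  have hsubx : Ω ⊆ ball x (ρ / 2) := by
    rintro q ⟨x', hx', L, hL, hr, t, ht0, ht1, hq⟩
    have h1 := (hkey x' hx' L hL t ht0 ht1 q hq).2.2
    have h2 := mem_ball.1 (hS hx')
    rw [mem_ball]
    linarith [dist_triangle q x' x]
  refine ⟨Ω, ⟨by norm_num, by norm_num, ?_, hρ, ?_, hball, ?_⟩, ?_, hsubx, ?_⟩
  · have : Ω = ⋃ x' ∈ S, ⋃ L, ⋃ (_ : 2 ≤ L ∧ RunV E v ρ 0 L x'), ⋃ t : ℝ, ⋃ (_ : 0 < t ∧ t ≤ 1),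
        ball (p x' L + t • (y0 - p x' L)) (t * (ρ / 32)) := by
      ext q
      simp only [hΩ, mem_setOf_eq, mem_iUnion]
      constructor
      · rintro ⟨x', h1, L, h2, h3, t, h4, h5, h6⟩
        exact ⟨x', h1, L, ⟨h2, h3⟩, t, ⟨h4, h5⟩, h6⟩
      · rintro ⟨x', h1, L, ⟨h2, h3⟩, t, ⟨h4, h5⟩, h6⟩
        exact ⟨x', h1, L, h2, h3, t, h4, h5, h6⟩
    rw [this]
    exact isOpen_iUnion fun _ => isOpen_iUnion fun _ => isOpen_iUnion fun _ => isOpen_iUnion fun _ =>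
      isOpen_iUnion fun _ => isOpen_iUnion fun _ => isOpen_ball
  · refine hsubx.trans (ball_subset_ball' ?_)
    rw [hy0, dist_eq_norm, sub_add_cancel_left, norm_neg, norm_smul, hv, mul_one,
      Real.norm_of_nonneg (by positivity)]
    linarith
  · rintro q ⟨x', hx', L, hL, hr, t, ht0, ht1, hq⟩ b hb τ hτ0 hτ1
    refine ⟨x', hx', L, hL, hr, t + τ * (1 - t), by nlinarith, by nlinarith, ?_⟩
    rw [mem_ball, dist_eq_norm] at hq hb ⊢
    have e1 : q + τ • (b - q) - (p x' L + (t + τ * (1 - t)) • (y0 - p x' L)) =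
        (1 - τ) • (q - (p x' L + t • (y0 - p x' L))) + τ • (b - y0) := by
      simp only [smul_add, smul_sub, add_smul, sub_smul, one_smul, mul_smul, mul_sub, mul_one]
      abel
    rw [e1]
    refine (norm_add_le _ _).trans_lt ?_
    rw [norm_smul, norm_smul, Real.norm_of_nonneg hτ0, Real.norm_of_nonneg (by linarith)]
    rcases eq_or_lt_of_le hτ0 with h0 | h0
    · rw [← h0]; simp; exact hq
    · have h1 : (1 - τ) * ‖q - (p x' L + t • (y0 - p x' L))‖ ≤ (1 - τ) * (t * (ρ / 32)) :=
        mul_le_mul_of_nonneg_left hq.le (by linarith)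
      have h2 : τ * ‖b - y0‖ < τ * (1 / 32 * ρ) := mul_lt_mul_of_pos_left hb h0
      have h3 : (t + τ * (1 - t)) * (ρ / 32) = (1 - τ) * (t * (ρ / 32)) + τ * (1 / 32 * ρ) := by ring
      linarith
  · rw [Set.disjoint_left]
    rintro q ⟨x', hx', L, hL, hr, t, ht0, ht1, hq⟩ hqE
    obtain ⟨h1, h2, h3⟩ := hkey x' hx' L hL t ht0 ht1 q hq
    -- find the scale
    have hdpos : 0 < dist q x' := lt_of_lt_of_le (by positivity) h2
    classical
    have hexm : ∃ m, ρ / 2 ^ (m + 1) ≤ dist q x' := ⟨L, h2⟩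
    set m := Nat.find hexm with hm
    have hmL : m ≤ L := Nat.find_min' hexm h2
    have hm1 : ρ / 2 ^ (m + 1) ≤ dist q x' := Nat.find_spec hexm
    have hm2 : dist q x' < ρ / 2 ^ m := by
      rcases Nat.eq_zero_or_pos m with h0 | h0
      · rw [h0, pow_zero, div_one]; linarith
      · have := Nat.find_min hexm (m := m - 1) (by omega)
        rw [not_le, Nat.sub_add_cancel h0] at this
        exact this
    have h4 := hr m (Nat.zero_le _) hmL q hqE hm2
    have h5 := le_abs_self ⟪q - x', v⟫
    have e6 : ρ / 2 ^ m / 10 = ρ / 2 ^ (m + 1) / 5 := by rw [pow_succ]; field_simp; norm_num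
    rw [e6] at h4
    linarith
  · intro x' hx' j hr
    have h2j : (1:ℝ) ≤ 2 ^ j := one_le_pow₀ (by norm_num)
    have ht0 : (0:ℝ) < 1 / (16 * 2 ^ j) := by positivity
    have ht1 : (1:ℝ) / (16 * 2 ^ j) ≤ 1 := by
      rw [div_le_one (by positivity)]; linarith
    refine ⟨p x' (j + 3) + (1 / (16 * 2 ^ j) : ℝ) • (y0 - p x' (j + 3)),
      ⟨x', hx', j + 3, by omega, hr, 1 / (16 * 2 ^ j), ht0, ht1,
        mem_ball_self (by positivity)⟩, ?_⟩
    set w := y0 - p x' (j + 3) with hw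
    have hρj : ρ / 2 ^ (j + 3) = ρ / 2 ^ j / 8 := by rw [pow_add]; field_simp; norm_num
    have hwn : ‖w‖ ≤ ρ := by
      have e1 : w = (x - x') + (ρ / 4 - ρ / 2 ^ (j + 3)) • v := by
        rw [hw, hy0, hp]; simp only [sub_smul]; abel
      have h1 := mem_ball.1 (hS hx')
      rw [dist_comm, dist_eq_norm] at h1
      have h3 : ‖(ρ / 4 - ρ / 2 ^ (j + 3)) • v‖ ≤ ρ / 4 := by
        rw [norm_smul, hv, mul_one, Real.norm_eq_abs, abs_le]
        have : ρ / 2 ^ j ≤ ρ := div_le_self hρ.le h2j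
        have : 0 < ρ / 2 ^ j := by positivity
        constructor <;> linarith
      rw [e1]
      refine (norm_add_le _ _).trans ?_
      linarith
    have e2 : p x' (j + 3) + (1 / (16 * 2 ^ j) : ℝ) • w - x' =
        (ρ / 2 ^ j / 8) • v + (1 / (16 * 2 ^ j) : ℝ) • w := by
      rw [← hρj, hp]; simp only; abel
    rw [dist_eq_norm, e2]
    refine (norm_add_le _ _).trans_lt ?_
    rw [norm_smul, norm_smul, hv, mul_one, Real.norm_of_nonneg (by positivity),
      Real.norm_of_nonneg ht0.le]
    have h4 : 1 / (16 * 2 ^ j) * ‖w‖ ≤ ρ / 2 ^ j / 16 := by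
      calc _ ≤ 1 / (16 * 2 ^ j) * ρ := by gcongr
        _ = _ := by field_simp
    have : 0 < ρ / 2 ^ j := by positivity
    linarith

lemma run_pigeon {n : ℕ} (E : Set (Euc n)) (V : Finset (Euc n)) (hV : V.Nonempty) (r : ℝ) (x : Euc n) :
    ∃ v ∈ V, ∀ L, Run E V r 0 L x → RunV E v r 0 L x := by
  by_contra! hcon
  choose! L h1 h2 using hcon
  obtain ⟨v0, hv0, hmax⟩ := V.exists_max_image L hV
  obtain ⟨v1, hv1, hr⟩ := h1 v0 hv0
  exact h2 v1 hv1 fun t a b => hr t a (b.trans (hmax v1 hv1))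

lemma creation (n : ℕ) (CE θ : ℝ) (M₀ : ℝ≥0) (V : Finset (Euc n)) (hV : ∀ v ∈ V, ‖v‖ = 1)
    (hVne : V.Nonempty) (hK : KEY n CE θ M₀ V) :
    ∃ c : ℝ, 0 < c ∧ c ≤ 1 ∧ ∃ N : ℕ, ∀ E : Set (Euc n), IsUR n E CE θ M₀ → ∀ x ∈ E, ∀ ρ : ℝ, 0 < ρ →
      ENNReal.ofReal ρ < ediam E → ∃ (Ω : Set (Euc n)) (y : Euc n) (s : ℝ) (S : Set (Euc n)),
        IsStar (1 / 32) Ω y s ∧ Disjoint Ω E ∧ Ω ⊆ ball x (ρ / 2) ∧ c * ρ ≤ s ∧ s ≤ ρ ∧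
        S ⊆ E ∩ ball x (ρ / 32) ∧ MeasurableSet S ∧ ENNReal.ofReal (c * ρ ^ n) ≤ μH[(n : ℝ)] S ∧
        ∀ x' ∈ S, (∀ K, GoodK E V ρ N K x') ∧
          ∀ j, Run E V ρ 0 (j + 3) x' → ∃ q ∈ Ω, dist q x' < ρ / 2 ^ j / 4 := by
  obtain ⟨ck, hck, N, hKEY⟩ := hK
  obtain ⟨cf, hcf, hcf4, hfree⟩ := free_ball n CE
  have hVc : 0 < (V.card : ℝ) := by exact_mod_cast hVne.card_pos
  refine ⟨min cf (ck / 32 ^ n / V.card), by positivity, (min_le_left _ _).trans (by linarith), N + 5, ?_⟩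
  intro E hE x hx ρ hρ hρd
  have hρ32 : 0 < ρ / 32 := by positivity
  have hk := hKEY E hE x hx (ρ / 32) hρ32
    (lt_of_le_of_lt (ENNReal.ofReal_le_ofReal (by linarith)) hρd)
  set G := {x' ∈ E ∩ ball x (ρ / 32) | ∀ K, GoodK E V (ρ / 32) N K x'} with hG
  set Sv : Euc n → Set (Euc n) := fun v => {x' ∈ G | ∀ L, Run E V ρ 0 L x' → RunV E v ρ 0 L x'} with hSv
  have hGm : MeasurableSet G := by
    apply MeasurableSet.inter (hE.1.1.measurableSet.inter measurableSet_ball)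
    exact measurableSet_setOf.2 (Measurable.forall fun K => goodK_measurable E V _ N K)
  have hSm : ∀ v, MeasurableSet (Sv v) := fun v => by
    apply MeasurableSet.inter hGm
    exact measurableSet_setOf.2 (Measurable.forall fun L =>
      Measurable.imp (run_measurable E V _ _ _) (runV_measurable E v _ _ _))
  have hGU : G ⊆ ⋃ v ∈ V, Sv v := by
    intro x' hx'
    obtain ⟨v, hv, h⟩ := run_pigeon E V hVne ρ x'
    exact mem_iUnion₂.2 ⟨v, hv, hx', h⟩
  obtain ⟨v, hv, hvS⟩ : ∃ v ∈ V, ENNReal.ofReal (ck / 32 ^ n / V.card * ρ ^ n) ≤ μH[(n : ℝ)] (Sv v) := by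
    by_contra! hcon
    have h1 : μH[(n : ℝ)] G < ∑ v ∈ V, ENNReal.ofReal (ck / 32 ^ n / V.card * ρ ^ n) :=
      ((measure_mono hGU).trans (measure_biUnion_finset_le _ _)).trans_lt
        (ENNReal.sum_lt_sum_of_nonempty hVne hcon)
    rw [Finset.sum_const, nsmul_eq_mul, ← ENNReal.ofReal_natCast,
      ← ENNReal.ofReal_mul (by positivity)] at h1
    refine absurd (hk.trans_lt h1) (not_lt.2 (ENNReal.ofReal_le_ofReal (le_of_eq ?_)))
    rw [div_pow]; field_simp
  have hSsub : Sv v ⊆ E ∩ ball x (ρ / 32) := fun x' h => h.1.1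
  have hGood : ∀ x' ∈ Sv v, ∀ K, GoodK E V ρ (N + 5) K x' := fun x' h K => by
    have h1 := h.1.2 K
    rw [show ρ / 32 = ρ / 2 ^ 5 by norm_num] at h1
    exact goodK_mono (by omega) (goodK_unshift h1)
  have hmeas : ENNReal.ofReal (min cf (ck / 32 ^ n / V.card) * ρ ^ n) ≤ μH[(n : ℝ)] (Sv v) :=
    le_trans (ENNReal.ofReal_le_ofReal (by gcongr; exact min_le_right _ _)) hvS
  have hcρ : min cf (ck / 32 ^ n / V.card) * ρ ≤ cf * ρ := by gcongr; exact min_le_left _ _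
  by_cases hne : ∃ x' ∈ Sv v, RunV E v ρ 0 3 x'
  · obtain ⟨Ω, h1, h2, h3, h4⟩ := cone_dom hρ (hV v hv) (fun x' h => (hSsub h).2) hne
    refine ⟨Ω, _, ρ, Sv v, h1, h2, h3, ?_, le_rfl, hSsub, hSm v, hmeas, fun x' hx' =>
      ⟨hGood x' hx', fun j hj => h4 x' hx' j (hx'.2 _ hj)⟩⟩
    nlinarith
  · push Not at hne
    obtain ⟨X, hX1, hX2⟩ := hfree E hE.1 x hx ρ hρ hρd
    refine ⟨ball X (cf * ρ), X, cf * ρ, Sv v, isStar_ball (by norm_num) (by norm_num) X (by positivity),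
      hX1, hX2, hcρ, by nlinarith, hSsub, hSm v, hmeas, fun x' hx' =>
      ⟨hGood x' hx', fun j hj => absurd (fun t h1 h2 => hx'.2 _ hj t h1 (by omega)) (hne x' hx')⟩⟩

lemma comb_count (A P : Finset ℕ) (N : ℕ) (hP : P.card ≤ N)
    (h : ∀ k ∈ A, ∀ k' ∈ A, k < k' → ∃ p ∈ P, k < p ∧ p ≤ k' + 3) : A.card ≤ 4 * (N + 1) := by
  classical
  set f : ℕ → ℕ := fun k => (P.filter (· ≤ k + 3)).card with hf
  have h1 : A.card ≤ 4 * (A.image f).card := by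
    refine Finset.card_le_mul_card_image A 4 ?_
    intro b _
    set Fb := A.filter (fun a => f a = b) with hFb
    rcases Fb.eq_empty_or_nonempty with he | hne
    · rw [he]; simp
    set a := Fb.min' hne
    set m := Fb.max' hne
    have ha := Fb.min'_mem hne
    have hm := Fb.max'_mem hne
    have hsub : Fb ⊆ {a, a + 1, a + 2, m} := by
      intro k hk
      have hak : a ≤ k := Fb.min'_le k hk
      have hkm : k ≤ m := Fb.le_max' k hk
      simp only [Finset.mem_insert, Finset.mem_singleton]
      by_contra hcon
      have hlt : k < m := by omega
      obtain ⟨p, hp, hp1, hp2⟩ := h k (Finset.mem_filter.1 hk).1 m (Finset.mem_filter.1 hm).1 hlt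
      have hss : P.filter (· ≤ a + 3) ⊂ P.filter (· ≤ m + 3) := by
        rw [Finset.ssubset_iff_of_subset]
        · exact ⟨p, Finset.mem_filter.2 ⟨hp, hp2⟩, fun hh => by
            have := (Finset.mem_filter.1 hh).2
            omega⟩
        · intro q hq
          rw [Finset.mem_filter] at hq ⊢
          exact ⟨hq.1, by omega⟩
      have := Finset.card_lt_card hss
      have e1 : f a = b := (Finset.mem_filter.1 ha).2
      have e2 : f m = b := (Finset.mem_filter.1 hm).2
      simp only [hf] at e1 e2
      omega
    exact (Finset.card_le_card hsub).trans Finset.card_le_four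
  have h2 : (A.image f).card ≤ N + 1 := by
    have : A.image f ⊆ Finset.range (N + 1) := by
      intro b hb
      obtain ⟨k, _, rfl⟩ := Finset.mem_image.1 hb
      have := Finset.card_filter_le P (· ≤ k + 3)
      simp only [hf, Finset.mem_range]
      omega
    simpa using Finset.card_le_card this
  exact h1.trans (Nat.mul_le_mul_left 4 h2)

lemma overlap_sum {n : ℕ} {ι : Type} (T : Finset ι) (S : ι → Set (Euc n)) (B : Set (Euc n)) (M : ℕ)
    (hS : ∀ i ∈ T, MeasurableSet (S i)) (hB : ∀ i ∈ T, S i ⊆ B) (hBm : MeasurableSet B)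
    (hM : ∀ x, ∀ T' ⊆ T, (∀ i ∈ T', x ∈ S i) → T'.card ≤ M) :
    ∑ i ∈ T, μH[(n : ℝ)] (S i) ≤ M * μH[(n : ℝ)] B := by
  classical
  calc ∑ i ∈ T, μH[(n : ℝ)] (S i) = ∑ i ∈ T, ∫⁻ x, (S i).indicator 1 x ∂(μH[(n : ℝ)] : Measure (Euc n)) :=
        Finset.sum_congr rfl fun i hi => (lintegral_indicator_one (hS i hi)).symm
    _ = ∫⁻ x, ∑ i ∈ T, (S i).indicator 1 x ∂(μH[(n : ℝ)] : Measure (Euc n)) :=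
        (lintegral_finset_sum' _ fun i hi => (measurable_one.indicator (hS i hi)).aemeasurable).symm
    _ ≤ ∫⁻ x, B.indicator (fun _ => (M : ℝ≥0∞)) x ∂(μH[(n : ℝ)] : Measure (Euc n)) := by
        apply lintegral_mono
        intro x
        by_cases hx : x ∈ B
        · simp only [hx, indicator_of_mem]
          have e1 : ∑ i ∈ T, (S i).indicator (1 : Euc n → ℝ≥0∞) x =
              ((T.filter (fun i => x ∈ S i)).card : ℝ≥0∞) := by
            simp [indicator_apply, Finset.sum_boole]
          show ∑ i ∈ T, (S i).indicator (1 : Euc n → ℝ≥0∞) x ≤ _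
          rw [e1]
          exact_mod_cast hM x _ (Finset.filter_subset _ _) fun i hi => (Finset.mem_filter.1 hi).2
        · have : ∀ i ∈ T, (S i).indicator (1 : Euc n → ℝ≥0∞) x = 0 := fun i hi =>
            indicator_of_notMem (fun h => hx (hB i hi h)) _
          show ∑ i ∈ T, (S i).indicator (1 : Euc n → ℝ≥0∞) x ≤ _
          rw [Finset.sum_eq_zero this]
          exact zero_le
    _ = M * μH[(n : ℝ)] B := by
        rw [lintegral_indicator hBm, lintegral_const, Measure.restrict_apply_univ]

structure GFam {n : ℕ} (c : ℝ) (M : ℕ) (E Y : Set (Euc n)) (r0 : ℝ) (ι : Type) (Ω : ι → Set (Euc n))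
    (y : ι → Euc n) (s : ι → ℝ) (S : ι → Set (Euc n)) : Prop where
  star : ∀ i, IsStar (1 / 32) (Ω i) (y i) (s i)
  disj : ∀ i j, i ≠ j → Disjoint (Ω i) (Ω j)
  sub : ∀ i, Disjoint (Ω i) E
  near : ∀ i, ∃ e ∈ Y, Ω i ⊆ ball e (r0 / 2) ∧ S i ⊆ ball e (r0 / 2) ∧ dist e (y i) ≤ s i / c
  cork : ∀ e ∈ Y, ∀ r : ℝ, 0 < r → r ≤ r0 →
    ∃ i X, ball X (c / 512 * r) ⊆ Ω i ∧ ball X (c / 512 * r) ⊆ ball e r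
  Smeas : ∀ i, MeasurableSet (S i)
  SE : ∀ i, S i ⊆ E
  Sball : ∀ i, S i ⊆ ball (y i) (s i / c)
  Smu : ∀ i, ENNReal.ofReal (c * (s i) ^ n) ≤ μH[(n : ℝ)] (S i)
  ovl : ∀ x, ∀ T : Finset ι, (∀ i ∈ T, x ∈ S i) → T.card ≤ M

lemma exists_scale {r r0 : ℝ} (hr : 0 < r) (hr0 : r ≤ r0) :
    ∃ k : ℕ, r / 8 < r0 / 2 ^ k ∧ r0 / 2 ^ k ≤ r / 4 := by
  classical
  have hex : ∃ k : ℕ, r0 / 2 ^ k ≤ r / 4 := by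
    obtain ⟨k, hk⟩ := pow_unbounded_of_one_lt (4 * r0 / r) (one_lt_two)
    refine ⟨k, ?_⟩
    rw [div_lt_iff₀ hr] at hk
    rw [div_le_iff₀ (by positivity)]
    linarith
  refine ⟨Nat.find hex, ?_, Nat.find_spec hex⟩
  have hk0 : 0 < Nat.find hex := by
    rw [Nat.find_pos]
    simp; linarith
  have := Nat.find_min hex (m := Nat.find hex - 1) (by omega)
  rw [not_le] at this
  have e : r0 / 2 ^ (Nat.find hex) = r0 / 2 ^ (Nat.find hex - 1) / 2 := by
    rw [div_div, ← pow_succ, Nat.sub_add_cancel hk0]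
  rw [e]; linarith

theorem greedy (n : ℕ) (CE θ : ℝ) (M₀ : ℝ≥0) (V : Finset (Euc n)) (hV : ∀ v ∈ V, ‖v‖ = 1)
    (hVne : V.Nonempty) (hK : KEY n CE θ M₀ V) :
    ∃ c : ℝ, 0 < c ∧ c ≤ 1 ∧ ∃ M : ℕ, ∀ E : Set (Euc n), IsUR n E CE θ M₀ → ∀ Y ⊆ E,
      Bornology.IsBounded Y → ∀ r0 : ℝ, 0 < r0 → ENNReal.ofReal r0 < ediam E →
      ∃ (ι : Type) (Ω : ι → Set (Euc n)) (y : ι → Euc n) (s : ι → ℝ) (S : ι → Set (Euc n)),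
        Countable ι ∧ GFam c M E Y r0 ι Ω y s S := by
  classical
  obtain ⟨c, hc, hc1, N, hcre⟩ := creation n CE θ M₀ V hV hVne hK
  refine ⟨c, hc, hc1, 4 * (N + 1), ?_⟩
  intro E hE Y hYE hYb r0 hr0 hr0d
  set rk : ℕ → ℝ := fun k => r0 / 2 ^ k with hrk
  have hrk0 : ∀ k, 0 < rk k := fun k => by simp only [hrk]; positivity
  have hrkr0 : ∀ k, rk k ≤ r0 := fun k => div_le_self hr0.le (one_le_pow₀ (by norm_num))
  have hrkm : ∀ k k', k < k' → rk k' ≤ rk k / 2 := fun k k' h => by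
    simp only [hrk]
    rw [div_div, ← pow_succ]
    gcongr
    · norm_num
    · omega
  have hcr := fun (z : Y) (k : ℕ) => hcre E hE z (hYE z.2) (rk k) (hrk0 k)
    (lt_of_le_of_lt (ENNReal.ofReal_le_ofReal (hrkr0 k)) hr0d)
  choose Dm yy ss SS hst hDE hDb hs1 hs2 hSE hSm hSmu hSg using hcr
  -- extend by junk
  obtain ⟨R0, hR0⟩ := hYb.subset_ball (0 : Euc n)
  have hnet : ∀ (A : Set (Euc n)) (k : ℕ), ∃ T : Finset (Euc n), (T : Set (Euc n)) ⊆ Y ∩ A ∧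
      (∀ x ∈ T, ∀ y ∈ T, x ≠ y → rk k ≤ dist x y) ∧ (∀ x ∈ Y ∩ A, ∃ t ∈ T, dist x t < rk k) := by
    intro A k
    obtain ⟨T, h1, h2, h3, -⟩ := exists_net (Y ∩ A) (s := rk k) (R := max R0 1) (z := 0) (hrk0 k)
      (by positivity) (inter_subset_left.trans (hR0.trans (ball_subset_ball (le_max_left _ _))))
    exact ⟨T, h1, h2, h3⟩
  choose net hn1 hn2 hn3 using hnet
  set el : Set (Euc n) → ℕ → Set (Euc n) := fun U k => {x | Disjoint (ball x (rk k / 2)) U} with hel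
  set U : ℕ → Set (Euc n) := fun k => Nat.rec ∅
    (fun k U => U ∪ ⋃ z : Y, ⋃ _ : (z : Euc n) ∈ net (el U k) k, Dm z k) k with hU
  have hUs : ∀ k, U (k + 1) = U k ∪ ⋃ z : Y, ⋃ _ : (z : Euc n) ∈ net (el (U k) k) k, Dm z k :=
    fun k => rfl
  have hUmono : Monotone U := monotone_nat_of_le_succ fun k => by rw [hUs]; exact subset_union_left
  set Z : ℕ → Finset (Euc n) := fun k => net (el (U k) k) k with hZ
  have hZU : ∀ k (z : Y), (z : Euc n) ∈ Z k → ∀ k', k < k' → Dm z k ⊆ U k' := by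
    intro k z hz k' hkk
    refine subset_trans ?_ (hUmono (Nat.succ_le_of_lt hkk))
    rw [Nat.succ_eq_add_one, hUs]
    exact fun q hq => Or.inr (mem_iUnion₂.2 ⟨z, hz, hq⟩)
  have hUmem : ∀ k q, q ∈ U k → ∃ k' < k, ∃ z : Y, (z : Euc n) ∈ Z k' ∧ q ∈ Dm z k' := by
    intro k
    induction k with
    | zero => intro q hq; exact absurd hq (notMem_empty q)
    | succ k ih =>
      intro q hq
      rw [hUs] at hq
      rcases hq with hq | hq
      · obtain ⟨k', h1, h2⟩ := ih q hq
        exact ⟨k', by omega, h2⟩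
      · obtain ⟨z, hz, hq⟩ := mem_iUnion₂.1 hq
        exact ⟨k, by omega, z, hz, hq⟩
  have hZel : ∀ k (z : Y), (z : Euc n) ∈ Z k → Disjoint (ball (z : Euc n) (rk k / 2)) (U k) :=
    fun k z hz => (hn1 _ _ hz).2
  refine ⟨{p : Y × ℕ // (p.1 : Euc n) ∈ Z p.2}, fun i => Dm i.1.1 i.1.2, fun i => yy i.1.1 i.1.2,
    fun i => ss i.1.1 i.1.2, fun i => SS i.1.1 i.1.2, ?_, ?_⟩
  · have hinj : Function.Injective (fun i : {p : Y × ℕ // (p.1 : Euc n) ∈ Z p.2} =>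
        (⟨i.1.2, ⟨i.1.1, i.2⟩⟩ : Σ k : ℕ, {z // z ∈ Z k})) := by
      rintro ⟨⟨z, k⟩, h⟩ ⟨⟨z', k'⟩, h'⟩ heq
      simp only [Sigma.mk.injEq] at heq
      obtain ⟨rfl, h2⟩ := heq
      simp only [heq_eq_eq, Subtype.mk.injEq] at h2
      simp only [Subtype.mk.injEq, Prod.mk.injEq, and_true]
      exact Subtype.ext h2
    exact hinj.countable
  have hsep : ∀ k (z z' : Y), (z : Euc n) ∈ Z k → (z' : Euc n) ∈ Z k → z ≠ z' → rk k ≤ dist (z : Euc n) z' :=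
    fun k z z' h h' hne => hn2 _ _ _ h _ h' (fun e => hne (Subtype.ext e))
  have hlt : ∀ k k' (z z' : Y), (z : Euc n) ∈ Z k → (z' : Euc n) ∈ Z k' → k < k' →
      Disjoint (Dm z k) (ball (z' : Euc n) (rk k' / 2)) := fun k k' z z' hz hz' hkk =>
    ((hZel k' z' hz').mono_right (hZU k z hz k' hkk)).symm
  refine ⟨fun i => hst _ _, ?_, fun i => hDE _ _, ?_, ?_, fun i => hSm _ _,
    fun i x hx => (hSE _ _ hx).1, ?_, ?_, ?_⟩
  · rintro ⟨⟨z, k⟩, hz⟩ ⟨⟨z', k'⟩, hz'⟩ hne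
    dsimp only at hz hz' ⊢
    rcases lt_trichotomy k k' with h | h | h
    · exact (hlt k k' z z' hz hz' h).mono_right (hDb z' k')
    · subst h
      have hzz : z ≠ z' := fun e => hne (by subst e; rfl)
      have h1 := hsep k z z' hz hz' hzz
      exact (ball_disjoint_ball (by linarith)).mono (hDb z k) (hDb z' k)
    · exact ((hlt k' k z' z hz' hz h).mono_right (hDb z k)).symm
  · rintro ⟨⟨z, k⟩, hz⟩
    dsimp only at hz ⊢
    refine ⟨z, z.2, (hDb z k).trans (ball_subset_ball (by linarith [hrkr0 k])), fun x hx =>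
      ball_subset_ball (by linarith [hrkr0 k, hrk0 k]) (hSE z k hx).2, ?_⟩
    rw [le_div_iff₀ hc]
    have h1 := mem_ball'.1 (hDb z k (hst z k).y_mem)
    have h2 := hs1 z k
    nlinarith [hrk0 k]
  · intro e he r hr hrr0
    obtain ⟨k, hk1, hk2⟩ := exists_scale hr hrr0
    change r / 8 < rk k at hk1
    change rk k ≤ r / 4 at hk2
    have hfin : ∀ (z : Y) (k' : ℕ) (hz : (z : Euc n) ∈ Z k') (q : Euc n), k' ≤ k → q ∈ Dm z k' →
        dist q e ≤ 2 * rk k → ∃ X, ball X (c / 512 * r) ⊆ Dm z k' ∧ ball X (c / 512 * r) ⊆ ball e r := by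
      intro z k' hz q hkk hq hqe
      have hmon : rk k ≤ rk k' := by
        rcases eq_or_lt_of_le hkk with h | h
        · rw [h]
        · linarith [hrkm k' k h, hrk0 k']
      obtain ⟨X, hX1, hX2⟩ := (hst z k').inner_ball (subset_closure hq) (r := c * rk k) (by have := hrk0 k; positivity)
        (by nlinarith [hs1 z k', hrk0 k'])
      have hrad : c / 512 * r ≤ 1 / 32 / 2 * (c * rk k) := by nlinarith
      refine ⟨X, (ball_subset_ball hrad).trans hX1, (ball_subset_ball hrad).trans (hX2.trans ?_)⟩
      apply ball_subset_ball'
      nlinarith [hrk0 k]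
    by_cases hel' : e ∈ el (U k) k
    · obtain ⟨z, hz, hd⟩ := hn3 (el (U k) k) k e ⟨he, hel'⟩
      have hzY : z ∈ Y := (hn1 _ _ hz).1
      have hym := (hst ⟨z, hzY⟩ k).y_mem
      obtain ⟨X, h1, h2⟩ := hfin ⟨z, hzY⟩ k hz _ le_rfl hym (by
        have h3 := mem_ball.1 (hDb ⟨z, hzY⟩ k hym)
        dsimp only at h3
        rw [dist_comm] at hd
        linarith [dist_triangle (yy ⟨z, hzY⟩ k) z e, hrk0 k])
      exact ⟨⟨⟨⟨z, hzY⟩, k⟩, hz⟩, X, h1, h2⟩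
    · obtain ⟨q, hq1, hq2⟩ := Set.not_disjoint_iff.1 hel'
      obtain ⟨k', hk', z, hz, hqD⟩ := hUmem k q hq2
      obtain ⟨X, h1, h2⟩ := hfin z k' hz q hk'.le hqD (by
        have := mem_ball.1 hq1
        linarith [hrk0 k])
      exact ⟨⟨⟨z, k'⟩, hz⟩, X, h1, h2⟩
  · rintro ⟨⟨z, k⟩, hz⟩ x hx
    dsimp only at hz hx ⊢
    have h1 := mem_ball'.1 (hDb z k (hst z k).y_mem)
    have h2 := hs1 z k
    have h3 := mem_ball.1 (hSE z k hx).2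
    rw [mem_ball, lt_div_iff₀ hc]
    nlinarith [hrk0 k, dist_triangle x z (yy z k)]
  · rintro ⟨⟨z, k⟩, hz⟩
    dsimp only
    refine le_trans (ENNReal.ofReal_le_ofReal ?_) (hSmu z k)
    have := (hst z k).spos
    gcongr
    exact hs2 z k
  · intro x T hT
    have hinj : Set.InjOn (fun i : {p : Y × ℕ // (p.1 : Euc n) ∈ Z p.2} => i.1.2) T := by
      rintro ⟨⟨z, k⟩, hz⟩ hi ⟨⟨z', k'⟩, hz'⟩ hi' heq
      dsimp only at heq hz hz'
      subst heq
      by_contra hne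
      have hzz : z ≠ z' := fun e => hne (by subst e; rfl)
      have h1 := hsep k z z' hz hz' hzz
      have h2 := mem_ball'.1 (hSE z k (hT _ hi)).2
      have h3 := mem_ball.1 (hSE z' k (hT _ hi')).2
      linarith [dist_triangle (z : Euc n) x z', hrk0 k]
    rw [← Finset.card_image_of_injOn hinj]
    set A := T.image (fun i : {p : Y × ℕ // (p.1 : Euc n) ∈ Z p.2} => i.1.2) with hA
    rcases A.eq_empty_or_nonempty with h0 | hne
    · rw [h0]; simp
    have hAm : ∀ k ∈ A, ∃ z : Y, (z : Euc n) ∈ Z k ∧ x ∈ SS z k := by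
      intro k hk
      obtain ⟨⟨⟨z, k1⟩, hz⟩, hi, rfl⟩ := Finset.mem_image.1 hk
      exact ⟨z, hz, hT _ hi⟩
    set k0 := A.min' hne with hk0
    obtain ⟨z0, hz0, hx0⟩ := hAm k0 (A.min'_mem hne)
    obtain ⟨P, hP, hPr⟩ := (hSg z0 k0 x hx0).1 (A.max' hne + 3)
    have hle := fun k hk => A.min'_le k hk
    have hcard : (A.image (· - k0)).card = A.card := by
      apply Finset.card_image_of_injOn
      intro a ha b hb hab
      have := hle a ha
      have := hle b hb
      dsimp only at hab
      omega
    rw [← hcard]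
    refine comb_count _ P N hP ?_
    intro a ha b hb hab
    obtain ⟨k, hk, rfl⟩ := Finset.mem_image.1 ha
    obtain ⟨k', hk', rfl⟩ := Finset.mem_image.1 hb
    by_contra! hcon
    have hkk0 := hle k hk
    have hkk0' := hle k' hk'
    have hmax := A.le_max' k' hk'
    have hkk : k < k' := by omega
    obtain ⟨v, hv, hrun⟩ := hPr (k - k0) (k' - k0 + 3) (by omega) (by omega) (fun p hp => by
      by_cases h : p ≤ k - k0
      · exact Or.inl h
      · exact Or.inr (by have := hcon p hp (by omega); omega))
    obtain ⟨z, hz, hxz⟩ := hAm k hk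
    obtain ⟨z', hz', hxz'⟩ := hAm k' hk'
    have hrun2 : RunV E v (rk k) 0 (k' - k + 3) x := by
      have e1 : rk k = rk k0 / 2 ^ (k - k0) := by
        simp only [hrk]; rw [div_div, ← pow_add]; congr 2; omega
      rw [e1]
      apply runV_unshift
      rw [add_zero, show k - k0 + (k' - k + 3) = k' - k0 + 3 by omega]
      exact hrun
    obtain ⟨q, hq, hqd⟩ := (hSg z k x hxz).2 (k' - k) ⟨v, hv, hrun2⟩
    have e2 : rk k / 2 ^ (k' - k) = rk k' := by
      simp only [hrk]; rw [div_div, ← pow_add]; congr 2; omega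
    rw [e2] at hqd
    refine Set.disjoint_left.1 (hlt k k' z z' hz hz' hkk) hq ?_
    have h3 := mem_ball.1 (hSE z' k' hxz').2
    rw [mem_ball]
    linarith [dist_triangle q x z', hrk0 k']

lemma isADR_mono {n : ℕ} {E : Set (Euc n)} {C C' : ℝ} (h : IsADR n E C) (hC : C ≤ C') : IsADR n E C' := by
  have h1 := h.2.1
  refine ⟨h.1, h1.trans hC, fun x hx r hr hrd => ?_⟩
  obtain ⟨a, b⟩ := h.2.2 x hx r hr hrd
  refine ⟨le_trans (ENNReal.ofReal_le_ofReal ?_) a, b.trans (ENNReal.ofReal_le_ofReal ?_)⟩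
  · gcongr
  · gcongr

lemma isNTA_mono {n : ℕ} {Ω : Set (Euc n)} {c c' C C' : ℝ} {Nb : ℝ → ℕ} (h : IsNTA Ω c C Nb) (hc : c' ≤ c)
    (hC : C ≤ C') : IsNTA Ω c' C' Nb := by
  obtain ⟨h1, h2, ⟨h3, h4⟩, h5⟩ := h
  refine ⟨h1, h2, ⟨h3.trans hC, ?_⟩, h5.mono hc⟩
  intro ρ hρ Λ hΛ X hX X' hX' ha hb hd
  obtain ⟨N, g1, g2, ctr, rad, g3, g4, g5, g6⟩ := h4 ρ hρ Λ hΛ X hX X' hX' ha hb hd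
  refine ⟨N, g1, g2, ctr, rad, g3, g4, fun i hi => ?_, g6⟩
  obtain ⟨k1, k2, k3, k4⟩ := g5 i hi
  have hd0 : 0 ≤ Metric.diam (ball (ctr i) (rad i)) := diam_nonneg
  refine ⟨k1, k2, le_trans ?_ k3, k4.trans ?_⟩
  · gcongr
  · gcongr

lemma pack_of {n : ℕ} {c CE : ℝ} {M : ℕ} {E : Set (Euc n)} {ι : Type} {y : ι → Euc n} {s : ι → ℝ}
    {S : ι → Set (Euc n)} (hc : 0 < c) (hc1 : c ≤ 1) (hCE : 0 ≤ CE) (hE : MeasurableSet E)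
    (up : ∀ (z : Euc n) (R : ℝ), 0 < R → μH[(n : ℝ)] (E ∩ ball z R) ≤ ENNReal.ofReal (CE * R ^ n))
    (hs : ∀ i, 0 < s i) (Smeas : ∀ i, MeasurableSet (S i))
    (SE : ∀ i, S i ⊆ E) (Sball : ∀ i, S i ⊆ ball (y i) (s i / c))
    (Smu : ∀ i, ENNReal.ofReal (c * (s i) ^ n) ≤ μH[(n : ℝ)] (S i))
    (ovl : ∀ x, ∀ T : Finset ι, (∀ i ∈ T, x ∈ S i) → T.card ≤ M)
    (z : Euc n) {R : ℝ} (hR : 0 < R) (T : Finset ι) (hT : ∀ i ∈ T, s i ≤ R ∧ y i ∈ ball z R) :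
    ∑ i ∈ T, (s i) ^ n ≤ (M * CE * (2 / c) ^ n / c) * R ^ n := by
  have h1 := overlap_sum T S (E ∩ ball z (2 * R / c)) M (fun i _ => Smeas i) (fun i hi x hx => by
      refine ⟨SE i hx, ?_⟩
      have h2 := mem_ball.1 (Sball i hx)
      obtain ⟨h3, h4⟩ := hT i hi
      rw [mem_ball] at h4 ⊢
      have h5 : s i / c ≤ R / c := by gcongr
      have h6 : R ≤ R / c := by rw [le_div_iff₀ hc]; nlinarith
      have h7 : 2 * R / c = R / c + R / c := by ring
      linarith [dist_triangle x (y i) z]) (hE.inter measurableSet_ball)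
    (fun x T' _ h => ovl x T' h)
  have h2 : ∑ i ∈ T, ENNReal.ofReal (c * (s i) ^ n) ≤ ENNReal.ofReal (M * (CE * (2 * R / c) ^ n)) := by
    refine (Finset.sum_le_sum fun i _ => Smu i).trans (h1.trans ?_)
    rw [ENNReal.ofReal_mul (by positivity), ENNReal.ofReal_natCast]
    gcongr
    exact up z _ (by positivity)
  rw [← ENNReal.ofReal_sum_of_nonneg (fun i _ => by have := hs i; positivity),
    ENNReal.ofReal_le_ofReal_iff (by positivity), ← Finset.mul_sum] at h2
  have e : M * (CE * (2 * R / c) ^ n) = c * ((M * CE * (2 / c) ^ n / c) * R ^ n) := by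
    rw [show 2 * R / c = 2 / c * R by ring, mul_pow]; field_simp
  rw [e] at h2
  exact le_of_mul_le_mul_left h2 hc

lemma sigma_fam {n : ℕ} {c c1 C2 CE : ℝ} {M : ℕ} {E : Set (Euc n)} {J : Type} {Y : J → Set (Euc n)}
    {r0 : J → ℝ} {ι : J → Type} {Ω : ∀ j, ι j → Set (Euc n)} {y : ∀ j, ι j → Euc n} {s : ∀ j, ι j → ℝ}
    {S : ∀ j, ι j → Set (Euc n)} {Dd : ℝ≥0∞}
    (hF : ∀ j, GFam c M E (Y j) (r0 j) (ι j) (Ω j) (y j) (s j) (S j))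
    (hc : 0 < c) (hc1 : c ≤ 1) (hc10 : 0 < c1) (hc11 : c1 ≤ 1) (hC2 : 1 ≤ C2) (hC2c : 1 / c ≤ C2)
    (hC2p : M * CE * (2 / c) ^ n / c ≤ C2)
    (hCE : 0 ≤ CE) (hE : IsClosed E)
    (up : ∀ (z : Euc n) (R : ℝ), 0 < R → μH[(n : ℝ)] (E ∩ ball z R) ≤ ENNReal.ofReal (CE * R ^ n))
    (hYE : ∀ j, Y j ⊆ E) (hD : 0 < Dd)
    (hcross : ∀ j j', j ≠ j' → ∀ e ∈ Y j, ∀ e' ∈ Y j', (r0 j + r0 j') / 2 ≤ dist e e')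
    (cork : ∀ j, ∀ e ∈ Y j, ∀ r : ℝ, 0 < r → ENNReal.ofReal r ≤ Dd →
      ∃ j' i X, ball X (c1 * r) ⊆ Ω j' i ∧ ball X (c1 * r) ⊆ ball e r)
    (diam : ediam (⋃ i : (Σ j, ι j), Ω i.1 i.2) ≤ ENNReal.ofReal C2 * Dd) :
    StarFamily (1 / 32) c1 C2 CE E (⋃ j, Y j) (Σ j, ι j) (fun i => Ω i.1 i.2) (fun i => y i.1 i.2)
      (fun i => s i.1 i.2) Dd := by
  classical
  refine ⟨hc10, hc11, hC2, hCE, hE, up, iUnion_subset hYE, hD, fun i => (hF i.1).star i.2, ?_,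
    fun i => (hF i.1).sub i.2, ?_, ?_, ?_, diam⟩
  · rintro ⟨j, i⟩ ⟨j', i'⟩ hne
    by_cases h : j = j'
    · subst h
      exact (hF j).disj i i' fun e => hne (by rw [e])
    · obtain ⟨e, he, h1, -⟩ := (hF j).near i
      obtain ⟨e', he', h1', -⟩ := (hF j').near i'
      refine (ball_disjoint_ball ?_).mono h1 h1'
      linarith [hcross j j' h e he e' he']
  · rintro ⟨j, i⟩
    obtain ⟨e, he, -, -, h⟩ := (hF j).near i
    refine ⟨e, mem_iUnion.2 ⟨j, he⟩, h.trans ?_⟩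
    have := ((hF j).star i).spos
    dsimp only
    rw [div_eq_mul_one_div, mul_comm]
    gcongr
  · intro e he r hr hrD
    obtain ⟨j, hj⟩ := mem_iUnion.1 he
    obtain ⟨j', i, X, h⟩ := cork j e hj r hr hrD
    exact ⟨⟨j', i⟩, X, h⟩
  · intro z R hR T hT
    refine (pack_of (S := fun i : (Σ j, ι j) => S i.1 i.2) (M := M) hc hc1 hCE hE.measurableSet up
      (fun i => ((hF i.1).star i.2).spos)
      (fun i => (hF i.1).Smeas i.2) (fun i => (hF i.1).SE i.2) (fun i => (hF i.1).Sball i.2)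
      (fun i => (hF i.1).Smu i.2) ?_ z hR T hT).trans (by gcongr)
    intro x T hT
    rcases T.eq_empty_or_nonempty with h0 | ⟨i0, hi0⟩
    · rw [h0]; simp
    obtain ⟨j0, k0⟩ := i0
    have hj : ∀ i ∈ T, i.1 = j0 := by
      rintro ⟨j, k⟩ hi
      by_contra hne
      obtain ⟨e, he, -, h1, -⟩ := (hF j).near k
      obtain ⟨e', he', -, h1', -⟩ := (hF j0).near k0
      have a := mem_ball'.1 (h1 (hT _ hi))
      have b := mem_ball.1 (h1' (hT _ hi0))
      linarith [hcross j j0 hne e he e' he', dist_triangle e x e']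
    have hsub : T ⊆ (T.preimage (Sigma.mk j0) sigma_mk_injective.injOn).map ⟨Sigma.mk j0, sigma_mk_injective⟩ := by
      rintro ⟨j, k⟩ hi
      have := hj _ hi
      dsimp only at this
      subst this
      simp [hi]
    refine (Finset.card_le_card hsub).trans ?_
    rw [Finset.card_map]
    exact (hF j0).ovl x _ fun i hi => hT _ (Finset.mem_preimage.1 hi)

lemma annulus_nonempty {n : ℕ} (hn : 1 ≤ n) {E : Set (Euc n)} {CE A : ℝ} (hE : IsADR n E CE)
    (hu : ediam E = ⊤) (hA : CE ^ 2 < A) {x0 : Euc n} (hx0 : x0 ∈ E) (m : ℕ) :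
    ∃ e ∈ E, A ^ m ≤ dist e x0 ∧ dist e x0 < A ^ (m + 1) := by
  have hCE := hE.2.1
  have hA1 : 1 < A := lt_of_le_of_lt (one_le_pow₀ hCE) hA
  have hA0 : 0 < A := by linarith
  by_contra! hcon
  have hsub : E ∩ ball x0 (A ^ (m + 1)) ⊆ E ∩ ball x0 (A ^ m) := by
    rintro e ⟨he, hb⟩
    refine ⟨he, ?_⟩
    by_contra h
    rw [mem_ball, not_lt] at h
    exact absurd (mem_ball.1 hb) (not_lt.2 (hcon e he h))
  have h1 := (hE.2.2 x0 hx0 (A ^ (m + 1)) (by positivity) (by rw [ediam_eq', hu]; exact ENNReal.ofReal_lt_top)).1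
  have h2 := (hE.2.2 x0 hx0 (A ^ m) (by positivity) (by rw [ediam_eq', hu]; exact ENNReal.ofReal_lt_top)).2
  have h3 := (h1.trans (measure_mono hsub)).trans h2
  rw [ENNReal.ofReal_le_ofReal_iff (by positivity), pow_succ, mul_pow, mul_comm (((A ^ m) ^ n)), ← mul_assoc] at h3
  have h4 := le_of_mul_le_mul_right h3 (by positivity)
  rw [inv_mul_le_iff₀ (by linarith)] at h4
  have h5 : A ≤ A ^ n := le_self_pow₀ hA1.le (by omega)
  nlinarith

theorem final_of_KEY (n : ℕ) (hn : 1 ≤ n) (CE θ : ℝ) (M₀ : ℝ≥0) (V : Finset (Euc n))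
    (hV : ∀ v ∈ V, ‖v‖ = 1) (hVne : V.Nonempty) (hK : KEY n CE θ M₀ V) :
    ∃ (c₀ C : ℝ) (Nb : ℝ → ℕ), 0 < c₀ ∧ c₀ < 1 ∧ 1 ≤ C ∧
      ∀ E : Set (Euc n), IsUR n E CE θ M₀ →
        ∀ D : ChristDavid n E, ∀ Q : CDCube D,
          ∃ Ω' : Set (Euc n), IsOpen Ω' ∧ Ω' ⊆ Eᶜ ∧
            C⁻¹ * Metric.diam Q.set ≤ Metric.diam Ω' ∧
            Metric.diam Ω' ≤ C * Metric.diam Q.set ∧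
            IsADR n (frontier Ω') C ∧
            StrongTwoSidedCorkscrew Ω' c₀ ∧
            ENNReal.ofReal c₀ * μH[(n : ℝ)] Q.set ≤ μH[(n : ℝ)] (frontier Ω' ∩ Q.set) ∧
            ∀ X ∈ Ω', IsNTA (connectedComponentIn Ω' X) c₀ C Nb ∧
              IsADR n (frontier (connectedComponentIn Ω' X)) C := by
  classical
  rcases lt_or_ge CE 1 with hlt | hCE
  · exact ⟨1 / 2, 1, fun _ => 0, by norm_num, by norm_num, le_rfl, fun E hE =>
      absurd hE.1.2.1 (not_le.2 hlt)⟩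
  obtain ⟨c, hc, hc1, M, hg⟩ := greedy n CE θ M₀ V hV hVne hK
  obtain ⟨CU, hCU, hup⟩ := upper_global n CE
  set A : ℝ := CE ^ 2 + 2 with hA
  have hA2 : 2 ≤ A := by rw [hA]; nlinarith [sq_nonneg CE]
  have hA3 : 1 ≤ A ^ 3 := one_le_pow₀ (by linarith)
  set c1 : ℝ := c / 512 / (32 * A ^ 3) with hc1d
  have hc10 : 0 < c1 := by positivity
  have hc1c : c1 ≤ c / 512 := div_le_self (by positivity) (by linarith)
  have hc11 : c1 ≤ 1 := hc1c.trans (by linarith)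
  set C2 : ℝ := max 3 (max (1 / c) (M * CU * (2 / c) ^ n / c)) with hC2
  have hC23 : 3 ≤ C2 := le_max_left _ _
  have hC2c : 1 / c ≤ C2 := (le_max_left _ _).trans (le_max_right _ _)
  have hC2p : M * CU * (2 / c) ^ n / c ≤ C2 := (le_max_right _ _).trans (le_max_right _ _)
  obtain ⟨c₀, C, Nb, hc₀, hc₀1, hC, hass⟩ := assembly n (κ := 1 / 32) (c1 := c1) (C2 := C2) (CE := CU)
    (by norm_num) (by norm_num) hc10 hc11 (by linarith)
  set C' := max C (max (1 / c1) 2) with hC'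
  have hCC' : C ≤ C' := le_max_left _ _
  have hC'1 : 1 / c1 ≤ C' := (le_max_left _ _).trans (le_max_right _ _)
  have hC'2 : 2 ≤ C' := (le_max_right _ _).trans (le_max_right _ _)
  refine ⟨min c₀ (1 / 2), C', Nb, by positivity, lt_of_le_of_lt (min_le_left _ _) hc₀1, by linarith, ?_⟩
  intro E hE D Q
  have hQE : Q.set ⊆ E := D.subset_E Q.mem
  have hQne : Q.set.Nonempty := ⟨_, D.ctr_mem Q.mem⟩
  rcases Q.set.subsingleton_or_nontrivial with hsub | hnt
  · have hQ0 : μH[(n : ℝ)] Q.set = 0 := by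
      have : NullSingletonClass (μH[(n : ℝ)] : Measure (Euc n)) :=
        Measure.nullSingletonClass_hausdorff _ (by exact_mod_cast hn)
      exact hsub.measure_zero _
    refine ⟨∅, isOpen_empty, empty_subset _, ?_, ?_, ?_, ?_, ?_, fun X hX => absurd hX (notMem_empty X)⟩
    · rw [Metric.diam_subsingleton hsub]; simp
    · rw [Metric.diam_subsingleton hsub]; simp
    · rw [frontier_empty]
      exact ⟨isClosed_empty, by linarith, fun x hx => absurd hx (notMem_empty x)⟩
    · intro x hx; rw [frontier_empty] at hx; exact absurd hx (notMem_empty x)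
    · rw [hQ0]; simp
  have hEnt : E.Nontrivial := hnt.mono hQE
  have hupE := hup E hE.1 hEnt
  by_cases hQb : Bornology.IsBounded Q.set
  · -- bounded case
    set d := Metric.diam Q.set with hd
    have hd0 : 0 < d := by
      obtain ⟨a, ha, b, hb, hab⟩ := hnt
      exact (dist_pos.2 hab).trans_le (dist_le_diam_of_mem hQb ha hb)
    have hedQ : ediam Q.set = ENNReal.ofReal d := by
      rw [hd, Metric.diam, ENNReal.ofReal_toReal]
      exact Metric.isBounded_iff_ediam_ne_top.1 hQb
    have hdE : ENNReal.ofReal (d / 2) < ediam E := by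
      refine lt_of_lt_of_le ?_ (ediam_mono hQE)
      rw [hedQ]
      exact (ENNReal.ofReal_lt_ofReal_iff hd0).2 (by linarith)
    obtain ⟨ι, Ω, y, s, S, hcount, hF⟩ := hg E hE Q.set hQE hQb (d / 2) (by positivity) hdE
    have hΩd : ediam (⋃ i : (Σ _ : Unit, ι), Ω i.2) ≤ ENNReal.ofReal (3 * (d / 2)) := by
      refine ediam_le fun p hp q hq => ?_
      obtain ⟨i, hi⟩ := mem_iUnion.1 hp
      obtain ⟨j, hj⟩ := mem_iUnion.1 hq
      obtain ⟨e, he, h1, -⟩ := hF.near i.2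
      obtain ⟨e', he', h1', -⟩ := hF.near j.2
      have a := mem_ball.1 (h1 hi)
      have b := mem_ball'.1 (h1' hj)
      have h3 := dist_le_diam_of_mem hQb he he'
      rw [edist_dist]
      apply ENNReal.ofReal_le_ofReal
      linarith [dist_triangle4 p e e' q]
    have hfam := sigma_fam (J := Unit) (Y := fun _ => Q.set) (r0 := fun _ => d / 2) (ι := fun _ => ι)
      (Ω := fun _ => Ω) (y := fun _ => y) (s := fun _ => s) (S := fun _ => S) (c1 := c1) (C2 := C2) (CE := CU)
      (Dd := ENNReal.ofReal (d / 2)) (fun _ => hF) hc hc1 hc10 hc11 (by linarith) hC2c hC2p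
      (by linarith) hE.1.1 hupE (fun _ => hQE) (ENNReal.ofReal_pos.2 (by positivity))
      (fun j j' h => absurd (Subsingleton.elim j j') h)
      (fun _ e he r hr hrD => by
        rw [ENNReal.ofReal_le_ofReal_iff (by positivity)] at hrD
        obtain ⟨i, X, h1, h2⟩ := hF.cork e he r hr hrD
        have hb : ball X (c1 * r) ⊆ ball X (c / 512 * r) := ball_subset_ball (by gcongr)
        exact ⟨(), i, X, hb.trans h1, hb.trans h2⟩)
      (hΩd.trans (by
        rw [← ENNReal.ofReal_mul (by linarith)]
        apply ENNReal.ofReal_le_ofReal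
        nlinarith))
    obtain ⟨a1, a2, a3, a4, a5, a6⟩ := hass _ _ _ _ _ _ _ inferInstance hfam
    rw [iUnion_const] at a5
    have hΩb : Bornology.IsBounded (⋃ i : (Σ _ : Unit, ι), Ω i.2) :=
      Metric.isBounded_iff_ediam_ne_top.2 (lt_of_le_of_lt hΩd ENNReal.ofReal_lt_top).ne
    refine ⟨_, a1, a2, ?_, ?_, isADR_mono a3 hCC', a4.mono (min_le_left _ _), ?_, fun X hX =>
      ⟨isNTA_mono (a6 X hX).1 (min_le_left _ _) hCC', isADR_mono (a6 X hX).2 hCC'⟩⟩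
    · obtain ⟨e, he⟩ := hQne
      obtain ⟨i, X, h1, -⟩ := hF.cork e he (d / 2) (by positivity) le_rfl
      have h3 := diam_mono (h1.trans (subset_iUnion (fun i : (Σ _ : Unit, ι) => Ω i.2) ⟨(), i⟩)) hΩb
      rw [diam_ball' _ (by positivity)] at h3
      refine le_trans ?_ h3
      have h4 : C'⁻¹ ≤ c1 := by
        rw [inv_le_comm₀ (by linarith) hc10]; rwa [one_div] at hC'1
      have : C'⁻¹ * d ≤ c / 512 * d := by gcongr; linarith
      linarith
    · have h3 : Metric.diam (⋃ i : (Σ _ : Unit, ι), Ω i.2) ≤ 3 * (d / 2) :=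
        ENNReal.toReal_le_of_le_ofReal (by positivity) hΩd
      refine h3.trans ?_
      nlinarith
    · rw [inter_eq_self_of_subset_right a5]
      calc _ ≤ 1 * μH[(n : ℝ)] Q.set := by
            gcongr
            rw [ENNReal.ofReal_le_one]
            exact (min_le_left _ _).trans hc₀1.le
        _ = _ := one_mul _
  · -- unbounded case
    obtain ⟨x0, hx0Q⟩ := hQne
    have hx0 := hQE hx0Q
    have hQd : Metric.diam Q.set = 0 := Metric.diam_eq_zero_of_unbounded hQb
    have hEtop : ediam E = ⊤ := by
      by_contra h
      exact hQb ((Metric.isBounded_iff_ediam_ne_top.2 h).subset hQE)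
    have hann := annulus_nonempty hn hE.1 hEtop (A := A) (by rw [hA]; linarith) hx0
    set W : ℕ → Set (Euc n) := fun j => {e ∈ E | (j = 0 ∨ A ^ j ≤ dist e x0) ∧ dist e x0 < A ^ (j + 1)} with hW
    have hA0 : 0 < A := by linarith
    have hA1 : 1 < A := by linarith
    have hWcov : E ⊆ ⋃ j, W j := by
      intro e he
      have hex : ∃ j : ℕ, dist e x0 < A ^ (j + 1) := by
        obtain ⟨j, hj⟩ := pow_unbounded_of_one_lt (dist e x0) hA1
        exact ⟨j, hj.trans (pow_lt_pow_right₀ hA1 (by omega))⟩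
      refine mem_iUnion.2 ⟨Nat.find hex, he, ?_, Nat.find_spec hex⟩
      rcases Nat.eq_zero_or_pos (Nat.find hex) with h | h
      · exact Or.inl h
      · right
        have := Nat.find_min hex (m := Nat.find hex - 1) (by omega)
        rwa [not_lt, Nat.sub_add_cancel h] at this
    -- parity
    obtain ⟨b, hb⟩ : ∃ b : ℕ, μH[(n : ℝ)] Q.set / 2 ≤ μH[(n : ℝ)] ((⋃ j, W (2 * j + b)) ∩ Q.set) := by
      by_contra! hcon
      have hsub : Q.set ⊆ ((⋃ j, W (2 * j + 0)) ∩ Q.set) ∪ ((⋃ j, W (2 * j + 1)) ∩ Q.set) := by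
        intro e he
        obtain ⟨j, hj⟩ := mem_iUnion.1 (hWcov (hQE he))
        rcases Nat.even_or_odd' j with ⟨k, hk | hk⟩
        · exact Or.inl ⟨mem_iUnion.2 ⟨k, by rw [hk] at hj; exact hj⟩, he⟩
        · exact Or.inr ⟨mem_iUnion.2 ⟨k, by rw [hk] at hj; exact hj⟩, he⟩
      have h1 := (measure_mono hsub).trans (measure_union_le (μ := (μH[(n : ℝ)] : Measure (Euc n))) _ _)
      have h2 := ENNReal.add_lt_add (hcon 0) (hcon 1)
      rw [ENNReal.add_halves] at h2
      exact absurd (h1.trans_lt h2) (lt_irrefl _)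
    set Y : ℕ → Set (Euc n) := fun j => W (2 * j + b) with hY
    set r0 : ℕ → ℝ := fun j => A ^ (2 * j + b) / 8 with hr0
    have hYE : ∀ j, Y j ⊆ E := fun j e he => he.1
    have hYne : ∀ j, ∃ e ∈ Y j, A ^ (2 * j + b) ≤ dist e x0 := fun j => by
      obtain ⟨e, he, h1, h2⟩ := hann (2 * j + b)
      exact ⟨e, ⟨he, Or.inr h1, h2⟩, h1⟩
    have hgj := fun j => hg E hE (Y j) (hYE j)
      (isBounded_ball.subset (fun e he => mem_ball.2 he.2.2 : Y j ⊆ ball x0 (A ^ (2 * j + b + 1))))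
      (r0 j) (by simp only [hr0]; positivity) (by rw [hEtop]; exact ENNReal.ofReal_lt_top)
    choose ι Ω y s S hcount hF using hgj
    have hcr : ∀ j j', j < j' → ∀ e ∈ Y j, ∀ e' ∈ Y j', (r0 j + r0 j') / 2 ≤ dist e e' := by
      intro j j' hjj e he e' he'
      have h1 : dist e x0 < A ^ (2 * j + b + 1) := he.2.2
      have h2 : A ^ (2 * j' + b) ≤ dist e' x0 := he'.2.1.resolve_left (by omega)
      have h3 : A * A ^ (2 * j + b + 1) ≤ A ^ (2 * j' + b) := by
        rw [← pow_succ']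
        exact pow_le_pow_right₀ hA1.le (by omega)
      have h4 : A ^ (2 * j + b) ≤ A ^ (2 * j' + b) := pow_le_pow_right₀ hA1.le (by omega)
      have h5 : 0 < A ^ (2 * j + b + 1) := by positivity
      have h6 := dist_triangle e' e x0
      rw [dist_comm e' e] at h6
      simp only [hr0]
      nlinarith
    have hfam := sigma_fam (J := ℕ) (Y := Y) (r0 := r0) (ι := ι)
      (Ω := Ω) (y := y) (s := s) (S := S) (c1 := c1) (C2 := C2) (CE := CU)
      (Dd := ⊤) hF hc hc1 hc10 hc11 (by linarith) hC2c hC2p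
      (by linarith) hE.1.1 hupE hYE ENNReal.zero_lt_top
      (fun j j' h e he e' he' => by
        rcases lt_or_gt_of_ne h with h | h
        · exact hcr j j' h e he e' he'
        · have := hcr j' j h e' he' e he
          rw [dist_comm] at this
          linarith)
      (fun j e he r hr _ => by
        have hex : ∃ l : ℕ, r < 4 * A ^ (2 * (j + l) + b + 3) := by
          obtain ⟨l, hl⟩ := pow_unbounded_of_one_lt r hA1
          refine ⟨l, hl.trans ?_⟩
          have : A ^ l ≤ A ^ (2 * (j + l) + b + 3) := pow_le_pow_right₀ hA1.le (by omega)
          have : 0 < A ^ l := by positivity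
          linarith
        have hr1 := Nat.find_spec hex
        set l := Nat.find hex with hl
        have hpos : 0 < A ^ (2 * (j + l) + b) := by positivity
        have hsmall : c1 * r ≤ c / 512 * r0 (j + l) := by
          have e1 : c1 * r = c / 512 * (r / (32 * A ^ 3)) := by rw [hc1d]; ring
          rw [e1]
          gcongr
          simp only [hr0]
          rw [pow_add _ _ 3] at hr1
          rw [div_le_iff₀ (by positivity)]
          linarith
        have hfin : ∀ e' ∈ Y (j + l), ∀ r' : ℝ, 0 < r' → r' ≤ r0 (j + l) → c1 * r ≤ c / 512 * r' →
            r' + dist e' e ≤ r → ∃ j' i X, ball X (c1 * r) ⊆ Ω j' i ∧ ball X (c1 * r) ⊆ ball e r := by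
          intro e' he' r' hr' hrr hle hd
          obtain ⟨i, X, h1, h2⟩ := (hF (j + l)).cork e' he' r' hr' hrr
          have hb : ball X (c1 * r) ⊆ ball X (c / 512 * r') := ball_subset_ball hle
          exact ⟨j + l, i, X, hb.trans h1, (hb.trans h2).trans (ball_subset_ball' hd)⟩
        rcases Nat.eq_zero_or_pos l with h0 | h0
        · rw [h0, add_zero] at hfin hsmall
          rcases le_total r (r0 j) with hrr | hrr
          · exact hfin e he r hr hrr (by gcongr) (by simp)
          · exact hfin e he (r0 j) (by simp only [hr0]; positivity) le_rfl hsmall (by simpa using hrr)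
        · have hmin := Nat.find_min hex (m := l - 1) (by omega)
          rw [not_lt, show 2 * (j + (l - 1)) + b + 3 = 2 * (j + l) + b + 1 by omega] at hmin
          obtain ⟨e', he', -⟩ := hYne (j + l)
          have h1 : dist e x0 < A ^ (2 * j + b + 1) := he.2.2
          have h2 : A ^ (2 * j + b + 1) ≤ A ^ (2 * (j + l) + b + 1) := pow_le_pow_right₀ hA1.le (by omega)
          have h3 : dist e' x0 < A ^ (2 * (j + l) + b + 1) := he'.2.2
          have h4 : A ^ (2 * (j + l) + b) ≤ A ^ (2 * (j + l) + b + 1) := pow_le_pow_right₀ hA1.le (by omega)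
          refine hfin e' he' (r0 (j + l)) (by simp only [hr0]; positivity) le_rfl hsmall ?_
          simp only [hr0]
          have h5 := dist_triangle_right e' e x0
          linarith)
      (by rw [ENNReal.mul_top (ENNReal.ofReal_pos.2 (by linarith)).ne']; exact le_top)
    obtain ⟨a1, a2, a3, a4, a5, a6⟩ := hass _ _ _ _ _ _ _ inferInstance hfam
    have hΩu : ¬ Bornology.IsBounded (⋃ i : (Σ j, ι j), Ω i.1 i.2) := by
      intro hbd
      have hbd2 := (hbd.closure).subset (a5.trans frontier_subset_closure)
      obtain ⟨R, hR⟩ := hbd2.subset_ball x0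
      obtain ⟨j, hj⟩ := pow_unbounded_of_one_lt R hA1
      obtain ⟨e, he, h1⟩ := hYne j
      have h2 := mem_ball.1 (hR (mem_iUnion.2 ⟨j, he⟩))
      have h3 : A ^ j ≤ A ^ (2 * j + b) := pow_le_pow_right₀ hA1.le (by omega)
      linarith
    have hΩd := Metric.diam_eq_zero_of_unbounded hΩu
    refine ⟨_, a1, a2, ?_, ?_, isADR_mono a3 hCC', a4.mono (min_le_left _ _), ?_, fun X hX =>
      ⟨isNTA_mono (a6 X hX).1 (min_le_left _ _) hCC', isADR_mono (a6 X hX).2 hCC'⟩⟩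
    · rw [hQd, hΩd, mul_zero]
    · rw [hQd, hΩd, mul_zero]
    · refine le_trans ?_ (hb.trans (measure_mono (inter_subset_inter_left _ a5)))
      rw [ENNReal.div_eq_inv_mul]
      gcongr
      calc ENNReal.ofReal (min c₀ (1 / 2)) ≤ ENNReal.ofReal (1 / 2) :=
            ENNReal.ofReal_le_ofReal (min_le_right _ _)
        _ = 2⁻¹ := by rw [one_div, ENNReal.ofReal_inv_of_pos (by norm_num)]; simp

/-- Box in the integer lattice. -/
def zbox (n : ℕ) (a : ℕ) : Finset (Fin n → ℤ) := Fintype.piFinset fun _ => Finset.Icc (-(a : ℤ)) a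

lemma mem_zbox {n a : ℕ} {p : Fin n → ℤ} : p ∈ zbox n a ↔ ∀ i, |p i| ≤ a := by
  simp [zbox, Fintype.mem_piFinset, abs_le]

lemma card_zbox (n a : ℕ) : (zbox n a).card = (2 * a + 1) ^ n := by
  simp [zbox, Fintype.card_piFinset]
  congr 1; omega

/-- Lipschitz on the lattice w.r.t. the sup distance. -/
def LipZ {n : ℕ} {H : Type*} [NormedAddCommGroup H] (f : (Fin n → ℤ) → H) (M : ℝ) : Prop :=
  ∀ p q : Fin n → ℤ, ∀ d : ℝ, 0 ≤ d → (∀ i, |(p i : ℝ) - q i| ≤ d) → ‖f p - f q‖ ≤ M * d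

section energy
variable {n : ℕ} {H : Type*} [NormedAddCommGroup H] [InnerProductSpace ℝ H]

def sdf (f : (Fin n → ℤ) → H) (w : Fin n → ℤ) (g : ℕ) (x : Fin n → ℤ) : H :=
  f (x + (2 : ℤ) ^ g • w + (2 : ℤ) ^ g • w) - (2 : ℝ) • f (x + (2 : ℤ) ^ g • w) + f x

def enE (f : (Fin n → ℤ) → H) (w : Fin n → ℤ) (g a : ℕ) : ℝ :=
  ∑ x ∈ zbox n a, ‖f (x + (2 : ℤ) ^ g • w) - f x‖ ^ 2 / 4 ^ g

def enS (f : (Fin n → ℤ) → H) (w : Fin n → ℤ) (g a : ℕ) : ℝ :=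
  ∑ x ∈ zbox n a, ‖sdf f w g x‖ ^ 2 / 4 ^ (g + 1)

lemma zbox_mono {a b : ℕ} (h : a ≤ b) : zbox n a ⊆ zbox n b := by
  intro p hp
  rw [mem_zbox] at *
  exact fun i => (hp i).trans (by exact_mod_cast h)

lemma zbox_shift {a b : ℕ} {p w : Fin n → ℤ} (hp : p ∈ zbox n a) (hw : w ∈ zbox n b) :
    p + w ∈ zbox n (a + b) := by
  rw [mem_zbox] at *
  intro i
  push_cast
  exact (abs_add_le _ _).trans (add_le_add (hp i) (hw i))

lemma zbox_smul {a g : ℕ} {w : Fin n → ℤ} (hw : w ∈ zbox n a) :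
    (2 : ℤ) ^ g • w ∈ zbox n (2 ^ g * a) := by
  rw [mem_zbox] at *
  intro i
  simp only [Pi.smul_apply, smul_eq_mul, abs_mul, abs_pow, abs_two]
  push_cast
  gcongr
  exact hw i

lemma enS_mono (f : (Fin n → ℤ) → H) (w : Fin n → ℤ) (g : ℕ) {a b : ℕ} (h : a ≤ b) :
    enS f w g a ≤ enS f w g b :=
  Finset.sum_le_sum_of_subset_of_nonneg (zbox_mono h) fun _ _ _ => by positivity

lemma sum_shift_le (F : (Fin n → ℤ) → ℝ) (hF : ∀ x, 0 ≤ F x) {a b : ℕ} {w : Fin n → ℤ}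
    (hw : w ∈ zbox n b) : ∑ x ∈ zbox n a, F (x + w) ≤ ∑ x ∈ zbox n (a + b), F x := by
  classical
  have : ∑ x ∈ zbox n a, F (x + w) = ∑ x ∈ (zbox n a).image (· + w), F x := by
    rw [Finset.sum_image]
    intro x _ y _ h
    exact add_right_cancel h
  rw [this]
  refine Finset.sum_le_sum_of_subset_of_nonneg ?_ fun _ _ _ => hF _
  intro x hx
  obtain ⟨y, hy, rfl⟩ := Finset.mem_image.1 hx
  exact zbox_shift hy hw

lemma energy_step (f : (Fin n → ℤ) → H) (w : Fin n → ℤ) {W : ℕ} (hw : w ∈ zbox n W) (g a : ℕ) :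
    enS f w g a + enE f w (g + 1) a ≤ enE f w g (a + 2 ^ g * W) := by
  have h1 := sum_shift_le (a := a) (fun x => ‖f (x + (2 : ℤ) ^ g • w) - f x‖ ^ 2 / 4 ^ g)
    (fun x => by positivity) (zbox_smul (g := g) hw)
  have h2 : ∑ x ∈ zbox n a, ‖f (x + (2 : ℤ) ^ g • w) - f x‖ ^ 2 / 4 ^ g ≤ enE f w g (a + 2 ^ g * W) :=
    Finset.sum_le_sum_of_subset_of_nonneg (zbox_mono (by omega)) fun _ _ _ => by positivity
  have h3 : enS f w g a + enE f w (g + 1) a =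
      (∑ x ∈ zbox n a, ‖f (x + (2 : ℤ) ^ g • w + (2 : ℤ) ^ g • w) - f (x + (2 : ℤ) ^ g • w)‖ ^ 2 / 4 ^ g
       + ∑ x ∈ zbox n a, ‖f (x + (2 : ℤ) ^ g • w) - f x‖ ^ 2 / 4 ^ g) / 2 := by
    unfold enS enE
    rw [← Finset.sum_add_distrib, ← Finset.sum_add_distrib, Finset.sum_div]
    refine Finset.sum_congr rfl fun x _ => ?_
    have e : x + (2 : ℤ) ^ (g + 1) • w = x + (2 : ℤ) ^ g • w + (2 : ℤ) ^ g • w := by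
      ext i; simp [pow_succ]; ring
    rw [e]
    unfold sdf
    set A := f (x + (2 : ℤ) ^ g • w + (2 : ℤ) ^ g • w)
    set B := f (x + (2 : ℤ) ^ g • w)
    set C := f x
    have hp := parallelogram_law_with_norm ℝ (A - B) (B - C)
    have e1 : A - B - (B - C) = A - (2 : ℝ) • B + C := by rw [two_smul]; abel
    have e2 : A - B + (B - C) = A - C := by abel
    rw [e1, e2] at hp
    rw [← add_div, add_comm (‖A - (2 : ℝ) • B + C‖ ^ 2), hp, pow_succ (4 : ℝ), ← add_div]
    field_simp
    ring
  have h1' : ∑ x ∈ zbox n a, ‖f (x + (2 : ℤ) ^ g • w + (2 : ℤ) ^ g • w) - f (x + (2 : ℤ) ^ g • w)‖ ^ 2 / 4 ^ g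
      ≤ enE f w g (a + 2 ^ g * W) := h1
  linarith

lemma energy_tele (f : (Fin n → ℤ) → H) (w : Fin n → ℤ) {W : ℕ} (hw : w ∈ zbox n W) (m : ℕ) :
    ∀ a, ∑ g ∈ Finset.range m, enS f w g a + enE f w m a ≤ enE f w 0 (a + (2 ^ m - 1) * W) := by
  induction m with
  | zero => intro a; simp
  | succ m ih =>
    intro a
    rw [Finset.sum_range_succ, add_assoc]
    have h1 := energy_step f w hw m a
    have h2 := ih (a + 2 ^ m * W)
    have h3 : ∑ g ∈ Finset.range m, enS f w g a ≤ ∑ g ∈ Finset.range m, enS f w g (a + 2 ^ m * W) :=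
      Finset.sum_le_sum fun g _ => enS_mono f w g (by omega)
    have e : a + 2 ^ m * W + (2 ^ m - 1) * W = a + (2 ^ (m + 1) - 1) * W := by
      have : 1 ≤ 2 ^ m := Nat.one_le_two_pow
      obtain ⟨k, hk⟩ := Nat.exists_eq_add_of_le this
      rw [pow_succ, hk, show (1 + k) * 2 - 1 = 2 * k + 1 by omega, show 1 + k - 1 = k by omega]
      ring
    rw [e] at h2
    linarith

lemma energy_zero {f : (Fin n → ℤ) → H} {M : ℝ} (hf : LipZ f M) (hM : 0 ≤ M) (w : Fin n → ℤ) {W : ℕ}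
    (hw : w ∈ zbox n W) (A : ℕ) : enE f w 0 A ≤ (M * W) ^ 2 * (2 * A + 1) ^ n := by
  unfold enE
  calc _ ≤ ∑ x ∈ zbox n A, (M * W) ^ 2 := by
        refine Finset.sum_le_sum fun x _ => ?_
        simp only [pow_zero, one_smul, div_one]
        gcongr
        refine hf _ _ _ (by positivity) fun i => ?_
        have := mem_zbox.1 hw i
        simp only [Pi.add_apply, Int.cast_add, add_sub_cancel_left]
        exact_mod_cast this
    _ = _ := by
        rw [Finset.sum_const, card_zbox, nsmul_eq_mul]; push_cast; ring

lemma energy_bound {f : (Fin n → ℤ) → H} {M : ℝ} (hf : LipZ f M) (hM : 0 ≤ M) (w : Fin n → ℤ) {W : ℕ}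
    (hw : w ∈ zbox n W) (m a : ℕ) :
    ∑ g ∈ Finset.range m, enS f w g a ≤ (M * W) ^ 2 * (2 * (a + 2 ^ m * W) + 1) ^ n := by
  have h1 := energy_tele f w hw m a
  have h2 : 0 ≤ enE f w m a := Finset.sum_nonneg fun _ _ => by positivity
  have h3 := energy_zero hf hM w hw (a + (2 ^ m - 1) * W)
  have h4 : (2 * ((a + (2 ^ m - 1) * W : ℕ) : ℝ) + 1) ^ n ≤ (2 * (a + 2 ^ m * W) + 1) ^ n := by
    gcongr
    have : (2 ^ m - 1) * W ≤ 2 ^ m * W := Nat.mul_le_mul_right _ (Nat.sub_le _ _)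
    exact_mod_cast Nat.add_le_add_left this a
  have h5 : 0 ≤ (M * W) ^ 2 := by positivity
  nlinarith [mul_le_mul_of_nonneg_left h4 h5]

def abad (f : (Fin n → ℤ) → H) (R : ℕ) (δ : ℝ) (g : ℕ) (p : Fin n → ℤ) : Prop :=
  ∃ u ∈ zbox n R, ∃ w ∈ zbox n R, δ * 2 ^ g < ‖sdf f w g (p + (2 : ℤ) ^ g • (u - w))‖

lemma le_dsum {α β : Type*} {S : Finset α} {T : Finset β} (F : α → β → ℝ) (hF : ∀ u w, 0 ≤ F u w)
    {u : α} {w : β} (hu : u ∈ S) (hw : w ∈ T) {c : ℝ} (hc : c ≤ F u w) :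
    c ≤ ∑ u ∈ S, ∑ w ∈ T, F u w :=
  hc.trans ((Finset.single_le_sum (f := fun w => F u w) (fun w _ => hF u w) hw).trans
    (Finset.single_le_sum (f := fun u => ∑ w ∈ T, F u w)
      (fun u _ => Finset.sum_nonneg fun w _ => hF u w) hu))

open Classical in
lemma abad_count (n : ℕ) {M δ : ℝ} (hM : 0 ≤ M) (hδ : 0 < δ) (R a0 : ℕ) : ∃ C : ℝ, 0 ≤ C ∧
    ∀ f : (Fin n → ℤ) → H, LipZ f M → ∀ m : ℕ,
    ∑ g ∈ Finset.range m, (((zbox n (a0 * 2 ^ m)).filter (abad f R δ g)).card : ℝ) ≤ C * (2 ^ m) ^ n := by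
  refine ⟨((2 * R + 1) ^ n : ℕ) * (((2 * R + 1) ^ n : ℕ) * (4 / δ ^ 2 * ((M * R) ^ 2 * (2 * (a0 + 3 * R) + 1) ^ n))),
    by positivity, fun f hf m => ?_⟩
  have key : ∀ g ∈ Finset.range m, (((zbox n (a0 * 2 ^ m)).filter (abad f R δ g)).card : ℝ) ≤
      ∑ u ∈ zbox n R, ∑ w ∈ zbox n R, 4 / δ ^ 2 * enS f w g (a0 * 2 ^ m + 2 ^ m * (2 * R)) := by
    intro g hg
    have hgm : g < m := Finset.mem_range.1 hg
    have h1 : ∀ p ∈ (zbox n (a0 * 2 ^ m)).filter (abad f R δ g), (1 : ℝ) ≤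
        ∑ u ∈ zbox n R, ∑ w ∈ zbox n R, 4 / δ ^ 2 *
          (‖sdf f w g (p + (2 : ℤ) ^ g • (u - w))‖ ^ 2 / 4 ^ (g + 1)) := by
      intro p hp
      obtain ⟨u, hu, w, hw, h⟩ := (Finset.mem_filter.1 hp).2
      have h2 : (1 : ℝ) ≤ 4 / δ ^ 2 * (‖sdf f w g (p + (2 : ℤ) ^ g • (u - w))‖ ^ 2 / 4 ^ (g + 1)) := by
        have : (δ * 2 ^ g) ^ 2 ≤ ‖sdf f w g (p + (2 : ℤ) ^ g • (u - w))‖ ^ 2 := by gcongr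
        rw [mul_pow, ← pow_mul, mul_comm g 2, pow_mul] at this
        rw [div_mul_div_comm, one_le_div (by positivity), pow_succ (4 : ℝ)]
        rw [show ((2 : ℝ) ^ 2) = 4 by norm_num] at this
        linarith
      exact le_dsum (fun u w => 4 / δ ^ 2 *
          (‖sdf f w g (p + (2 : ℤ) ^ g • (u - w))‖ ^ 2 / 4 ^ (g + 1))) (fun _ _ => by positivity) hu hw h2
    calc (((zbox n (a0 * 2 ^ m)).filter (abad f R δ g)).card : ℝ)
        = ∑ p ∈ (zbox n (a0 * 2 ^ m)).filter (abad f R δ g), (1 : ℝ) := by simp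
      _ ≤ ∑ p ∈ (zbox n (a0 * 2 ^ m)).filter (abad f R δ g), ∑ u ∈ zbox n R, ∑ w ∈ zbox n R, 4 / δ ^ 2 *
          (‖sdf f w g (p + (2 : ℤ) ^ g • (u - w))‖ ^ 2 / 4 ^ (g + 1)) := Finset.sum_le_sum h1
      _ ≤ ∑ p ∈ zbox n (a0 * 2 ^ m), ∑ u ∈ zbox n R, ∑ w ∈ zbox n R, 4 / δ ^ 2 *
          (‖sdf f w g (p + (2 : ℤ) ^ g • (u - w))‖ ^ 2 / 4 ^ (g + 1)) :=
          Finset.sum_le_sum_of_subset_of_nonneg (Finset.filter_subset _ _) fun _ _ _ => by positivity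
      _ = ∑ u ∈ zbox n R, ∑ w ∈ zbox n R, 4 / δ ^ 2 * ∑ p ∈ zbox n (a0 * 2 ^ m),
          (‖sdf f w g (p + (2 : ℤ) ^ g • (u - w))‖ ^ 2 / 4 ^ (g + 1)) := by
          rw [Finset.sum_comm]
          refine Finset.sum_congr rfl fun u _ => ?_
          rw [Finset.sum_comm]
          refine Finset.sum_congr rfl fun w _ => ?_
          rw [Finset.mul_sum]
      _ ≤ _ := by
          refine Finset.sum_le_sum fun u hu => Finset.sum_le_sum fun w hw => ?_
          gcongr
          have huw : u - w ∈ zbox n (2 * R) := by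
            rw [mem_zbox] at *
            intro i
            push_cast
            exact (abs_sub _ _).trans (by linarith [hu i, hw i])
          refine (sum_shift_le (fun x => ‖sdf f w g x‖ ^ 2 / 4 ^ (g + 1)) (fun _ => by positivity)
            (zbox_smul (g := g) huw)).trans ?_
          refine enS_mono f w g ?_
          have : 2 ^ g ≤ 2 ^ m := Nat.pow_le_pow_right (by norm_num) hgm.le
          gcongr
  refine (Finset.sum_le_sum key).trans ?_
  rw [Finset.sum_comm]
  calc _ ≤ ∑ u ∈ zbox n R, ∑ w ∈ zbox n R, 4 / δ ^ 2 * ((M * R) ^ 2 * (2 * (a0 + 3 * R) + 1) ^ n * (2 ^ m) ^ n) := by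
        refine Finset.sum_le_sum fun u hu => ?_
        rw [Finset.sum_comm]
        refine Finset.sum_le_sum fun w hw => ?_
        rw [← Finset.mul_sum]
        gcongr
        refine (energy_bound hf hM w hw m _).trans ?_
        rw [mul_assoc, ← mul_pow]
        gcongr
        push_cast
        have : (1 : ℝ) ≤ 2 ^ m := one_le_pow₀ (by norm_num)
        nlinarith
    _ = _ := by
        simp only [Finset.sum_const, card_zbox, nsmul_eq_mul]
        ring
end energy

section affine
variable {n : ℕ} {H : Type*} [NormedAddCommGroup H] [InnerProductSpace ℝ H]

lemma almost_add {ψ : (Fin n → ℤ) → H} {η : ℝ} {R : ℕ} (hR : 1 ≤ R) (h0 : ψ 0 = 0)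
    (h : ∀ a b, a ∈ zbox n R → b ∈ zbox n R → ‖ψ (a + b) - ψ a - ψ b‖ ≤ η) :
    ∀ L : ℕ, ∀ a ∈ zbox n R, ∑ i, (a i).natAbs = L →
      ‖ψ a - ∑ i, (a i : ℝ) • ψ (Pi.single i 1)‖ ≤ L * η := by
  intro L
  induction L with
  | zero =>
    intro a _ hL
    have : a = 0 := by
      ext i
      have := (Finset.sum_eq_zero_iff.1 hL) i (Finset.mem_univ i)
      simpa using this
    subst this
    simp [h0]
  | succ L ih =>
    intro a ha hL
    have hex : ∃ i, a i ≠ 0 := by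
      by_contra hc
      push Not at hc
      simp [hc] at hL
    obtain ⟨i, hi⟩ := hex
    have hei : (Pi.single i 1 : Fin n → ℤ) ∈ zbox n R := by
      rw [mem_zbox]; intro j
      by_cases hj : j = i
      · subst hj; simp; exact_mod_cast hR
      · simp [hj]
    have hsum : ∀ b : Fin n → ℤ, ∀ e : ℤ, b = a + e • Pi.single i 1 → 
        ∑ j, (b j : ℝ) • ψ (Pi.single j 1) = ∑ j, (a j : ℝ) • ψ (Pi.single j 1) + (e : ℝ) • ψ (Pi.single i 1) := by
      intro b e hb
      have : ∀ j, (b j : ℝ) • ψ (Pi.single j 1) = (a j : ℝ) • ψ (Pi.single j 1)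
          + (if j = i then (e : ℝ) • ψ (Pi.single i 1) else 0) := by
        intro j
        subst hb
        by_cases hj : j = i
        · subst hj; simp [add_smul]
        · simp [hj]
      rw [Finset.sum_congr rfl fun j _ => this j, Finset.sum_add_distrib]
      simp
    have hcount : ∀ b : Fin n → ℤ, (∀ j, j ≠ i → b j = a j) → (b i).natAbs + 1 = (a i).natAbs →
        ∑ j, (b j).natAbs = L := by
      intro b hb hbi
      have h1 := Finset.add_sum_erase Finset.univ (fun j => (b j).natAbs) (Finset.mem_univ i)
      have h2 := Finset.add_sum_erase Finset.univ (fun j => (a j).natAbs) (Finset.mem_univ i)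
      have h3 : ∑ j ∈ Finset.univ.erase i, (b j).natAbs = ∑ j ∈ Finset.univ.erase i, (a j).natAbs :=
        Finset.sum_congr rfl fun j hj => by rw [hb j (Finset.ne_of_mem_erase hj)]
      omega
    have hbox : ∀ b : Fin n → ℤ, (∀ j, j ≠ i → b j = a j) → (b i).natAbs + 1 = (a i).natAbs →
        b ∈ zbox n R := by
      intro b hb hbi
      rw [mem_zbox] at *
      intro j
      by_cases hj : j = i
      · subst hj; have := ha j; rw [Int.abs_eq_natAbs] at *; omega
      · rw [hb j hj]; exact ha j
    rcases lt_or_gt_of_ne hi with hneg | hpos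
    · set b : Fin n → ℤ := a + (1 : ℤ) • Pi.single i 1 with hb
      have c1 : ∀ j, j ≠ i → b j = a j := fun j hj => by simp [hb, hj]
      have c2 : (b i).natAbs + 1 = (a i).natAbs := by simp [hb]; omega
      have h1 := ih b (hbox b c1 c2) (hcount b c1 c2)
      rw [hsum b 1 hb] at h1
      have h2 := h a _ ha hei
      rw [one_smul] at hb
      rw [← hb] at h2
      set Z := ∑ j, (a j : ℝ) • ψ (Pi.single j 1)
      have e : ψ a - Z = (ψ b - (Z + ((1 : ℤ) : ℝ) • ψ (Pi.single i 1))) - (ψ b - ψ a - ψ (Pi.single i 1)) := by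
        simp; abel
      rw [e]
      refine (norm_sub_le _ _).trans ?_
      push_cast at h1 ⊢
      linarith
    · set b : Fin n → ℤ := a + (-1 : ℤ) • Pi.single i 1 with hb
      have c1 : ∀ j, j ≠ i → b j = a j := fun j hj => by simp [hb, hj]
      have c2 : (b i).natAbs + 1 = (a i).natAbs := by simp [hb]; omega
      have h1 := ih b (hbox b c1 c2) (hcount b c1 c2)
      rw [hsum b _ hb] at h1
      have h2 := h b _ (hbox b c1 c2) hei
      have hb' : b + Pi.single i 1 = a := by rw [hb]; simp
      rw [hb'] at h2
      set Z := ∑ j, (a j : ℝ) • ψ (Pi.single j 1)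
      have e : ψ a - Z = (ψ b - (Z + ((-1 : ℤ) : ℝ) • ψ (Pi.single i 1))) + (ψ a - ψ b - ψ (Pi.single i 1)) := by
        simp; abel
      rw [e]
      refine (norm_add_le _ _).trans ?_
      push_cast at h1 ⊢
      linarith

lemma affine_raw {f : (Fin n → ℤ) → H} {M δ : ℝ} (hM : 0 ≤ M) (hf : LipZ f M) {R g : ℕ}
    (hR : 1 ≤ R) (hδ : 0 ≤ δ) {p : Fin n → ℤ} (hp : ¬ abad f (2 * R) δ g p) :
    ∃ b : Fin n → H, ∀ q : Fin n → ℤ, (∀ i, |q i - p i| ≤ R * 2 ^ (g + 1)) →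
      ‖f q - f p - ∑ i, ((q i - p i : ℤ) : ℝ) • b i‖ ≤ (n + 1) * M * 2 ^ (g + 1) + n * R * δ * 2 ^ (g + 1) := by
  set ψ : (Fin n → ℤ) → H := fun a => f (p + (2 : ℤ) ^ (g + 1) • a) - f p with hψ
  have hpow : (0 : ℝ) < 2 ^ (g + 1) := by positivity
  have hsd : ∀ u ∈ zbox n (2 * R), ∀ w ∈ zbox n (2 * R),
      ‖f (p + (2 : ℤ) ^ g • (u + w)) - (2 : ℝ) • f (p + (2 : ℤ) ^ g • u) + f (p + (2 : ℤ) ^ g • (u - w))‖ ≤ δ * 2 ^ g := by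
    intro u hu w hw
    unfold abad at hp
    push Not at hp
    have := hp u hu w hw
    unfold sdf at this
    have e1 : p + (2 : ℤ) ^ g • (u - w) + (2 : ℤ) ^ g • w = p + (2 : ℤ) ^ g • u := by
      rw [smul_sub]; abel
    have e2 : p + (2 : ℤ) ^ g • u + (2 : ℤ) ^ g • w = p + (2 : ℤ) ^ g • (u + w) := by
      rw [smul_add]; abel
    rwa [e1, e2] at this
  have hadd : ∀ a b, a ∈ zbox n R → b ∈ zbox n R → ‖ψ (a + b) - ψ a - ψ b‖ ≤ δ * 2 ^ (g + 1) := by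
    intro a b ha hb
    have hs : a + b ∈ zbox n (2 * R) := by rw [two_mul]; exact zbox_shift ha hb
    have hd : a - b ∈ zbox n (2 * R) := by
      rw [mem_zbox] at *
      intro i
      push_cast
      exact (abs_sub _ _).trans (by linarith [ha i, hb i])
    have h1 := hsd _ hs _ hd
    have h2 := hsd _ hs _ hs
    rw [show a + b + (a - b) = a + a by abel, show a + b - (a - b) = b + b by abel] at h1
    rw [sub_self, smul_zero, add_zero] at h2
    have e : ∀ c : Fin n → ℤ, (2 : ℤ) ^ g • (c + c) = (2 : ℤ) ^ (g + 1) • c := by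
      intro c; ext i; simp [pow_succ]; ring
    rw [e] at h1 h2
    rw [e] at h1
    have e3 : ψ (a + b) - ψ a - ψ b =
        (f (p + (2 : ℤ) ^ (g + 1) • (a + b)) - (2 : ℝ) • f (p + (2 : ℤ) ^ g • (a + b)) + f p)
        - (f (p + (2 : ℤ) ^ (g + 1) • a) - (2 : ℝ) • f (p + (2 : ℤ) ^ g • (a + b)) + f (p + (2 : ℤ) ^ (g + 1) • b)) := by
      simp only [hψ]; abel
    rw [e3]
    refine (norm_sub_le _ _).trans ?_
    rw [pow_succ (2 : ℝ)]
    linarith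
  have h0 : ψ 0 = 0 := by simp [hψ]
  have hψM : ∀ i, ‖ψ (Pi.single i 1)‖ ≤ M * 2 ^ (g + 1) := by
    intro i
    refine hf _ _ _ hpow.le fun j => ?_
    by_cases hj : j = i
    · subst hj; simp
    · simp [hj]
  refine ⟨fun i => ((2 : ℝ) ^ (g + 1))⁻¹ • ψ (Pi.single i 1), fun q hq => ?_⟩
  set a : Fin n → ℤ := fun i => (q i - p i) / (2 ^ (g + 1)) with ha
  have hpz : (0 : ℤ) < 2 ^ (g + 1) := by positivity
  have habox : a ∈ zbox n R := by
    rw [mem_zbox]; intro i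
    have h1 := hq i
    simp only [ha]
    rw [abs_le] at h1 ⊢
    exact ⟨Int.le_ediv_of_mul_le hpz (by linarith [h1.1]), Int.ediv_le_of_le_mul hpz h1.2⟩
  have hres : ∀ i, |((q i : ℝ) - p i) - (2 : ℝ) ^ (g + 1) * a i| ≤ 2 ^ (g + 1) := by
    intro i
    have h2 : (q i - p i) - 2 ^ (g + 1) * a i = (q i - p i) % (2 ^ (g + 1)) := by
      have := Int.mul_ediv_add_emod (q i - p i) (2 ^ (g + 1))
      simp only [ha]
      linarith
    have h3 : |(q i - p i) % (2 ^ (g + 1))| ≤ 2 ^ (g + 1) := by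
      have h4 := Int.emod_lt_of_pos (q i - p i) hpz
      have h5 := Int.emod_nonneg (q i - p i) hpz.ne'
      rw [abs_le]; constructor <;> linarith
    rw [← h2] at h3
    exact_mod_cast h3
  have h1 := almost_add hR h0 hadd _ a habox rfl
  have hL : ((∑ i, (a i).natAbs : ℕ) : ℝ) ≤ n * R := by
    have : ∑ i, (a i).natAbs ≤ ∑ i : Fin n, R := Finset.sum_le_sum fun i _ => by
      have := mem_zbox.1 habox i
      rw [Int.abs_eq_natAbs] at this
      exact_mod_cast this
    simp at this
    exact_mod_cast this
  have h2 : ‖f q - f (p + (2 : ℤ) ^ (g + 1) • a)‖ ≤ M * 2 ^ (g + 1) := by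
    refine hf _ _ _ hpow.le fun i => ?_
    have := hres i
    simp only [Pi.add_apply, Pi.smul_apply, smul_eq_mul]
    push_cast
    rwa [← sub_sub]
  have h3 : ‖∑ i, (((q i : ℝ) - p i) - (2 : ℝ) ^ (g + 1) * a i) • ((2 : ℝ) ^ (g + 1))⁻¹ • ψ (Pi.single i 1)‖
      ≤ n * (M * 2 ^ (g + 1)) := by
    refine (norm_sum_le _ _).trans ?_
    calc _ ≤ ∑ i : Fin n, M * 2 ^ (g + 1) := by
          refine Finset.sum_le_sum fun i _ => ?_
          rw [norm_smul, norm_smul, Real.norm_eq_abs, norm_inv, Real.norm_of_nonneg hpow.le]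
          calc _ ≤ (2 : ℝ) ^ (g + 1) * (((2 : ℝ) ^ (g + 1))⁻¹ * (M * 2 ^ (g + 1))) := by
                gcongr
                · exact hres i
                · exact hψM i
            _ = _ := by field_simp
      _ = _ := by simp
  have e : f q - f p - ∑ i, ((q i - p i : ℤ) : ℝ) • ((2 : ℝ) ^ (g + 1))⁻¹ • ψ (Pi.single i 1) =
      (f q - f (p + (2 : ℤ) ^ (g + 1) • a)) + (ψ a - ∑ i, (a i : ℝ) • ψ (Pi.single i 1))
      - ∑ i, (((q i : ℝ) - p i) - (2 : ℝ) ^ (g + 1) * a i) • ((2 : ℝ) ^ (g + 1))⁻¹ • ψ (Pi.single i 1) := by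
    have e1 : ∑ i, (((q i : ℝ) - p i) - (2 : ℝ) ^ (g + 1) * a i) • ((2 : ℝ) ^ (g + 1))⁻¹ • ψ (Pi.single i 1)
        = ∑ i, ((q i - p i : ℤ) : ℝ) • ((2 : ℝ) ^ (g + 1))⁻¹ • ψ (Pi.single i 1)
          - ∑ i, (a i : ℝ) • ψ (Pi.single i 1) := by
      rw [← Finset.sum_sub_distrib]
      refine Finset.sum_congr rfl fun i _ => ?_
      rw [sub_smul, smul_smul ((2 : ℝ) ^ (g + 1) * a i)]
      congr 2
      · push_cast; ring
      · field_simp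
    rw [e1]
    simp only [hψ]
    abel
  rw [e]
  refine (norm_sub_le _ _).trans ?_
  have h4 := norm_add_le (f q - f (p + (2 : ℤ) ^ (g + 1) • a)) (ψ a - ∑ i, (a i : ℝ) • ψ (Pi.single i 1))
  have h5 : ((∑ i, (a i).natAbs : ℕ) : ℝ) * (δ * 2 ^ (g + 1)) ≤ n * R * (δ * 2 ^ (g + 1)) := by gcongr
  nlinarith

end affine

section affine2
variable {n : ℕ} {H : Type*} [NormedAddCommGroup H] [InnerProductSpace ℝ H]

/-- Dyadic difference quotient in direction `i` at scale `2^G`. -/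
def avA (f : (Fin n → ℤ) → H) (i : Fin n) (G : ℕ) (p : Fin n → ℤ) : H :=
  ((2 : ℝ) ^ G)⁻¹ • (f (Function.update p i (p i / 2 ^ G * 2 ^ G + 2 ^ G)) -
    f (Function.update p i (p i / 2 ^ G * 2 ^ G)))

def agood (f : (Fin n → ℤ) → H) (L : ℕ) (ε : ℝ) (G : ℕ) (p : Fin n → ℤ) : Prop :=
  ∀ q : Fin n → ℤ, (∀ i, |q i - p i| ≤ L * 2 ^ G) →
    ‖f q - f p - ∑ i, ((q i - p i : ℤ) : ℝ) • avA f i G p‖ ≤ ε * 2 ^ G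

lemma agood_of {f : (Fin n → ℤ) → H} {L : ℕ} (hL : 1 ≤ L) {ε : ℝ} {G : ℕ} {p : Fin n → ℤ}
    (b : Fin n → H) (hb : ∀ q : Fin n → ℤ, (∀ i, |q i - p i| ≤ L * 2 ^ G) →
      ‖f q - f p - ∑ i, ((q i - p i : ℤ) : ℝ) • b i‖ ≤ ε * 2 ^ G) :
    agood f L ((1 + 2 * n * L) * ε) G p := by
  have hpz : (0 : ℤ) < 2 ^ G := by positivity
  have hpr : (0 : ℝ) < 2 ^ G := by positivity
  have hL' : (1 : ℤ) ≤ L := by exact_mod_cast hL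
  have hA : ∀ i, ‖avA f i G p - b i‖ ≤ 2 * ε := by
    intro i
    set c := p i / 2 ^ G * 2 ^ G with hc
    have hc1 : c ≤ p i := Int.ediv_mul_le _ hpz.ne'
    have hc2 : p i < c + 2 ^ G := by
      have := Int.lt_ediv_add_one_mul_self (p i) hpz
      rw [add_mul, one_mul] at this
      exact this
    have hrange : ∀ d : ℤ, |d - p i| ≤ 2 ^ G → ∀ j, |Function.update p i d j - p j| ≤ L * 2 ^ G := by
      intro d hd j
      by_cases hj : j = i
      · subst hj; simp; nlinarith
      · simp [hj]
    have hsum : ∀ d : ℤ, ∑ j, ((Function.update p i d j - p j : ℤ) : ℝ) • b j = ((d - p i : ℤ) : ℝ) • b i := by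
      intro d
      rw [Finset.sum_eq_single i]
      · simp
      · intro j _ hj; simp [hj]
      · simp
    have h1 := hb _ (hrange (c + 2 ^ G) (by rw [abs_le]; constructor <;> linarith))
    have h2 := hb _ (hrange c (by rw [abs_le]; constructor <;> linarith))
    rw [hsum] at h1 h2
    have e : avA f i G p - b i = ((2 : ℝ) ^ G)⁻¹ • ((f (Function.update p i (c + 2 ^ G)) - f p - ((c + 2 ^ G - p i : ℤ) : ℝ) • b i)
       - (f (Function.update p i c) - f p - ((c - p i : ℤ) : ℝ) • b i)) := by
      have : f (Function.update p i (c + 2 ^ G)) - f p - ((c + 2 ^ G - p i : ℤ) : ℝ) • b i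
       - (f (Function.update p i c) - f p - ((c - p i : ℤ) : ℝ) • b i) =
        (f (Function.update p i (c + 2 ^ G)) - f (Function.update p i c)) - ((2 : ℝ) ^ G) • b i := by
        push_cast
        module
      rw [this, smul_sub, smul_smul, inv_mul_cancel₀ hpr.ne', one_smul]
      rfl
    rw [e, norm_smul, norm_inv, Real.norm_of_nonneg hpr.le, inv_mul_le_iff₀ hpr]
    refine (norm_sub_le _ _).trans (by linarith)
  intro q hq
  have h1 := hb q hq
  have h2 : ‖∑ i, ((q i - p i : ℤ) : ℝ) • (avA f i G p - b i)‖ ≤ n * (L * 2 ^ G * (2 * ε)) := by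
    refine (norm_sum_le _ _).trans ?_
    calc _ ≤ ∑ i : Fin n, (L * 2 ^ G * (2 * ε)) := by
          refine Finset.sum_le_sum fun i _ => ?_
          rw [norm_smul, Real.norm_eq_abs]
          gcongr
          · exact_mod_cast hq i
          · exact hA i
      _ = _ := by simp
  have e : f q - f p - ∑ i, ((q i - p i : ℤ) : ℝ) • avA f i G p =
      (f q - f p - ∑ i, ((q i - p i : ℤ) : ℝ) • b i) - ∑ i, ((q i - p i : ℤ) : ℝ) • (avA f i G p - b i) := by
    simp only [smul_sub, Finset.sum_sub_distrib]
    abel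
  rw [e]
  refine (norm_sub_le _ _).trans ?_
  nlinarith

lemma avA_norm_le {f : (Fin n → ℤ) → H} {M : ℝ} (hf : LipZ f M) (i : Fin n) (G : ℕ)
    (p : Fin n → ℤ) : ‖avA f i G p‖ ≤ M := by
  have hpr : (0 : ℝ) < 2 ^ G := by positivity
  unfold avA
  rw [norm_smul, norm_inv, Real.norm_of_nonneg hpr.le, inv_mul_le_iff₀ hpr, mul_comm _ M]
  refine hf _ _ _ hpr.le fun j => ?_
  by_cases hj : j = i
  · subst hj; simp
  · simp [hj]

open Classical in
lemma agood_pack (n : ℕ) {M ε : ℝ} (hM : 0 ≤ M) (hε : 0 < ε) {L : ℕ} (hL : 1 ≤ L) : ∃ C : ℝ, 0 ≤ C ∧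
    ∀ f : (Fin n → ℤ) → H, LipZ f M → ∀ J : ℕ,
    ∑ G ∈ Finset.range (J + 2), (((zbox n (2 ^ J)).filter (fun p => ¬ agood f L ε G p)).card : ℝ)
      ≤ C * (2 ^ J) ^ n := by
  set ε1 := ε / (1 + 2 * n * L) with hε1
  have hden : (0 : ℝ) < 1 + 2 * n * L := by positivity
  have hεpos_one : 0 < ε1 := by positivity
  obtain ⟨m, hm⟩ := pow_unbounded_of_one_lt (4 * (n + 1) * M / ε1) (one_lt_two (α := ℝ))
  set δ := ε1 / (4 * n * L + 1) with hδ
  have hδp : 0 < δ := by positivity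
  obtain ⟨C, hC, hcount⟩ := abad_count (H := H) n hM hδp (2 * (L * 2 ^ m)) 1
  refine ⟨m * 3 ^ n + C * 4 ^ n, by positivity, fun f hf J => ?_⟩
  set c : ℕ → ℝ := fun G => (((zbox n (2 ^ J)).filter (fun p => ¬ agood f L ε G p)).card : ℝ) with hc
  have h1 : ∑ G ∈ Finset.range (J + 2), c G ≤ ∑ G ∈ Finset.range (m + (J + 2)), c G :=
    Finset.sum_le_sum_of_subset_of_nonneg (Finset.range_mono (by omega)) fun _ _ _ => by positivity
  rw [Finset.sum_range_add c m (J + 2)] at h1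
  have h2 : ∑ G ∈ Finset.range m, c G ≤ m * 3 ^ n * (2 ^ J) ^ n := by
    have : ∀ G ∈ Finset.range m, c G ≤ 3 ^ n * (2 ^ J) ^ n := by
      intro G _
      have h3 : c G ≤ (zbox n (2 ^ J)).card := by
        simp only [hc]; exact_mod_cast Finset.card_filter_le _ _
      refine h3.trans ?_
      rw [card_zbox, ← mul_pow]
      push_cast
      gcongr
      have : (1 : ℝ) ≤ 2 ^ J := one_le_pow₀ (by norm_num)
      linarith
    refine (Finset.sum_le_sum this).trans ?_
    simp [mul_assoc]
  have h3 : ∑ g ∈ Finset.range (J + 2), c (m + g) ≤ C * 4 ^ n * (2 ^ J) ^ n := by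
    have h4 := hcount f hf (J + 2)
    refine le_trans (Finset.sum_le_sum fun g _ => ?_) (h4.trans (le_of_eq ?_))
    · simp only [hc]
      have hsub : (zbox n (2 ^ J)).filter (fun p => ¬ agood f L ε (m + g) p) ⊆
          (zbox n (1 * 2 ^ (J + 2))).filter (abad f (2 * (L * 2 ^ m)) δ g) := by
        intro p hp
        rw [Finset.mem_filter] at *
        refine ⟨zbox_mono (by rw [one_mul]; exact Nat.pow_le_pow_right (by norm_num) (by omega)) hp.1, ?_⟩
        by_contra hna
        apply hp.2
        obtain ⟨b, hb⟩ := affine_raw hM hf (Nat.one_le_iff_ne_zero.2 (by positivity)) hδp.le hna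
        have hg := agood_of (f := f) (ε := ε1) (G := m + g) hL b (p := p) fun q hq => by
          refine (hb q fun i => (hq i).trans ?_).trans ?_
          · push_cast
            rw [mul_assoc, ← pow_add]
            gcongr
            · norm_num
            · omega
          · have e1 : (n + 1) * M * 2 ^ (g + 1) ≤ ε1 / 2 * 2 ^ (m + g) := by
              rw [div_lt_iff₀ hεpos_one] at hm
              have : (0 : ℝ) < 2 ^ g := by positivity
              rw [pow_add, pow_add]
              nlinarith
            have e2 : n * ((L * 2 ^ m : ℕ) : ℝ) * δ * 2 ^ (g + 1) ≤ ε1 / 2 * 2 ^ (m + g) := by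
              have : n * L * δ * 4 ≤ ε1 := by
                rw [hδ, mul_div_assoc', div_mul_eq_mul_div, div_le_iff₀ (by positivity)]
                nlinarith
              push_cast
              have h0 : (0 : ℝ) < 2 ^ (m + g) := by positivity
              have e : (n : ℝ) * (L * 2 ^ m) * δ * 2 ^ (g + 1) = n * L * δ * 2 * 2 ^ (m + g) := by
                rw [pow_add, pow_add]; ring
              rw [e]
              nlinarith
            linarith
        have : (1 + 2 * n * L) * ε1 = ε := by rw [hε1]; field_simp
        rwa [this] at hg
      exact_mod_cast Finset.card_le_card hsub
    · rw [pow_add, mul_pow]; norm_num; ring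
  have : ∑ G ∈ Finset.range (J + 2), c G ≤ m * 3 ^ n * (2 ^ J) ^ n + C * 4 ^ n * (2 ^ J) ^ n := by linarith
  linarith
end affine2

section jump
variable {H : Type*} [NormedAddCommGroup H] [InnerProductSpace ℝ H]

open Classical in
def refs (α : ℝ) (b : ℕ → H) : ℕ → H
  | 0 => b 0
  | t + 1 => if α < ‖b (t + 1) - refs α b t‖ then b (t + 1) else refs α b t

open Classical in
def jumps (α : ℝ) (b : ℕ → H) (J : ℕ) : Finset ℕ :=
  (Finset.range J).filter fun t => α < ‖b (t + 1) - refs α b t‖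

lemma refs_congr {α : ℝ} {b b' : ℕ → H} (t : ℕ) (h : ∀ s ≤ t, b s = b' s) : refs α b t = refs α b' t := by
  induction t with
  | zero => simp [refs, h 0 le_rfl]
  | succ t ih =>
    have := ih fun s hs => h s (by omega)
    simp only [refs, this, h (t + 1) le_rfl]

lemma refs_close {α : ℝ} (hα : 0 ≤ α) (b : ℕ → H) (t : ℕ) : ‖b t - refs α b t‖ ≤ α := by
  cases t with
  | zero => simp [refs, hα]
  | succ t =>
    simp only [refs]
    split_ifs with h
    · simpa using hα
    · exact not_lt.1 h

lemma refs_const {α : ℝ} {b : ℕ → H} {J i : ℕ} {j : ℕ} (hij : i ≤ j) (hj : j ≤ J)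
    (h : ∀ t ∈ jumps α b J, t + 1 ≤ i ∨ j < t + 1) : refs α b j = refs α b i := by
  induction j with
  | zero => rw [show i = 0 by omega]
  | succ j ih =>
    rcases Nat.eq_or_lt_of_le hij with rfl | hlt
    · rfl
    · have h1 := ih (by omega) (by omega) fun t ht => by
        rcases h t ht with h | h <;> omega
      rw [← h1]
      simp only [refs]
      rw [if_neg]
      intro hc
      have : j ∈ jumps α b J := by
        unfold jumps
        exact Finset.mem_filter.2 ⟨Finset.mem_range.2 (by omega), hc⟩
      rcases h j this with h | h <;> omega

lemma sum_invol {X : Type*} {T : Finset X} {σ : X → X} (hσ : ∀ x, σ (σ x) = x) (hT : ∀ x ∈ T, σ x ∈ T)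
    (F : X → ℝ) : ∑ x ∈ T, F (σ x) = ∑ x ∈ T, F x :=
  Finset.sum_nbij' σ σ hT hT (fun x _ => hσ x) (fun x _ => hσ x) fun _ _ => rfl

lemma jump_bound {X : Type*} (T : Finset X) {α : ℝ} (hα : 0 ≤ α) (B : ℕ → X → H) (σ : ℕ → X → X) (J : ℕ)
    (hσ : ∀ t x, σ t (σ t x) = x) (hT : ∀ t < J, ∀ x ∈ T, σ t x ∈ T)
    (hB : ∀ t < J, ∀ x, B t x = (1 / 2 : ℝ) • (B (t + 1) x + B (t + 1) (σ t x)))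
    (hinv : ∀ t < J, ∀ s ≤ t, ∀ x, B s (σ t x) = B s x) :
    ∀ t ≤ J, ∑ x ∈ T, (α ^ 2 * (jumps α (fun s => B s x) t).card + ‖B t x - refs α (fun s => B s x) t‖ ^ 2)
      ≤ ∑ x ∈ T, ‖B t x‖ ^ 2 := by
  intro t
  induction t with
  | zero =>
    intro _
    refine Finset.sum_le_sum fun x _ => ?_
    simp [jumps, refs]
  | succ t ih =>
    intro ht
    have ih := ih (by omega)
    have htJ : t < J := by omega
    set D : X → ℝ := fun x => ‖(1 / 2 : ℝ) • (B (t + 1) x - B (t + 1) (σ t x))‖ ^ 2 with hD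
    have par : ∀ y : X → H, (∀ x, y (σ t x) = y x) → ∑ x ∈ T, ‖B (t + 1) x - y x‖ ^ 2 =
        ∑ x ∈ T, ‖B t x - y x‖ ^ 2 + ∑ x ∈ T, D x := by
      intro y hy
      have h1 := sum_invol (hσ t) (hT t htJ) fun x => ‖B (t + 1) x - y x‖ ^ 2
      have h2 : ∑ x ∈ T, ‖B (t + 1) x - y x‖ ^ 2 =
          ∑ x ∈ T, (‖B (t + 1) x - y x‖ ^ 2 + ‖B (t + 1) (σ t x) - y (σ t x)‖ ^ 2) / 2 := by
        rw [← Finset.sum_div, Finset.sum_add_distrib, h1]; ring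
      rw [h2, ← Finset.sum_add_distrib]
      refine Finset.sum_congr rfl fun x _ => ?_
      rw [hy, hD, hB t htJ x]
      have hp := parallelogram_law_with_norm ℝ ((1 / 2 : ℝ) • (B (t + 1) x - y x)) ((1 / 2 : ℝ) • (B (t + 1) (σ t x) - y x))
      have e1 : (1 / 2 : ℝ) • (B (t + 1) x - y x) + (1 / 2 : ℝ) • (B (t + 1) (σ t x) - y x) =
        (1 / 2 : ℝ) • (B (t + 1) x + B (t + 1) (σ t x)) - y x := by module
      have e2 : (1 / 2 : ℝ) • (B (t + 1) x - y x) - (1 / 2 : ℝ) • (B (t + 1) (σ t x) - y x) =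
        (1 / 2 : ℝ) • (B (t + 1) x - B (t + 1) (σ t x)) := by module
      rw [e1, e2, norm_smul (1 / 2 : ℝ) (B (t + 1) x - y x), norm_smul (1 / 2 : ℝ) (B (t + 1) (σ t x) - y x),
        mul_pow, mul_pow, show ‖(1 / 2 : ℝ)‖ ^ 2 = 1 / 4 by norm_num] at hp
      simp only
      linarith [hp]
    have h0 := par (fun _ => 0) (fun _ => rfl)
    simp only [sub_zero] at h0
    have h1 := par (fun x => refs α (fun s => B s x) t) (fun x => refs_congr t fun s hs => hinv t htJ s hs x)
    have h2 : ∀ x ∈ T, α ^ 2 * ((jumps α (fun s => B s x) (t + 1)).card : ℝ)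
        + ‖B (t + 1) x - refs α (fun s => B s x) (t + 1)‖ ^ 2 ≤
        α ^ 2 * (jumps α (fun s => B s x) t).card + ‖B (t + 1) x - refs α (fun s => B s x) t‖ ^ 2 := by
      intro x _
      have hj : jumps α (fun s => B s x) (t + 1) = if α < ‖B (t + 1) x - refs α (fun s => B s x) t‖ then
          insert t (jumps α (fun s => B s x) t) else jumps α (fun s => B s x) t := by
        unfold jumps
        rw [Finset.range_add_one, Finset.filter_insert]
      rw [hj]
      simp only [refs]
      split_ifs with hc
      · rw [Finset.card_insert_of_notMem (by simp [jumps])]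
        have : α ^ 2 ≤ ‖B (t + 1) x - refs α (fun s => B s x) t‖ ^ 2 := by gcongr
        simp
        linarith
      · exact le_rfl
    refine (Finset.sum_le_sum h2).trans ?_
    rw [Finset.sum_add_distrib] at ih ⊢
    linarith

/-- flip of the `k`-th bit -/
def bflip (k : ℕ) (a : ℤ) : ℤ := if (a / 2 ^ k) % 2 = 0 then a + 2 ^ k else a - 2 ^ k

lemma bflip_ediv (k : ℕ) (a : ℤ) : bflip k a / 2 ^ k = if (a / 2 ^ k) % 2 = 0 then a / 2 ^ k + 1 else a / 2 ^ k - 1 := by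
  have hp : (2 : ℤ) ^ k ≠ 0 := by positivity
  unfold bflip
  split_ifs with h
  · rw [Int.add_ediv_of_dvd_right dvd_rfl, Int.ediv_self hp]
  · rw [Int.sub_ediv_of_dvd _ dvd_rfl, Int.ediv_self hp]

lemma bflip_bflip (k : ℕ) (a : ℤ) : bflip k (bflip k a) = a := by
  have h := bflip_ediv k a
  by_cases hc : (a / 2 ^ k) % 2 = 0
  · rw [if_pos hc] at h
    have e : bflip k a = a + 2 ^ k := by unfold bflip; rw [if_pos hc]
    rw [bflip, h, if_neg (by omega), e]; ring
  · rw [if_neg hc] at h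
    have e : bflip k a = a - 2 ^ k := by unfold bflip; rw [if_neg hc]
    rw [bflip, h, if_pos (by omega), e]; ring

lemma bflip_ediv_succ (k : ℕ) (a : ℤ) : bflip k a / 2 ^ (k + 1) = a / 2 ^ (k + 1) := by
  have hp : (0 : ℤ) ≤ 2 ^ k := by positivity
  rw [pow_succ, ← Int.ediv_ediv_of_nonneg hp, ← Int.ediv_ediv_of_nonneg hp, bflip_ediv]
  split_ifs <;> omega

lemma bflip_ediv_lt {k k' : ℕ} (h : k < k') (a : ℤ) : bflip k a / 2 ^ k' = a / 2 ^ k' := by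
  obtain ⟨d, rfl⟩ := Nat.exists_eq_add_of_le (Nat.succ_le_of_lt h)
  have hp : (0 : ℤ) ≤ 2 ^ (k + 1) := by positivity
  rw [Nat.succ_eq_add_one, pow_add, ← Int.ediv_ediv_of_nonneg hp, ← Int.ediv_ediv_of_nonneg hp, bflip_ediv_succ]

variable {n : ℕ}

def zflip (i : Fin n) (k : ℕ) (p : Fin n → ℤ) : Fin n → ℤ := Function.update p i (bflip k (p i))

lemma zflip_zflip (i : Fin n) (k : ℕ) (p : Fin n → ℤ) : zflip i k (zflip i k p) = p := by
  simp [zflip, bflip_bflip]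

lemma avA_zflip_lt (f : (Fin n → ℤ) → H) (i : Fin n) {k k' : ℕ} (h : k < k') (p : Fin n → ℤ) :
    avA f i k' (zflip i k p) = avA f i k' p := by
  simp [avA, zflip, bflip_ediv_lt h]

lemma avA_avg (f : (Fin n → ℤ) → H) (i : Fin n) (k : ℕ) (p : Fin n → ℤ) :
    avA f i (k + 1) p = (1 / 2 : ℝ) • (avA f i k p + avA f i k (zflip i k p)) := by
  have hp : (0 : ℤ) ≤ 2 ^ k := by positivity
  have hu : p i / 2 ^ (k + 1) = p i / 2 ^ k / 2 := by
    rw [pow_succ, ← Int.ediv_ediv_of_nonneg hp]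
  have hv := bflip_ediv k (p i)
  unfold avA zflip
  simp only [Function.update_self, Function.update_idem]
  rw [hu, hv]
  set u := p i / 2 ^ k
  rw [pow_succ (2 : ℤ), pow_succ (2 : ℝ)]
  by_cases hc : u % 2 = 0
  · rw [if_pos hc]
    have e1 : u / 2 * (2 ^ k * 2) = u * 2 ^ k := by
      have : u = u / 2 * 2 := by omega
      conv_rhs => rw [this]
      ring
    have e2 : (u + 1) * 2 ^ k = u * 2 ^ k + 2 ^ k := by ring
    have e3 : u * (2 : ℤ) ^ k + 2 ^ k * 2 = u * 2 ^ k + 2 ^ k + 2 ^ k := by ring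
    rw [e1, e2, e3, mul_inv]
    module
  · rw [if_neg hc]
    have e1 : u / 2 * (2 ^ k * 2) = (u - 1) * 2 ^ k := by
      have : u = u / 2 * 2 + 1 := by omega
      conv_rhs => rw [this]
      ring
    have e2 : (u - 1) * 2 ^ k + 2 ^ k = u * 2 ^ k := by ring
    have e3 : (u - 1) * (2 : ℤ) ^ k + 2 ^ k * 2 = u * 2 ^ k + 2 ^ k := by ring
    rw [e1, e2, e3, mul_inv]
    module

def zT (n J : ℕ) : Finset (Fin n → ℤ) := Fintype.piFinset fun _ => Finset.Ico (-(2 : ℤ) ^ (J + 1)) (2 ^ (J + 1))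

lemma mem_Ico_iff_ediv (J : ℕ) (a : ℤ) : a ∈ Finset.Ico (-(2 : ℤ) ^ J) (2 ^ J) ↔ (-1 ≤ a / 2 ^ J ∧ a / 2 ^ J < 1) := by
  have hp : (0 : ℤ) < 2 ^ J := by positivity
  rw [Finset.mem_Ico, Int.le_ediv_iff_mul_le hp, Int.ediv_lt_iff_lt_mul hp]
  simp

lemma zflip_mem {i : Fin n} {k J : ℕ} (hk : k < J + 1) {p : Fin n → ℤ} (hp : p ∈ zT n J) : zflip i k p ∈ zT n J := by
  unfold zT at *
  rw [Fintype.mem_piFinset] at *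
  intro j
  by_cases hj : j = i
  · subst hj
    have := hp j
    rw [mem_Ico_iff_ediv] at *
    simpa [zflip, bflip_ediv_lt hk] using this
  · simpa [zflip, hj] using hp j

lemma zbox_sub_zT (n J : ℕ) : zbox n (2 ^ J) ⊆ zT n J := by
  intro p hp
  rw [mem_zbox] at hp
  unfold zT
  rw [Fintype.mem_piFinset]
  intro i
  have := abs_le.1 (hp i)
  push_cast at this
  have h2 : (0 : ℤ) < 2 ^ J := by positivity
  rw [Finset.mem_Ico, pow_succ]
  constructor <;> linarith [this.1, this.2]

lemma card_zT (n J : ℕ) : ((zT n J).card : ℝ) = 4 ^ n * (2 ^ J) ^ n := by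
  unfold zT
  rw [Fintype.card_piFinset]
  simp only [Int.card_Ico, Finset.prod_const, Finset.card_univ, Fintype.card_fin]
  rw [← mul_pow]
  push_cast
  congr 1
  have : ((2 : ℤ) ^ (J + 1) - -2 ^ (J + 1)).toNat = 4 * 2 ^ J := by
    rw [show ((2 : ℤ) ^ (J + 1) - -2 ^ (J + 1)) = ((4 * 2 ^ J : ℕ) : ℤ) by push_cast; ring]
    exact Int.toNat_natCast _
  rw [this]; push_cast; rfl

lemma jump_count {f : (Fin n → ℤ) → H} {M α : ℝ} (hf : LipZ f M) (hα : 0 < α) (i : Fin n) (J : ℕ) :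
    ∑ p ∈ zbox n (2 ^ J), ((jumps α (fun t => avA f i (J - t) p) J).card : ℝ) ≤
      M ^ 2 / α ^ 2 * 4 ^ n * (2 ^ J) ^ n := by
  have h := jump_bound (zT n J) hα.le (fun t p => avA f i (J - t) p) (fun t => zflip i (J - t - 1)) J
    (fun t x => zflip_zflip _ _ _) (fun t ht x hx => zflip_mem (by omega) hx)
    (fun t ht x => by
      have := avA_avg f i (J - t - 1) x
      rw [show J - t - 1 + 1 = J - t by omega] at this
      rw [this, show J - (t + 1) = J - t - 1 by omega])
    (fun t ht s hs x => avA_zflip_lt f i (by omega) x) J le_rfl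
  have h2 : ∑ p ∈ zT n J, ‖avA f i (J - J) p‖ ^ 2 ≤ M ^ 2 * (4 ^ n * (2 ^ J) ^ n) := by
    rw [← card_zT, mul_comm, ← nsmul_eq_mul, ← Finset.sum_const]
    exact Finset.sum_le_sum fun p _ => by gcongr; exact avA_norm_le hf i _ p
  have h3 : α ^ 2 * ∑ p ∈ zbox n (2 ^ J), ((jumps α (fun t => avA f i (J - t) p) J).card : ℝ) ≤
      M ^ 2 * (4 ^ n * (2 ^ J) ^ n) := by
    refine le_trans ?_ (h.trans h2)
    rw [Finset.mul_sum]
    refine le_trans (Finset.sum_le_sum_of_subset_of_nonneg (zbox_sub_zT n J) fun _ _ _ => by positivity) ?_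
    exact Finset.sum_le_sum fun p _ => by
      have : 0 ≤ ‖avA f i (J - J) p - refs α (fun s => avA f i (J - s) p) J‖ ^ 2 := by positivity
      linarith
  rw [div_mul_eq_mul_div, div_mul_eq_mul_div, le_div_iff₀ (by positivity)]
  linarith
end jump

/-- some unit direction is strongly contracted by the approximate differential -/
def Deg {m : ℕ} (f : (Fin (m + 1) → ℤ) → Euc (m + 1)) (s : ℝ) (G : ℕ) (p : Fin (m + 1) → ℤ) : Prop :=
  ∃ w : Euc m, ‖w‖ = 1 ∧ ‖∑ i, w i • avA f i G p‖ < s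

lemma euc_norm_le {m : ℕ} (z : Euc m) {b : ℝ} (hb : 0 ≤ b) (h : ∀ i, |z i| ≤ b) : ‖z‖ ≤ (m + 1) * b := by
  rw [EuclideanSpace.norm_eq, Real.sqrt_le_iff]
  refine ⟨by positivity, ?_⟩
  calc ∑ i, ‖z i‖ ^ 2 ≤ ∑ i : Fin (m + 1), b ^ 2 := Finset.sum_le_sum fun i _ => by
        have := h i
        rw [Real.norm_eq_abs]
        gcongr
    _ = (m + 1) * b ^ 2 := by simp
    _ ≤ _ := by
        rw [mul_pow]
        gcongr
        nlinarith [(Nat.cast_nonneg m : (0 : ℝ) ≤ m)]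

lemma lin_norm_le {m : ℕ} {H : Type*} [NormedAddCommGroup H] [InnerProductSpace ℝ H] (z : Euc m)
    (a : Fin (m + 1) → H) {M : ℝ} (ha : ∀ i, ‖a i‖ ≤ M) : ‖∑ i, z i • a i‖ ≤ (m + 1) * M * ‖z‖ := by
  refine (norm_sum_le _ _).trans ?_
  calc _ ≤ ∑ i : Fin (m + 1), ‖z‖ * M := by
        refine Finset.sum_le_sum fun i _ => ?_
        rw [norm_smul]
        gcongr
        · exact PiLp.norm_apply_le z i
        · exact ha i
    _ = _ := by simp; ring

lemma deg_cover (m : ℕ) {M CU : ℝ} (hM : 1 ≤ M) (hCU : 1 ≤ CU) : ∃ C : ℝ, 0 < C ∧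
    ∀ (E : Set (Euc (m + 1))), (∀ (z : Euc (m + 1)) (R : ℝ), 0 < R →
      μH[((m + 1 : ℕ) : ℝ)] (E ∩ ball z R) ≤ ENNReal.ofReal (CU * R ^ (m + 1))) →
    ∀ (f : (Fin (m + 1) → ℤ) → Euc (m + 1)), LipZ f M → ∀ (s ε c h : ℝ) (L G : ℕ) (p : Fin (m + 1) → ℤ),
    0 < s → s ≤ 1 / 2 → ε ≤ s / 2 → 0 < h → 0 ≤ c → 2 * c ≤ s * 2 ^ G → 1 ≤ L → agood f L ε G p → Deg f s G p →
    ∀ Y : Set (Euc (m + 1)), Y ⊆ E → (∀ y ∈ Y, ∃ q : Fin (m + 1) → ℤ, (∀ i, |q i - p i| ≤ 2 ^ G) ∧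
      dist y (h • f q) ≤ c * h) →
    μH[((m + 1 : ℕ) : ℝ)] Y ≤ ENNReal.ofReal (C * s * (2 ^ G * h) ^ (m + 1)) := by
  refine ⟨2 * ((2 * m + 7) * 6 * ((m + 1) * M)) ^ (m + 1) * CU, by positivity, ?_⟩
  intro E hE f hf s ε c h L G p hs hs1 hε hh hc hcs hL hg hdeg Y hYE hY
  classical
  obtain ⟨w, hw, hws⟩ := hdeg
  have hG : (0 : ℝ) < 2 ^ G := by positivity
  have hL' : (1 : ℤ) ≤ L := by exact_mod_cast hL
  set a : Fin (m + 1) → Euc (m + 1) := fun i => avA f i G p with ha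
  have haM : ∀ i, ‖a i‖ ≤ M := fun i => avA_norm_le hf i G p
  set S := 6 * s * 2 ^ G * h with hS
  have hSp : 0 < S := by positivity
  set σ := s / ((m + 1) * M) with hσ
  have hmM : (1 : ℝ) ≤ (m + 1) * M := by nlinarith [(Nat.cast_nonneg m : (0 : ℝ) ≤ m)]
  have hσp : 0 < σ := by positivity
  have hσs : σ ≤ s := div_le_self hs.le hmM
  have hsσ : s = σ * ((m + 1) * M) := by rw [hσ]; field_simp
  clear_value σ S
  have hbd : ∃ R : ℝ, 0 < R ∧ Y ⊆ ball (h • f p) R := by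
    refine ⟨c * h + h * (M * 2 ^ G) + 1, by positivity, fun y hy => ?_⟩
    obtain ⟨q, hq, hyq⟩ := hY y hy
    have : dist (h • f q) (h • f p) ≤ h * (M * 2 ^ G) := by
      rw [dist_eq_norm, ← smul_sub, norm_smul, Real.norm_of_nonneg hh.le]
      gcongr
      exact hf _ _ _ hG.le fun i => by exact_mod_cast hq i
    have := dist_triangle y (h • f q) (h • f p)
    rw [mem_ball]; linarith
  obtain ⟨R, hR, hYR⟩ := hbd
  obtain ⟨T, hTY, hTsep, hTcov, -⟩ := exists_net Y hSp hR hYR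
  choose! q hq hyq using hY
  set Q : Euc (m + 1) → Euc m := fun y => WithLp.toLp 2 fun i => ((q y i - p i : ℤ) : ℝ) with hQ
  have hQn : ∀ y ∈ Y, ‖Q y‖ ≤ (m + 1) * 2 ^ G := fun y hy => euc_norm_le _ hG.le fun i => by
    simp only [hQ]; exact_mod_cast hq y hy i
  have hA : ∀ y ∈ Y, ‖f (q y) - f p - ∑ i, Q y i • a i‖ ≤ ε * 2 ^ G := by
    intro y hy
    exact hg (q y) fun i => (hq y hy i).trans (le_mul_of_one_le_left (by positivity) hL')
  have hAsep : ∀ y ∈ T, ∀ y' ∈ T, y ≠ y' → 4 * s * 2 ^ G ≤ ‖∑ i, (Q y - Q y') i • a i‖ := by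
    intro y hy y' hy' hne
    have h1 := hTsep y hy y' hy' hne
    have h2 := hyq y (hTY hy)
    have h3 := hyq y' (hTY hy')
    have h4 := dist_triangle4 y (h • f (q y)) (h • f (q y')) y'
    rw [dist_comm (h • f (q y')) y'] at h4
    have h5 : dist (h • f (q y)) (h • f (q y')) = h * ‖f (q y) - f (q y')‖ := by
      rw [dist_eq_norm, ← smul_sub, norm_smul, Real.norm_of_nonneg hh.le]
    have h6 : 5 * s * 2 ^ G ≤ ‖f (q y) - f (q y')‖ := by
      have : h * (5 * s * 2 ^ G) ≤ h * ‖f (q y) - f (q y')‖ := by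
        rw [hS] at h1
        rw [h5] at h4
        have h10 := mul_le_mul_of_nonneg_right hcs hh.le
        have e1 : h * (5 * s * 2 ^ G) = 6 * s * 2 ^ G * h - s * 2 ^ G * h := by ring
        rw [e1]
        linarith
      exact le_of_mul_le_mul_left this hh
    have h7 := hA y (hTY hy)
    have h8 := hA y' (hTY hy')
    have e : f (q y) - f (q y') = (f (q y) - f p - ∑ i, Q y i • a i) - (f (q y') - f p - ∑ i, Q y' i • a i)
        + ∑ i, (Q y - Q y') i • a i := by
      simp only [PiLp.sub_apply, sub_smul, Finset.sum_sub_distrib]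
      abel
    have h9 : ‖f (q y) - f (q y')‖ ≤ ‖f (q y) - f p - ∑ i, Q y i • a i‖ + ‖f (q y') - f p - ∑ i, Q y' i • a i‖
        + ‖∑ i, (Q y - Q y') i • a i‖ := by
      rw [e]
      exact (norm_add_le _ _).trans (add_le_add_left (norm_sub_le _ _) _)
    have : ε * 2 ^ G ≤ s / 2 * 2 ^ G := by gcongr
    linarith
  set I : ℕ := ⌊1 / σ⌋₊ with hI
  have hI1 : (I : ℝ) * σ ≤ 1 := by
    have := Nat.floor_le (a := 1 / σ) (by positivity)
    rwa [le_div_iff₀ hσp] at this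
  have hI2 : 1 ≤ 2 * σ * I := by
    have h1 := Nat.lt_floor_add_one (1 / σ)
    rw [← hI, div_lt_iff₀ hσp] at h1
    nlinarith
  set Φ : Euc (m + 1) × ℕ → Euc m := fun x => Q x.1 + ((x.2 : ℝ) * (σ * 2 ^ G)) • w with hΦ
  have hsep : ∀ x ∈ T ×ˢ Finset.range I, ∀ x' ∈ T ×ˢ Finset.range I, x ≠ x' → σ * 2 ^ G ≤ dist (Φ x) (Φ x') := by
    rintro ⟨y, i⟩ hx ⟨y', i'⟩ hx' hne
    rw [Finset.mem_product, Finset.mem_range] at hx hx'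
    simp only at hx hx'
    have hii : |(i : ℝ) - i'| ≤ I := by
      have h1 : (i : ℝ) ≤ I := by exact_mod_cast hx.2.le
      have h2 : (i' : ℝ) ≤ I := by exact_mod_cast hx'.2.le
      have h3 : (0 : ℝ) ≤ i := by positivity
      have h4 : (0 : ℝ) ≤ i' := by positivity
      rw [abs_le]; constructor <;> linarith
    have e0 : Φ (y, i) - Φ (y', i') = (Q y - Q y') + (((i : ℝ) - i') * (σ * 2 ^ G)) • w := by
      simp only [hΦ]; module
    rw [dist_eq_norm, e0]
    by_cases hyy : y = y'
    · subst hyy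
      have hi : i ≠ i' := fun h => hne (by rw [h])
      rw [sub_self, zero_add, norm_smul, hw, mul_one, Real.norm_eq_abs, abs_mul, abs_of_pos (by positivity : 0 < σ * 2 ^ G)]
      have : (1 : ℝ) ≤ |(i : ℝ) - i'| := by
        have : (1 : ℤ) ≤ |(i : ℤ) - i'| := Int.one_le_abs (by omega)
        exact_mod_cast this
      exact le_mul_of_one_le_left (by positivity) this
    · have h1 := hAsep y hx.1 y' hx'.1 hyy
      set z : Euc m := (Q y - Q y') + (((i : ℝ) - i') * (σ * 2 ^ G)) • w with hz
      have h2 := lin_norm_le z a haM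
      have e1 : ∑ j, z j • a j = ∑ j, (Q y - Q y') j • a j + (((i : ℝ) - i') * (σ * 2 ^ G)) • ∑ j, w j • a j := by
        rw [Finset.smul_sum, ← Finset.sum_add_distrib]
        refine Finset.sum_congr rfl fun j _ => ?_
        rw [hz, PiLp.add_apply, PiLp.smul_apply, add_smul, smul_eq_mul, smul_smul]
      have h3 : ‖(((i : ℝ) - i') * (σ * 2 ^ G)) • ∑ j, w j • a j‖ ≤ s * 2 ^ G := by
        rw [norm_smul, Real.norm_eq_abs, abs_mul, abs_of_pos (by positivity : 0 < σ * 2 ^ G)]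
        calc _ ≤ I * (σ * 2 ^ G) * s := by gcongr
          _ = I * σ * (2 ^ G * s) := by ring
          _ ≤ 1 * (2 ^ G * s) := by gcongr
          _ = _ := by ring
      have h4 : ‖∑ j, (Q y - Q y') j • a j‖ ≤ ‖∑ j, z j • a j‖ + ‖(((i : ℝ) - i') * (σ * 2 ^ G)) • ∑ j, w j • a j‖ := by
        have : ∑ j, (Q y - Q y') j • a j = ∑ j, z j • a j - (((i : ℝ) - i') * (σ * 2 ^ G)) • ∑ j, w j • a j := by
          rw [e1]; abel
        rw [this]
        exact norm_sub_le _ _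
      have h5 : s * 2 ^ G ≤ (m + 1) * M * ‖z‖ := by nlinarith [mul_pos hs hG]
      rw [hσ, div_mul_eq_mul_div, div_le_iff₀ (by positivity)]
      linarith
  have hinj : Set.InjOn Φ (T ×ˢ Finset.range I : Finset _) := by
    intro x hx x' hx' he
    by_contra hne
    have := hsep x hx x' hx' hne
    rw [he, dist_self] at this
    have : 0 < σ * 2 ^ G := by positivity
    linarith
  have hcard := card_separated ((T ×ˢ Finset.range I).image Φ) (s := σ * 2 ^ G) (R := (m + 3) * 2 ^ G) (z := 0)
    (by positivity) (by positivity) (by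
      intro x hx x' hx' hne
      obtain ⟨y, hy, rfl⟩ := Finset.mem_image.1 hx
      obtain ⟨y', hy', rfl⟩ := Finset.mem_image.1 hx'
      exact hsep y hy y' hy' fun h => hne (by rw [h])) (by
      intro x hx
      obtain ⟨⟨y, i⟩, hy, rfl⟩ := Finset.mem_image.1 hx
      rw [Finset.mem_product, Finset.mem_range] at hy
      simp only at hy
      rw [mem_ball_zero_iff]
      refine lt_of_le_of_lt (norm_add_le _ _) ?_
      rw [norm_smul, hw, mul_one, Real.norm_of_nonneg (by positivity)]
      have h1 := hQn y (hTY hy.1)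
      have h2 : (i : ℝ) * (σ * 2 ^ G) ≤ 2 ^ G := by
        have : (i : ℝ) ≤ I := by exact_mod_cast hy.2.le
        calc _ ≤ I * (σ * 2 ^ G) := by gcongr
          _ = I * σ * 2 ^ G := by ring
          _ ≤ 1 * 2 ^ G := by gcongr
          _ = _ := one_mul _
      simp only
      nlinarith)
  rw [Finset.card_image_of_injOn hinj, Finset.card_product, Finset.card_range] at hcard
  have hT : (T.card : ℝ) ≤ 2 * σ * ((2 * m + 7) / σ) ^ (m + 1) := by
    have h1 : 1 + 2 * ((m + 3) * 2 ^ G) / (σ * 2 ^ G) ≤ (2 * m + 7) / σ := by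
      rw [← mul_assoc, mul_div_mul_right _ _ hG.ne', ← sub_nonneg]
      have gen : ∀ x : ℝ, 0 < x → (2 * (m : ℝ) + 7) / x - (1 + 2 * (m + 3) / x) = (1 - x) / x := by
        intro x hx
        field_simp
        ring
      have := gen σ hσp
      rw [this]
      exact div_nonneg (by linarith) hσp.le
    have h2 : (T.card : ℝ) * I ≤ ((2 * m + 7) / σ) ^ (m + 1) := by
      push_cast at hcard
      exact hcard.trans (by gcongr)
    calc (T.card : ℝ) ≤ T.card * (2 * σ * I) := le_mul_of_one_le_right (Nat.cast_nonneg _) hI2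
      _ = 2 * σ * (T.card * I) := by ring
      _ ≤ _ := by gcongr
  calc μH[((m + 1 : ℕ) : ℝ)] Y ≤ μH[((m + 1 : ℕ) : ℝ)] (⋃ t ∈ T, E ∩ ball t S) := by
        refine measure_mono fun y hy => ?_
        obtain ⟨t, ht, hd⟩ := hTcov y hy
        exact mem_iUnion₂.2 ⟨t, ht, hYE hy, hd⟩
    _ ≤ ∑ t ∈ T, μH[((m + 1 : ℕ) : ℝ)] (E ∩ ball t S) := measure_biUnion_finset_le _ _
    _ ≤ ∑ t ∈ T, ENNReal.ofReal (CU * S ^ (m + 1)) := Finset.sum_le_sum fun t _ => hE t S hSp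
    _ = ENNReal.ofReal (T.card * (CU * S ^ (m + 1))) := by
        rw [Finset.sum_const, nsmul_eq_mul, ENNReal.ofReal_mul (p := (T.card : ℝ)) (Nat.cast_nonneg _), ENNReal.ofReal_natCast]
    _ ≤ _ := by
        apply ENNReal.ofReal_le_ofReal
        calc (T.card : ℝ) * (CU * S ^ (m + 1)) ≤ 2 * σ * ((2 * m + 7) / σ) ^ (m + 1) * (CU * S ^ (m + 1)) := by gcongr
          _ = 2 * CU * σ * ((2 * m + 7) / σ * S) ^ (m + 1) := by rw [mul_pow]; ring
          _ = 2 * CU * σ * ((2 * m + 7) * 6 * ((m + 1) * M) * (2 ^ G * h)) ^ (m + 1) := by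
              congr 2
              rw [div_mul_eq_mul_div, div_eq_iff hσp.ne', hS]
              linear_combination (2 * (m : ℝ) + 7) * 6 * 2 ^ G * h * hsσ
          _ = 2 * ((2 * m + 7) * 6 * ((m + 1) * M)) ^ (m + 1) * CU * σ * (2 ^ G * h) ^ (m + 1) := by
              rw [mul_pow _ (2 ^ G * h)]; ring
          _ ≤ _ := by gcongr

lemma cube_finset {n : ℕ} (G : ℕ) (p : Fin n → ℤ) : ∃ C : Finset (Fin n → ℤ), C.card = (2 ^ G) ^ n ∧
    ∀ q, q ∈ C ↔ ∀ i, q i / 2 ^ G = p i / 2 ^ G := by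
  have hp : (0 : ℤ) < 2 ^ G := by positivity
  refine ⟨Fintype.piFinset fun i => Finset.Ico (p i / 2 ^ G * 2 ^ G) (p i / 2 ^ G * 2 ^ G + 2 ^ G), ?_, ?_⟩
  · rw [Fintype.card_piFinset]
    simp only [Int.card_Ico, add_sub_cancel_left, Finset.prod_const, Finset.card_univ, Fintype.card_fin]
    congr 1
  · intro q
    rw [Fintype.mem_piFinset]
    refine forall_congr' fun i => ?_
    rw [Finset.mem_Ico, ← Int.le_ediv_iff_mul_le hp,
      show p i / 2 ^ G * 2 ^ G + 2 ^ G = (p i / 2 ^ G + 1) * 2 ^ G by ring, ← Int.ediv_lt_iff_lt_mul hp]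
    omega

lemma ediv_pow_mono {a b : ℤ} {G G' : ℕ} (h : G ≤ G') (hab : a / 2 ^ G = b / 2 ^ G) :
    a / 2 ^ G' = b / 2 ^ G' := by
  obtain ⟨d, rfl⟩ := Nat.exists_eq_add_of_le h
  have hp : (0 : ℤ) ≤ 2 ^ G := by positivity
  rw [pow_add, ← Int.ediv_ediv_of_nonneg hp, ← Int.ediv_ediv_of_nonneg hp, hab]

lemma mem_zT_of_ediv {n J G : ℕ} (hG : G ≤ J + 1) {p q : Fin n → ℤ} (hp : p ∈ zT n J)
    (h : ∀ i, q i / 2 ^ G = p i / 2 ^ G) : q ∈ zT n J := by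
  unfold zT at *
  rw [Fintype.mem_piFinset] at *
  intro i
  have := hp i
  rw [mem_Ico_iff_ediv] at *
  rw [ediv_pow_mono hG (h i)]
  exact this

lemma dyadic_cover {n : ℕ} {X : Type*} [MeasurableSpace X] (μ : Measure X) (Y : (Fin n → ℤ) → Set X)
    (mk : ℕ → (Fin n → ℤ) → Prop) (J : ℕ) (c : ℝ≥0∞)
    (hinv : ∀ G p q, (∀ i, q i / 2 ^ G = p i / 2 ^ G) → mk G p → mk G q)
    (h : ∀ G p, mk G p → μ (⋃ q ∈ {q : Fin n → ℤ | ∀ i, q i / 2 ^ G = p i / 2 ^ G}, Y q) ≤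
      c * (((2 ^ G) ^ n : ℕ) : ℝ≥0∞)) :
    μ (⋃ p ∈ {p : Fin n → ℤ | p ∈ zT n J ∧ ∃ G ≤ J + 1, mk G p}, Y p) ≤ c * ((zT n J).card : ℝ≥0∞) := by
  classical
  set A := (zT n J).filter fun p => ∃ G ≤ J + 1, mk G p with hA
  set g : (Fin n → ℤ) → ℕ := fun p => Nat.findGreatest (fun G => mk G p) (J + 1) with hg
  set key : (Fin n → ℤ) → ℕ × (Fin n → ℤ) := fun p => (g p, fun i => p i / 2 ^ (g p)) with hkey
  have hmk : ∀ p ∈ A, mk (g p) p := by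
    intro p hp
    obtain ⟨-, G, hG, h1⟩ := Finset.mem_filter.1 hp
    exact Nat.findGreatest_spec (P := fun G => mk G p) hG h1
  have hgle : ∀ p, g p ≤ J + 1 := fun p => Nat.findGreatest_le _
  have hsame : ∀ p ∈ A, ∀ q, (∀ i, q i / 2 ^ (g p) = p i / 2 ^ (g p)) → q ∈ A ∧ key q = key p := by
    intro p hp q hq
    have h1 : mk (g p) q := hinv _ _ _ hq (hmk p hp)
    have hqA : q ∈ A := by
      rw [hA, Finset.mem_filter]
      exact ⟨mem_zT_of_ediv (hgle p) (Finset.mem_filter.1 hp).1 hq, g p, hgle p, h1⟩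
    have h2 : g p ≤ g q := Nat.le_findGreatest (P := fun G => mk G q) (hgle p) h1
    have h3 : g q ≤ g p := by
      refine Nat.le_findGreatest (P := fun G => mk G p) (hgle q) ?_
      exact hinv _ _ _ (fun i => (ediv_pow_mono h2 (hq i)).symm) (hmk q hqA)
    have h4 : g q = g p := le_antisymm h3 h2
    refine ⟨hqA, ?_⟩
    simp only [hkey, h4]
    congr 1
    funext i
    exact hq i
  have hcard : ∑ a ∈ A.image key, (2 ^ a.1) ^ n ≤ (zT n J).card := by
    calc ∑ a ∈ A.image key, (2 ^ a.1) ^ n ≤ ∑ a ∈ A.image key, (A.filter fun q => key q = a).card := by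
          refine Finset.sum_le_sum fun a ha => ?_
          obtain ⟨p, hp, rfl⟩ := Finset.mem_image.1 ha
          obtain ⟨C, hC, hCm⟩ := cube_finset (g p) p
          change (2 ^ g p) ^ n ≤ _
          rw [← hC]
          refine Finset.card_le_card fun q hq => ?_
          exact Finset.mem_filter.2 (hsame p hp q ((hCm q).1 hq))
      _ = A.card := (Finset.card_eq_sum_card_image key A).symm
      _ ≤ _ := Finset.card_filter_le _ _
  calc μ (⋃ p ∈ {p : Fin n → ℤ | p ∈ zT n J ∧ ∃ G ≤ J + 1, mk G p}, Y p)
      ≤ μ (⋃ a ∈ A.image key, ⋃ q ∈ {q | q ∈ A ∧ key q = a}, Y q) := by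
        refine measure_mono fun x hx => ?_
        obtain ⟨p, hp, hxp⟩ := mem_iUnion₂.1 hx
        have hp' : p ∈ A := by rw [hA, Finset.mem_filter]; exact hp
        exact mem_iUnion₂.2 ⟨key p, Finset.mem_image_of_mem _ hp', mem_iUnion₂.2 ⟨p, ⟨hp', rfl⟩, hxp⟩⟩
    _ ≤ ∑ a ∈ A.image key, μ (⋃ q ∈ {q | q ∈ A ∧ key q = a}, Y q) := measure_biUnion_finset_le _ _
    _ ≤ ∑ a ∈ A.image key, c * (((2 ^ a.1) ^ n : ℕ) : ℝ≥0∞) := by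
        refine Finset.sum_le_sum fun a ha => ?_
        obtain ⟨p, hp, rfl⟩ := Finset.mem_image.1 ha
        refine le_trans (measure_mono ?_) (h (g p) p (hmk p hp))
        refine biUnion_subset_biUnion_left ?_
        rintro q ⟨-, hq⟩ i
        simp only [hkey, Prod.mk.injEq] at hq
        have := congrFun hq.2 i
        rw [hq.1] at this
        exact this
    _ = c * ((∑ a ∈ A.image key, (2 ^ a.1) ^ n : ℕ) : ℝ≥0∞) := by
        rw [← Finset.mul_sum, Nat.cast_sum]
    _ ≤ _ := by gcongr

lemma colour {X Γ : Type*} [Fintype Γ] [Nonempty Γ] (κ : ℕ → X → Γ) (R : ℕ) :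
    ∀ (T : Finset X) (w : X → ℝ≥0∞) (bad : X → Finset ℕ), (∀ p, bad p ⊆ Finset.range R) →
    ∃ T' ⊆ T, (∃ c : ℕ → Γ, ∀ p ∈ T', ∀ k ∈ bad p, κ k p = c k) ∧
      ∑ p ∈ T, w p ≤ ∑ p ∈ T', (Fintype.card Γ : ℝ≥0∞) ^ (bad p).card * w p := by
  classical
  induction R with
  | zero =>
    intro T w bad hb
    have hb' : ∀ p, bad p = ∅ := fun p => by simpa using hb p
    exact ⟨T, subset_rfl, ⟨fun _ => Classical.arbitrary Γ, fun p _ k hk => by simp [hb'] at hk⟩, by simp [hb']⟩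
  | succ R ih =>
    intro T w bad hb
    set N : ℝ≥0∞ := ((Fintype.card Γ : ℕ) : ℝ≥0∞) with hN
    have hγ : ∃ γ : Γ, ∑ p ∈ T.filter (fun p => R ∈ bad p), w p ≤
        N * ∑ p ∈ (T.filter (fun p => R ∈ bad p)).filter (fun p => κ R p = γ), w p := by
      obtain ⟨γ, -, hγ⟩ := Finset.exists_max_image (Finset.univ : Finset Γ)
        (fun γ => ∑ p ∈ (T.filter (fun p => R ∈ bad p)).filter (fun p => κ R p = γ), w p) Finset.univ_nonempty
      refine ⟨γ, ?_⟩
      rw [← Finset.sum_fiberwise (T.filter (fun p => R ∈ bad p)) (fun p => κ R p) w]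
      refine (Finset.sum_le_card_nsmul _ _ _ hγ).trans ?_
      rw [nsmul_eq_mul, Finset.card_univ]
    obtain ⟨γ, hγ⟩ := hγ
    obtain ⟨T', hT', ⟨c, hc⟩, hsum⟩ := ih (T.filter fun p => R ∈ bad p → κ R p = γ)
      (fun p => if R ∈ bad p then N * w p else w p) (fun p => (bad p).erase R) (fun p k hk => by
        rw [Finset.mem_erase] at hk
        have := hb p hk.2
        rw [Finset.mem_range] at *
        omega)
    refine ⟨T', hT'.trans (Finset.filter_subset _ _), ⟨Function.update c R γ, ?_⟩, ?_⟩
    · intro p hp k hk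
      by_cases hkR : k = R
      · subst hkR
        rw [Function.update_self]
        exact (Finset.mem_filter.1 (hT' hp)).2 hk
      · rw [Function.update_of_ne hkR]
        exact hc p hp k (Finset.mem_erase.2 ⟨hkR, hk⟩)
    · have e : ∑ p ∈ T', N ^ ((bad p).erase R).card * (if R ∈ bad p then N * w p else w p) =
          ∑ p ∈ T', N ^ (bad p).card * w p := by
        refine Finset.sum_congr rfl fun p _ => ?_
        split_ifs with h
        · rw [← Finset.card_erase_add_one h, pow_succ, mul_assoc]
        · rw [Finset.erase_eq_of_notMem h]
      rw [e] at hsum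
      refine le_trans ?_ hsum
      rw [← Finset.sum_filter_add_sum_filter_not T (fun p => R ∈ bad p)]
      rw [← Finset.sum_filter_add_sum_filter_not (T.filter fun p => R ∈ bad p → κ R p = γ) (fun p => R ∈ bad p)]
      refine add_le_add ?_ ?_
      · refine hγ.trans ?_
        rw [Finset.mul_sum]
        refine le_of_eq (Finset.sum_congr ?_ ?_)
        · ext p
          simp only [Finset.mem_filter]
          tauto
        · intro p hp
          simp only [Finset.mem_filter] at hp
          rw [if_pos hp.2]
      · refine le_of_eq (Finset.sum_congr ?_ ?_)
        · ext p
          simp only [Finset.mem_filter]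
          tauto
        · intro p hp
          simp only [Finset.mem_filter] at hp
          rw [if_neg hp.2]

/-- dyadic size of a lattice difference, and the colours differ there -/
lemma colour_sep {n : ℕ} {p q : Fin n → ℤ} (hne : p ≠ q) : ∃ k : ℕ, (∃ i, 2 ^ k ≤ |q i - p i|) ∧
    (∀ i, |q i - p i| < 2 ^ (k + 1)) ∧
    (fun i => ((p i / 2 ^ k : ℤ) : ZMod 4)) ≠ (fun i => ((q i / 2 ^ k : ℤ) : ZMod 4)) := by
  obtain ⟨i0, hi0⟩ := Function.ne_iff.1 hne
  obtain ⟨i, -, hi⟩ := Finset.exists_max_image Finset.univ (fun i => (q i - p i).natAbs) ⟨i0, Finset.mem_univ _⟩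
  have h0 := hi i0 (Finset.mem_univ _)
  set d := (q i - p i).natAbs with hd
  have hd0 : d ≠ 0 := by omega
  have h1 : 2 ^ Nat.log 2 d ≤ d := Nat.pow_log_le_self 2 hd0
  have h2 : d < 2 ^ (Nat.log 2 d + 1) := Nat.lt_pow_succ_log_self one_lt_two d
  set k := Nat.log 2 d with hk
  have h1' : (2 : ℤ) ^ k ≤ |q i - p i| := by
    rw [Int.abs_eq_natAbs, ← hd]; exact_mod_cast h1
  have h2' : ∀ j, |q j - p j| < (2 : ℤ) ^ (k + 1) := by
    intro j
    rw [Int.abs_eq_natAbs]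
    have := hi j (Finset.mem_univ _)
    have := this.trans_lt h2
    exact_mod_cast this
  refine ⟨k, ⟨i, h1'⟩, h2', fun h => ?_⟩
  have h3 := congrFun h i
  rw [ZMod.intCast_eq_intCast_iff] at h3

  have h5 : ((4 : ℕ) : ℤ) ∣ q i / 2 ^ k - p i / 2 ^ k := (Int.modEq_iff_dvd).1 h3
  have hp : (0 : ℤ) < 2 ^ k := by positivity
  have e1 := Int.mul_ediv_add_emod (p i) (2 ^ k)
  have e2 := Int.mul_ediv_add_emod (q i) (2 ^ k)
  have f1 := Int.emod_nonneg (p i) hp.ne'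
  have f2 := Int.emod_nonneg (q i) hp.ne'
  have g1 := Int.emod_lt_of_pos (p i) hp
  have g2 := Int.emod_lt_of_pos (q i) hp
  have h6 := h2' i
  rw [pow_succ] at h6
  obtain ⟨z, hz⟩ := h5
  have e3 : q i - p i = 2 ^ k * (4 * z) + (q i % 2 ^ k - p i % 2 ^ k) := by
    push_cast at hz
    rw [← hz]
    linear_combination e1 - e2
  have : z = 0 := by
    rw [abs_lt] at h6
    by_contra hz0
    rcases lt_or_gt_of_ne hz0 with h | h
    · have : z ≤ -1 := by omega
      nlinarith
    · have : 1 ≤ z := by omega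
      nlinarith
  rw [this] at e3
  rcases le_abs.1 h1' with h | h <;> nlinarith

lemma nondeg_lower {m : ℕ} {F : (Fin (m + 1) → ℤ) → Euc (m + 1)} {s ε : ℝ} {L k : ℕ} {p q : Fin (m + 1) → ℤ}
    (hs : 0 < s) (hε : ε ≤ s / 2) (hL : 2 ≤ L) (hg : agood F L ε k p) (hd : ¬ Deg F s k p)
    (h1 : ∃ i, 2 ^ k ≤ |q i - p i|) (h2 : ∀ i, |q i - p i| < 2 ^ (k + 1)) :
    s / 2 * 2 ^ k ≤ ‖F q - F p‖ := by
  obtain ⟨i, hi⟩ := h1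
  have hk : (0 : ℝ) < 2 ^ k := by positivity
  set z : Euc m := WithLp.toLp 2 fun j => ((q j - p j : ℤ) : ℝ) with hz
  have hzn : (2 : ℝ) ^ k ≤ ‖z‖ := by
    refine le_trans ?_ (PiLp.norm_apply_le z i)
    rw [hz, Real.norm_eq_abs]
    change (2 : ℝ) ^ k ≤ |((q i - p i : ℤ) : ℝ)|
    exact_mod_cast hi
  have hzp : 0 < ‖z‖ := hk.trans_le hzn
  have h3 : s * ‖z‖ ≤ ‖∑ j, z j • avA F j k p‖ := by
    by_contra hcon
    push Not at hcon
    apply hd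
    refine ⟨‖z‖⁻¹ • z, ?_, ?_⟩
    · rw [norm_smul, norm_inv, norm_norm, inv_mul_cancel₀ hzp.ne']
    · have : ∑ j, (‖z‖⁻¹ • z) j • avA F j k p = ‖z‖⁻¹ • ∑ j, z j • avA F j k p := by
        rw [Finset.smul_sum]
        refine Finset.sum_congr rfl fun j _ => ?_
        rw [PiLp.smul_apply, smul_eq_mul, smul_smul]
      rw [this, norm_smul, norm_inv, norm_norm, inv_mul_lt_iff₀ hzp]
      linarith
  have h4 := hg q fun j => by
    have := h2 j
    have hL' : (2 : ℤ) ≤ L := by exact_mod_cast hL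
    have hk' : (0 : ℤ) < 2 ^ k := by positivity
    rw [pow_succ] at this
    nlinarith
  have h5 : ‖∑ j, z j • avA F j k p‖ ≤ ‖F q - F p‖ + ‖F q - F p - ∑ j, z j • avA F j k p‖ := by
    have : ∑ j, z j • avA F j k p = (F q - F p) - (F q - F p - ∑ j, z j • avA F j k p) := by abel
    conv_lhs => rw [this]
    exact norm_sub_le _ _
  have h6 : ‖F q - F p - ∑ j, z j • avA F j k p‖ ≤ ε * 2 ^ k := h4
  have h7 : ε * 2 ^ k ≤ s / 2 * 2 ^ k := by gcongr
  have h8 : s * 2 ^ k ≤ s * ‖z‖ := by gcongr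
  linarith

def col {n : ℕ} (k : ℕ) (p : Fin n → ℤ) : Fin n → ZMod 4 := fun i => ((p i / 2 ^ k : ℤ) : ZMod 4)

lemma latt_sep {m : ℕ} {F : (Fin (m + 1) → ℤ) → Euc (m + 1)} {s ε : ℝ} {L J : ℕ}
    (hs : 0 < s) (hε : ε ≤ s / 2) (hL : 2 ≤ L) {bad : (Fin (m + 1) → ℤ) → Finset ℕ}
    {T : Finset (Fin (m + 1) → ℤ)} (hT : T ⊆ zbox (m + 1) (2 ^ J))
    (hc : ∃ c : ℕ → (Fin (m + 1) → ZMod 4), ∀ p ∈ T, ∀ k ∈ bad p, col k p = c k)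
    (hgood : ∀ p ∈ T, ∀ k < J + 2, k ∉ bad p → agood F L ε k p ∧ ¬ Deg F s k p) :
    ∀ p ∈ T, ∀ q ∈ T, ∀ i, s / 4 * |((q i - p i : ℤ) : ℝ)| ≤ ‖F q - F p‖ := by
  intro p hp q hq i
  by_cases hne : p = q
  · subst hne; simp
  obtain ⟨c, hc⟩ := hc
  obtain ⟨k, ⟨i0, h1⟩, h2, h3⟩ := colour_sep hne
  have hkJ : k < J + 2 := by
    have a1 := mem_zbox.1 (hT hp) i0
    have a2 := mem_zbox.1 (hT hq) i0
    have : (2 : ℤ) ^ k ≤ 2 ^ (J + 1) := by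
      refine h1.trans ((abs_sub _ _).trans ?_)
      push_cast at a1 a2
      rw [pow_succ]; linarith
    have := (pow_le_pow_iff_right₀ (by norm_num : (1 : ℤ) < 2)).1 this
    omega
  have key : s / 2 * 2 ^ k ≤ ‖F q - F p‖ := by
    by_cases hb : k ∈ bad p
    · by_cases hb' : k ∈ bad q
      · exact absurd ((hc p hp k hb).trans (hc q hq k hb').symm) h3
      · obtain ⟨g1, g2⟩ := hgood q hq k hkJ hb'
        rw [norm_sub_rev]
        exact nondeg_lower hs hε hL g1 g2 ⟨i0, by rwa [abs_sub_comm]⟩ fun j => by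
          rw [abs_sub_comm]; exact h2 j
    · obtain ⟨g1, g2⟩ := hgood p hp k hkJ hb
      exact nondeg_lower hs hε hL g1 g2 ⟨i0, h1⟩ h2
  have h4 : |((q i - p i : ℤ) : ℝ)| ≤ 2 * 2 ^ k := by
    have := (h2 i).le
    rw [pow_succ, mul_comm] at this
    exact_mod_cast this
  calc _ ≤ s / 4 * (2 * 2 ^ k) := by gcongr
    _ = s / 2 * 2 ^ k := by ring
    _ ≤ _ := key

lemma exists_normal {m : ℕ} (a : Fin (m + 1) → Euc (m + 1)) : ∃ v : Euc (m + 1), ‖v‖ = 1 ∧ ∀ i, ⟪a i, v⟫ = 0 := by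
  set K := Submodule.span ℝ (Set.range a) with hK
  have h1 : Kᗮ ≠ ⊥ := by
    intro h
    rw [Submodule.orthogonal_eq_bot_iff] at h
    have h2 : Module.finrank ℝ K ≤ m + 1 := by
      have := finrank_range_le_card (R := ℝ) a
      simpa [Set.finrank] using this
    rw [h, finrank_top] at h2
    simp at h2
  obtain ⟨u, hu, hu0⟩ := Submodule.exists_mem_ne_zero_of_ne_bot h1
  refine ⟨‖u‖⁻¹ • u, ?_, fun i => ?_⟩
  · rw [norm_smul, norm_inv, norm_norm, inv_mul_cancel₀ (norm_ne_zero_iff.2 hu0)]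
  · rw [inner_smul_right, (Submodule.mem_orthogonal K u).1 hu (a i) (Submodule.subset_span ⟨i, rfl⟩), mul_zero]

lemma run_of {m : ℕ} {E FS : Set (Euc (m + 1))} {V : Finset (Euc (m + 1))}
    (hV : ∀ u : Euc (m + 1), ‖u‖ = 1 → ∃ v ∈ V, ‖v - u‖ ≤ 1 / 20)
    {F : (Fin (m + 1) → ℤ) → Euc (m + 1)} {s ε c h r α : ℝ} {L J K m0 i j : ℕ} {T : Finset (Fin (m + 1) → ℤ)}
    {X : (Fin (m + 1) → ℤ) → Set (Euc (m + 1))}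
    (hs : 0 < s) (hε : ε ≤ 1 / 80) (hh : 0 < h) (hr : r = h * 2 ^ J) (hJ : J = K + m0) (hc : 0 ≤ c)
    (hc0 : 160 * c ≤ 2 ^ m0) (hL : 16 / s ≤ L) (hα : (16 * (m + 1) / s) * α ≤ 1 / 80) (hα0 : 0 ≤ α)
    (hFS : ∀ x ∈ FS, ∃ p ∈ T, x ∈ X p) (hX : ∀ p ∈ T, ∀ x ∈ X p, dist x (h • F p) ≤ c * h)
    (hsep : ∀ p ∈ T, ∀ q ∈ T, ∀ i, s / 4 * |((q i - p i : ℤ) : ℝ)| ≤ ‖F q - F p‖)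
    {p : Fin (m + 1) → ℤ} {x : Euc (m + 1)} (hp : p ∈ T) (hx : x ∈ X p) (hxF : x ∈ FS) (hjK : j ≤ K)
    (hag : ∀ t, i ≤ t → t ≤ j → agood F L ε (J - t) p)
    (hb1 : ∀ t, i ≤ t → t ≤ j → ∀ y ∈ E, dist y x < r / 2 ^ t → infDist y FS ≤ 1 / 320 * (r / 2 ^ t))
    (href : ∀ l, ∀ t, i ≤ t → t ≤ j → refs α (fun t => avA F l (J - t) p) t = refs α (fun t => avA F l (J - t) p) i) :
    Run E V r i j x := by
  obtain ⟨v0, hv0, hperp⟩ := exists_normal fun l => refs α (fun t => avA F l (J - t) p) i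
  obtain ⟨v, hv, hvv⟩ := hV v0 hv0
  refine ⟨v, hv, fun t hit htj y hy hyx => ?_⟩
  set k := J - t with hk
  set R := r / 2 ^ t with hR
  have hRk : R = h * 2 ^ k := by
    rw [hR, hr, div_eq_iff (by positivity), mul_assoc, ← pow_add, hk, Nat.sub_add_cancel (by omega)]
  have hRp : 0 < R := by rw [hRk]; positivity
  have hk2 : (2 : ℝ) ^ m0 ≤ 2 ^ k := by
    gcongr
    · norm_num
    · omega
  have hcR : 160 * (c * h) ≤ R := by
    rw [hRk]
    nlinarith
  obtain ⟨x', hx', hyx'⟩ : ∃ x' ∈ FS, dist y x' < 1 / 160 * R := by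
    refine (infDist_lt_iff ⟨x, hxF⟩).1 ((hb1 t hit htj y hy hyx).trans_lt ?_)
    nlinarith
  obtain ⟨q, hq, hxq⟩ := hFS x' hx'
  have d1 := hX p hp x hx
  have d2 := hX q hq x' hxq
  have d3 : dist (h • F q) (h • F p) = h * ‖F q - F p‖ := by
    rw [dist_eq_norm, ← smul_sub, norm_smul, Real.norm_of_nonneg hh.le]
  have d4 : h * ‖F q - F p‖ ≤ 4 * R := by
    rw [← d3]
    have t1 := dist_triangle4 (h • F q) x' x (h • F p)
    have t2 := dist_triangle x' y x
    rw [dist_comm (h • F q) x'] at t1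
    rw [dist_comm x' y] at t2
    linarith
  have d5 : ‖F q - F p‖ ≤ 4 * 2 ^ k := by
    rw [hRk] at d4
    nlinarith
  have d6 : ∀ l, |((q l - p l : ℤ) : ℝ)| ≤ 16 / s * 2 ^ k := by
    intro l
    have := (hsep p hp q hq l).trans d5
    rw [div_mul_eq_mul_div, le_div_iff₀ hs]
    nlinarith
  have g := hag t hit htj q fun l => by
    have : |((q l - p l : ℤ) : ℝ)| ≤ L * 2 ^ k := (d6 l).trans (by gcongr)
    exact_mod_cast this
  have hin : |⟪F q - F p, v0⟫| ≤ 1 / 40 * 2 ^ k := by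
    have e : F q - F p = (F q - F p - ∑ l, ((q l - p l : ℤ) : ℝ) • avA F l k p) +
        ∑ l, ((q l - p l : ℤ) : ℝ) • avA F l k p := by abel
    rw [e, inner_add_left, sum_inner]
    have b1 : |⟪F q - F p - ∑ l, ((q l - p l : ℤ) : ℝ) • avA F l k p, v0⟫| ≤ ε * 2 ^ k := by
      refine (abs_real_inner_le_norm _ _).trans ?_
      rw [hv0, mul_one]; exact g
    have b2 : ∀ l, |⟪((q l - p l : ℤ) : ℝ) • avA F l k p, v0⟫| ≤ 16 / s * 2 ^ k * α := by
      intro l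
      have hcl := refs_close hα0 (fun t => avA F l (J - t) p) t
      rw [href l t hit htj] at hcl
      rw [real_inner_smul_left, abs_mul]
      have : ⟪avA F l k p, v0⟫ = ⟪avA F l k p - refs α (fun t => avA F l (J - t) p) i, v0⟫ := by
        rw [inner_sub_left, hperp l, sub_zero]
      rw [this]
      gcongr
      · exact d6 l
      · refine (abs_real_inner_le_norm _ _).trans ?_
        rw [hv0, mul_one]; exact hcl
    have b3 : |∑ l, ⟪((q l - p l : ℤ) : ℝ) • avA F l k p, v0⟫| ≤ (m + 1) * (16 / s * 2 ^ k * α) := by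
      refine (Finset.abs_sum_le_sum_abs _ _).trans ((Finset.sum_le_sum fun l _ => b2 l).trans ?_)
      simp
    have b4 : (m + 1) * (16 / s * 2 ^ k * α) ≤ 1 / 80 * 2 ^ k := by
      calc (m + 1) * (16 / s * 2 ^ k * α) = (16 * (m + 1) / s) * α * 2 ^ k := by ring
        _ ≤ _ := by gcongr
    have b5 : ε * 2 ^ k ≤ 1 / 80 * 2 ^ k := by gcongr
    refine (abs_add_le _ _).trans ?_
    linarith
  have h1 : |⟪y - x, v0⟫| ≤ R / 20 := by
    have e : y - x = (y - x') + (x' - h • F q) + h • (F q - F p) + (h • F p - x) := by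
      rw [smul_sub]; abel
    have n : ∀ z : Euc (m + 1), |⟪z, v0⟫| ≤ ‖z‖ := fun z => by
      have := abs_real_inner_le_norm z v0
      rwa [hv0, mul_one] at this
    rw [e, inner_add_left, inner_add_left, inner_add_left, real_inner_smul_left]
    have c1 : |⟪y - x', v0⟫| ≤ 1 / 160 * R := (n _).trans (by rw [← dist_eq_norm]; exact hyx'.le)
    have c2 : |⟪x' - h • F q, v0⟫| ≤ c * h := (n _).trans (by rw [← dist_eq_norm]; exact d2)
    have c3 : |⟪h • F p - x, v0⟫| ≤ c * h := (n _).trans (by rw [← dist_eq_norm, dist_comm]; exact d1)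
    have c4 : |h * ⟪F q - F p, v0⟫| ≤ 1 / 40 * R := by
      rw [abs_mul, abs_of_pos hh, hRk]
      nlinarith
    have t1 := abs_add_le (⟪y - x', v0⟫ + ⟪x' - h • F q, v0⟫ + h * ⟪F q - F p, v0⟫) ⟪h • F p - x, v0⟫
    have t2 := abs_add_le (⟪y - x', v0⟫ + ⟪x' - h • F q, v0⟫) (h * ⟪F q - F p, v0⟫)
    have t3 := abs_add_le ⟪y - x', v0⟫ ⟪x' - h • F q, v0⟫
    linarith
  have h2 : |⟪y - x, v - v0⟫| ≤ R * (1 / 20) := by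
    refine (abs_real_inner_le_norm _ _).trans ?_
    rw [← dist_eq_norm]
    gcongr
  have e : ⟪y - x, v⟫ = ⟪y - x, v0⟫ + ⟪y - x, v - v0⟫ := by rw [inner_sub_right]; ring
  rw [e]
  refine (abs_add_le _ _).trans ?_
  linarith

/-- points of `FS` near which `E` is not close to `FS` at scale `R` -/
def Bad1 {n : ℕ} (E FS : Set (Euc n)) (R : ℝ) : Set (Euc n) :=
  {x | ∃ y ∈ E, dist y x < R ∧ 1 / 320 * R < infDist y FS}

lemma bad1_meas {n : ℕ} (E FS : Set (Euc n)) (R : ℝ) : MeasurableSet (Bad1 E FS R) := by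
  apply IsOpen.measurableSet
  have : Bad1 E FS R = ⋃ y ∈ {y ∈ E | 1 / 320 * R < infDist y FS}, {x | dist y x < R} := by
    ext x
    simp only [Bad1, mem_setOf_eq, mem_iUnion, exists_prop]
    constructor
    · rintro ⟨y, h1, h2, h3⟩; exact ⟨y, ⟨h1, h3⟩, h2⟩
    · rintro ⟨y, ⟨h1, h3⟩, h2⟩; exact ⟨y, h1, h2, h3⟩
  rw [this]
  exact isOpen_biUnion fun y _ => isOpen_lt (by fun_prop) (by fun_prop)

lemma bad1_pack {n : ℕ} {CE CU : ℝ} {E : Set (Euc n)} (hE : IsADR n E CE) (hCU : 1 ≤ CU)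
    (up : ∀ (z : Euc n) (R : ℝ), 0 < R → μH[(n : ℝ)] (E ∩ ball z R) ≤ ENNReal.ofReal (CU * R ^ n))
    {y : Euc n} {r : ℝ} (hr : 0 < r) (hrd : ENNReal.ofReal r < ediam E) {FS : Set (Euc n)} (hFS : FS ⊆ E ∩ ball y r)
    (K : ℕ) : ∑ t ∈ Finset.range (K + 1), μH[(n : ℝ)] (FS ∩ Bad1 E FS (r / 2 ^ t)) ≤
      ENNReal.ofReal ((CU * CE * 1280 ^ n) * (11 * (CU * 4 ^ n)) * r ^ n) := by
  classical
  have hCE : 1 ≤ CE := hE.2.1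
  have hrt : ∀ t : ℕ, 0 < r / 2 ^ t := fun t => by positivity
  have hrt' : ∀ t : ℕ, r / 2 ^ t ≤ r := fun t => div_le_self hr.le (one_le_pow₀ one_le_two)
  set A : ℕ → Set (Euc n) := fun t => {z ∈ E | (∃ x ∈ FS, dist z x < r / 2 ^ t) ∧ 1 / 320 * (r / 2 ^ t) < infDist z FS} with hA
  have hAb : ∀ t, A t ⊆ ball y (2 * r) := by
    rintro t z ⟨-, ⟨x, hx, hzx⟩, -⟩
    have h1 := mem_ball.1 (hFS hx).2
    have := dist_triangle z x y
    have := hrt' t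
    rw [mem_ball]; linarith
  choose Nt hNA hNsep hNcov _ using fun t => exists_net (A t) (hrt t) (by positivity : 0 < 2 * r) (hAb t)
  set S : (Σ _ : ℕ, Euc n) → Set (Euc n) := fun i => E ∩ ball i.2 (1 / 640 * (r / 2 ^ i.1)) with hS
  set T : Finset (Σ _ : ℕ, Euc n) := (Finset.range (K + 1)).sigma Nt with hT
  have hTm : ∀ i ∈ T, i.2 ∈ Nt i.1 := fun i hi => (Finset.mem_sigma.1 hi).2
  have hbet : ∀ i ∈ T, ∀ x ∈ S i, 1 / 640 * (r / 2 ^ i.1) < infDist x FS ∧ infDist x FS < 2 * (r / 2 ^ i.1) := by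
    intro i hi x hx
    obtain ⟨-, ⟨x', hx', hd⟩, h2⟩ := hNA _ (hTm i hi)
    have h3 := mem_ball.1 hx.2
    have h4 := infDist_le_infDist_add_dist (s := FS) (x := i.2) (y := x)
    rw [dist_comm] at h4
    have h5 := infDist_le_dist_of_mem (x := x) hx'
    have h6 := dist_triangle x i.2 x'
    have := hrt i.1
    constructor <;> linarith
  have hov := overlap_sum T S (E ∩ ball y (4 * r)) 11 (fun i _ => hE.1.measurableSet.inter measurableSet_ball)
    (fun i hi x hx => by
      refine ⟨hx.1, ?_⟩
      have h1 := mem_ball.1 hx.2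
      have h2 := mem_ball.1 (hAb _ (hNA _ (hTm i hi)))
      have h3 := dist_triangle x i.2 y
      have := hrt' i.1
      rw [mem_ball]; linarith) (hE.1.measurableSet.inter measurableSet_ball) (by
    intro x T' hT' hx
    rcases T'.eq_empty_or_nonempty with h0 | hne
    · rw [h0]; simp
    obtain ⟨i0, hi0, hmin⟩ := Finset.exists_min_image T' (fun i => i.1) hne
    have hinj : Set.InjOn (fun i : (Σ _ : ℕ, Euc n) => i.1) T' := by
      rintro ⟨t, z⟩ hz ⟨t', z'⟩ hz' he
      simp only at he
      subst he
      by_contra hne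
      have hzz : z ≠ z' := fun h => hne (by rw [h])
      have h1 := hNsep t z (hTm _ (hT' hz)) z' (hTm _ (hT' hz')) hzz
      have h2 := mem_ball.1 (hx _ hz).2
      have h3 := mem_ball.1 (hx _ hz').2
      have h4 := dist_triangle_left z z' x
      have := hrt t
      simp only at h2 h3
      linarith
    rw [← Finset.card_image_of_injOn hinj]
    have : T'.image (fun i => i.1) ⊆ Finset.Ico i0.1 (i0.1 + 11) := by
      intro t ht
      obtain ⟨i, hi, rfl⟩ := Finset.mem_image.1 ht
      rw [Finset.mem_Ico]
      refine ⟨hmin i hi, ?_⟩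
      by_contra hcon
      push Not at hcon
      have h1 := (hbet i (hT' hi) x (hx i hi)).2
      have h2 := (hbet i0 (hT' hi0) x (hx i0 hi0)).1
      have h3 : r / 2 ^ i.1 ≤ r / 2 ^ (i0.1 + 11) := by
        gcongr
        norm_num
      have h4 : r / 2 ^ (i0.1 + 11) = r / 2 ^ i0.1 / 2048 := by
        rw [pow_add, ← div_div]; norm_num
      have := hrt i0.1
      linarith
    exact (Finset.card_le_card this).trans (by simp))
  have hlow : ∀ i, ∀ t, i ∈ Nt t → ENNReal.ofReal (CU * (2 * (r / 2 ^ t)) ^ n) ≤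
      ENNReal.ofReal (CU * CE * 1280 ^ n) * μH[(n : ℝ)] (S ⟨t, i⟩) := by
    intro z t hz
    have h1 := (hE.2.2 z (hNA t hz).1 (1 / 640 * (r / 2 ^ t)) (by have := hrt t; positivity)
      (lt_of_le_of_lt (ENNReal.ofReal_le_ofReal (by have := hrt t; have := hrt' t; linarith)) hrd)).1
    refine le_trans (le_of_eq ?_) (mul_le_mul_right h1 _)
    rw [← ENNReal.ofReal_mul (by positivity)]
    congr 1
    rw [show 2 * (r / 2 ^ t) = 1280 * (1 / 640 * (r / 2 ^ t)) by ring, mul_pow]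
    field_simp
  calc ∑ t ∈ Finset.range (K + 1), μH[(n : ℝ)] (FS ∩ Bad1 E FS (r / 2 ^ t))
      ≤ ∑ t ∈ Finset.range (K + 1), ∑ z ∈ Nt t, ENNReal.ofReal (CU * CE * 1280 ^ n) * μH[(n : ℝ)] (S ⟨t, z⟩) := by
        refine Finset.sum_le_sum fun t _ => ?_
        calc μH[(n : ℝ)] (FS ∩ Bad1 E FS (r / 2 ^ t)) ≤ μH[(n : ℝ)] (⋃ z ∈ Nt t, E ∩ ball z (2 * (r / 2 ^ t))) := by
              refine measure_mono ?_
              rintro x ⟨hx, y', hy', hd, hf⟩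
              obtain ⟨z, hz, hzd⟩ := hNcov t y' ⟨hy', ⟨x, hx, hd⟩, hf⟩
              refine mem_iUnion₂.2 ⟨z, hz, (hFS hx).1, ?_⟩
              have := dist_triangle_left x z y'
              rw [mem_ball]; linarith
          _ ≤ ∑ z ∈ Nt t, μH[(n : ℝ)] (E ∩ ball z (2 * (r / 2 ^ t))) := measure_biUnion_finset_le _ _
          _ ≤ _ := Finset.sum_le_sum fun z hz => (up z _ (by have := hrt t; positivity)).trans (hlow z t hz)
    _ = ENNReal.ofReal (CU * CE * 1280 ^ n) * ∑ i ∈ T, μH[(n : ℝ)] (S i) := by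
        rw [hT, Finset.sum_sigma, Finset.mul_sum]
        simp only [Finset.mul_sum]
    _ ≤ ENNReal.ofReal (CU * CE * 1280 ^ n) * ((11 : ℕ) * ENNReal.ofReal (CU * (4 * r) ^ n)) := by
        gcongr
        exact hov.trans (by gcongr; exact up y _ (by positivity))
    _ = _ := by
        rw [← ENNReal.ofReal_natCast, ← ENNReal.ofReal_mul (by positivity), ← ENNReal.ofReal_mul (by positivity)]
        congr 1
        rw [mul_pow]; push_cast; ring

/-- Chebyshev for counting -/
lemma cheb {X : Type*} [MeasurableSpace X] (μ : Measure X) {I : Finset ℕ} {B : ℕ → Set X} {FS : Set X}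
    (hF : MeasurableSet FS) (hB : ∀ t, MeasurableSet (B t)) (N : ℕ) :
    ∃ W : Set X, MeasurableSet W ∧ W ⊆ FS ∧ (N : ℝ≥0∞) * μ W ≤ ∑ t ∈ I, μ (FS ∩ B t) ∧
      ∀ x ∈ FS, x ∉ W → ∃ P : Finset ℕ, P.card ≤ N ∧ ∀ t ∈ I, x ∈ B t → t ∈ P := by
  classical
  set g : X → ℝ≥0∞ := fun x => ∑ t ∈ I, (FS ∩ B t).indicator 1 x with hg
  have hgm : Measurable g := Finset.measurable_sum _ fun t _ => measurable_one.indicator (hF.inter (hB t))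
  have hgi : ∫⁻ x, g x ∂μ = ∑ t ∈ I, μ (FS ∩ B t) := by
    rw [hg, lintegral_finset_sum _ fun t _ => measurable_one.indicator (hF.inter (hB t))]
    exact Finset.sum_congr rfl fun t _ => lintegral_indicator_one (hF.inter (hB t))
  refine ⟨FS ∩ {x | (N : ℝ≥0∞) ≤ g x}, hF.inter (measurableSet_le measurable_const hgm), inter_subset_left, ?_, ?_⟩
  · rw [← hgi]
    refine le_trans ?_ (mul_meas_ge_le_lintegral₀ hgm.aemeasurable (N : ℝ≥0∞))
    gcongr
    exact inter_subset_right
  · intro x hx hxW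
    have h1 : g x < N := by
      by_contra h
      exact hxW ⟨hx, not_lt.1 h⟩
    refine ⟨I.filter fun t => x ∈ B t, ?_, fun t ht hxt => Finset.mem_filter.2 ⟨ht, hxt⟩⟩
    have h2 : g x = ((I.filter fun t => x ∈ B t).card : ℝ≥0∞) := by
      simp only [hg, Set.indicator_apply, mem_inter_iff, hx, true_and, Pi.one_apply]
      rw [Finset.sum_boole]
    rw [h2] at h1
    exact_mod_cast h1.le

open Classical in
/-- number of exceptional scales at a lattice point -/
def cntZ {m : ℕ} (F : (Fin (m + 1) → ℤ) → Euc (m + 1)) (L : ℕ) (ε α : ℝ) (J : ℕ) (p : Fin (m + 1) → ℤ) : ℕ :=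
  ((Finset.range (J + 2)).filter fun k => ¬ agood F L ε k p).card +
    ∑ i, (jumps α (fun t => avA F i (J - t) p) J).card

lemma cntZ_sum (m : ℕ) {M ε α : ℝ} (hM : 0 ≤ M) (hε : 0 < ε) (hα : 0 < α) {L : ℕ} (hL : 1 ≤ L) : ∃ C : ℝ, 0 ≤ C ∧
    ∀ F : (Fin (m + 1) → ℤ) → Euc (m + 1), LipZ F M → ∀ J : ℕ,
    ∑ p ∈ zbox (m + 1) (2 ^ J), (cntZ F L ε α J p : ℝ) ≤ C * (2 ^ J) ^ (m + 1) := by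
  classical
  obtain ⟨C, hC, h⟩ := agood_pack (H := Euc (m + 1)) (m + 1) hM hε hL
  refine ⟨C + (m + 1) * (M ^ 2 / α ^ 2 * 4 ^ (m + 1)), by positivity, fun F hF J => ?_⟩
  have h1 := h F hF J
  have h2 : ∑ p ∈ zbox (m + 1) (2 ^ J), (((Finset.range (J + 2)).filter fun k => ¬ agood F L ε k p).card : ℝ) =
      ∑ G ∈ Finset.range (J + 2), (((zbox (m + 1) (2 ^ J)).filter (fun p => ¬ agood F L ε G p)).card : ℝ) := by
    simp only [← Finset.sum_boole]
    exact Finset.sum_comm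
  have h3 : ∑ p ∈ zbox (m + 1) (2 ^ J), ∑ i, ((jumps α (fun t => avA F i (J - t) p) J).card : ℝ) ≤
      (m + 1) * (M ^ 2 / α ^ 2 * 4 ^ (m + 1) * (2 ^ J) ^ (m + 1)) := by
    rw [Finset.sum_comm]
    refine (Finset.sum_le_sum fun i _ => jump_count hF hα i J).trans ?_
    simp
  simp only [cntZ, Nat.cast_add, Nat.cast_sum, Finset.sum_add_distrib]
  have e : (C + (m + 1) * (M ^ 2 / α ^ 2 * 4 ^ (m + 1))) * (2 ^ J) ^ (m + 1) =
    C * (2 ^ J) ^ (m + 1) + (m + 1) * (M ^ 2 / α ^ 2 * 4 ^ (m + 1) * (2 ^ J) ^ (m + 1)) := by ring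
  rw [e]
  refine add_le_add (le_of_eq_of_le ?_ h1) h3
  rw [← h2]

lemma ediv_abs {a b : ℤ} {G : ℕ} (h : a / 2 ^ G = b / 2 ^ G) : |a - b| ≤ 2 ^ G := by
  have hp : (0 : ℤ) < 2 ^ G := by positivity
  have e1 := Int.mul_ediv_add_emod a (2 ^ G)
  have e2 := Int.mul_ediv_add_emod b (2 ^ G)
  have f1 := Int.emod_nonneg a hp.ne'
  have f2 := Int.emod_nonneg b hp.ne'
  have g1 := Int.emod_lt_of_pos a hp
  have g2 := Int.emod_lt_of_pos b hp
  rw [h] at e1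
  rw [abs_le]
  constructor <;> linarith

lemma core1 {m : ℕ} {CU Cd C3 c θ s ε α h r : ℝ} {E : Set (Euc (m + 1))} {F : (Fin (m + 1) → ℤ) → Euc (m + 1)}
    {L J m0 N1 : ℕ} {X : (Fin (m + 1) → ℤ) → Set (Euc (m + 1))}
    (hCU : 1 ≤ CU) (hs : 0 < s) (hε : ε ≤ s / 2) (hL : 2 ≤ L) (hh : 0 < h) (hr : r = h * 2 ^ J) (hc : 0 < c)
    (hCd : 0 < Cd) (hCds : Cd * s * 4 ^ (m + 1) ≤ θ / 4) (hθ : 0 < θ)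
    (up : ∀ (z : Euc (m + 1)) (R : ℝ), 0 < R → μH[((m + 1 : ℕ) : ℝ)] (E ∩ ball z R) ≤ ENNReal.ofReal (CU * R ^ (m + 1)))
    (hD : ∀ G p, m0 ≤ G → agood F L ε G p → Deg F s G p → ∀ Y ⊆ E,
      (∀ y ∈ Y, ∃ q : Fin (m + 1) → ℤ, (∀ i, |q i - p i| ≤ 2 ^ G) ∧ dist y (h • F q) ≤ c * h) →
      μH[((m + 1 : ℕ) : ℝ)] Y ≤ ENNReal.ofReal (Cd * s * (2 ^ G * h) ^ (m + 1)))
    (hcnt : ∑ p ∈ zbox (m + 1) (2 ^ J), (cntZ F L ε α J p : ℝ) ≤ C3 * (2 ^ J) ^ (m + 1))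
    (hN1 : C3 * (CU * (2 * c) ^ (m + 1)) ≤ θ / 4 * N1) (hN1p : 0 < N1)
    (hXm : ∀ p, MeasurableSet (X p)) (hXE : ∀ p, X p ⊆ E) (hXd : ∀ p, ∀ x ∈ X p, dist x (h • F p) ≤ c * h)
    (hcov : ENNReal.ofReal (θ * r ^ (m + 1)) ≤ μH[((m + 1 : ℕ) : ℝ)] (⋃ p ∈ zbox (m + 1) (2 ^ J), X p)) :
    ∃ T ⊆ zbox (m + 1) (2 ^ J), (∀ p ∈ T, ∀ q ∈ T, ∀ i, s / 4 * |((q i - p i : ℤ) : ℝ)| ≤ ‖F q - F p‖) ∧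
      (∀ p ∈ T, cntZ F L ε α J p ≤ N1) ∧
      ENNReal.ofReal (θ / 2 * r ^ (m + 1)) ≤
        ((4 ^ (m + 1)) ^ (m0 + N1) * (2 * ⌈8 * c / s⌉₊ + 1) ^ (m + 1) : ℕ) * μH[((m + 1 : ℕ) : ℝ)] (⋃ p ∈ T, X p) := by
  classical
  have hrp : 0 < r := by rw [hr]; positivity
  set μ : Measure (Euc (m + 1)) := μH[((m + 1 : ℕ) : ℝ)] with hμ
  set mk : ℕ → (Fin (m + 1) → ℤ) → Prop := fun G p => m0 ≤ G ∧ ∃ p' : Fin (m + 1) → ℤ,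
    (∀ i, p' i / 2 ^ G = p i / 2 ^ G) ∧ agood F L ε G p' ∧ Deg F s G p' with hmk
  set Z := zbox (m + 1) (2 ^ J) with hZ
  -- the degenerate part
  have hdeg : μ (⋃ p ∈ {p : Fin (m + 1) → ℤ | p ∈ zT (m + 1) J ∧ ∃ G ≤ J + 1, mk G p}, X p) ≤
      ENNReal.ofReal (θ / 4 * r ^ (m + 1)) := by
    refine (dyadic_cover μ X mk J (ENNReal.ofReal (Cd * s * h ^ (m + 1))) ?_ ?_).trans ?_
    · rintro G p q hpq ⟨h1, p', h2, h3⟩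
      exact ⟨h1, p', fun i => (h2 i).trans (hpq i).symm, h3⟩
    · rintro G p ⟨h1, p', h2, h3, h4⟩
      refine (hD G p' h1 h3 h4 _ (iUnion₂_subset fun q _ => hXE q) ?_).trans (le_of_eq ?_)
      · intro x hx
        obtain ⟨q, hq, hxq⟩ := mem_iUnion₂.1 hx
        exact ⟨q, fun i => ediv_abs ((hq i).trans (h2 i).symm), hXd q x hxq⟩
      · rw [← ENNReal.ofReal_natCast, ← ENNReal.ofReal_mul (by positivity)]
        congr 1
        push_cast
        rw [mul_pow]; ring
    · rw [← ENNReal.ofReal_natCast, card_zT, ← ENNReal.ofReal_mul (by positivity)]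
      apply ENNReal.ofReal_le_ofReal
      rw [hr, mul_pow]
      calc Cd * s * h ^ (m + 1) * (4 ^ (m + 1) * (2 ^ J) ^ (m + 1)) =
            Cd * s * 4 ^ (m + 1) * (h ^ (m + 1) * (2 ^ J) ^ (m + 1)) := by ring
        _ ≤ _ := by gcongr
  -- points with many exceptional scales
  set Rm := Z.filter fun p => N1 < cntZ F L ε α J p with hRm
  have hRmc : (N1 : ℝ) * Rm.card ≤ C3 * (2 ^ J) ^ (m + 1) := by
    refine le_trans ?_ hcnt
    calc (N1 : ℝ) * Rm.card = ∑ p ∈ Rm, (N1 : ℝ) := by rw [Finset.sum_const, nsmul_eq_mul, mul_comm]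
      _ ≤ ∑ p ∈ Rm, (cntZ F L ε α J p : ℝ) := Finset.sum_le_sum fun p hp => by
          exact_mod_cast (Finset.mem_filter.1 hp).2.le
      _ ≤ _ := Finset.sum_le_sum_of_subset_of_nonneg (Finset.filter_subset _ _) fun _ _ _ => by positivity
  have hRmμ : μ (⋃ p ∈ Rm, X p) ≤ ENNReal.ofReal (θ / 4 * r ^ (m + 1)) := by
    calc μ (⋃ p ∈ Rm, X p) ≤ ∑ p ∈ Rm, μ (X p) := measure_biUnion_finset_le _ _
      _ ≤ ∑ p ∈ Rm, ENNReal.ofReal (CU * (2 * c * h) ^ (m + 1)) := by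
          refine Finset.sum_le_sum fun p _ => ?_
          have hsub : X p ⊆ E ∩ ball (h • F p) (2 * c * h) := fun x hx => ⟨hXE p hx, by
            rw [mem_ball]
            have := hXd p x hx
            nlinarith [mul_pos hc hh]⟩
          exact (measure_mono hsub).trans (up (h • F p) (2 * c * h) (by positivity))
      _ = ENNReal.ofReal (Rm.card * (CU * (2 * c * h) ^ (m + 1))) := by
          rw [Finset.sum_const, nsmul_eq_mul, ENNReal.ofReal_mul (p := (Rm.card : ℝ)) (Nat.cast_nonneg _),
            ENNReal.ofReal_natCast]
      _ ≤ _ := by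
          apply ENNReal.ofReal_le_ofReal
          have hN : (0 : ℝ) < N1 := by exact_mod_cast hN1p
          refine le_of_mul_le_mul_left ?_ hN
          calc (N1 : ℝ) * (Rm.card * (CU * (2 * c * h) ^ (m + 1))) = N1 * Rm.card * (CU * (2 * c * h) ^ (m + 1)) := by ring
            _ ≤ C3 * (2 ^ J) ^ (m + 1) * (CU * (2 * c * h) ^ (m + 1)) := by gcongr
            _ = C3 * (CU * (2 * c) ^ (m + 1)) * r ^ (m + 1) := by rw [hr, mul_pow (2 * c) h, mul_pow h]; ring
            _ ≤ θ / 4 * N1 * r ^ (m + 1) := by gcongr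
            _ = _ := by ring
  set T1 := Z.filter fun p => ¬ (∃ G ≤ J + 1, mk G p) ∧ cntZ F L ε α J p ≤ N1 with hT1
  have hT1μ : ENNReal.ofReal (θ / 2 * r ^ (m + 1)) ≤ ∑ p ∈ T1, μ (X p) := by
    have h1 : ENNReal.ofReal (θ * r ^ (m + 1)) ≤ ∑ p ∈ T1, μ (X p) + ENNReal.ofReal (θ / 4 * r ^ (m + 1)) +
        ENNReal.ofReal (θ / 4 * r ^ (m + 1)) := by
      refine hcov.trans ?_
      calc μ (⋃ p ∈ Z, X p) ≤ μ ((⋃ p ∈ T1, X p) ∪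
            (⋃ p ∈ {p : Fin (m + 1) → ℤ | p ∈ zT (m + 1) J ∧ ∃ G ≤ J + 1, mk G p}, X p) ∪ ⋃ p ∈ Rm, X p) := by
            refine measure_mono fun x hx => ?_
            obtain ⟨p, hp, hxp⟩ := mem_iUnion₂.1 hx
            by_cases h1 : ∃ G ≤ J + 1, mk G p
            · exact Or.inl (Or.inr (mem_iUnion₂.2 ⟨p, ⟨zbox_sub_zT _ _ hp, h1⟩, hxp⟩))
            by_cases h2 : cntZ F L ε α J p ≤ N1
            · exact Or.inl (Or.inl (mem_iUnion₂.2 ⟨p, Finset.mem_filter.2 ⟨hp, h1, h2⟩, hxp⟩))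
            · exact Or.inr (mem_iUnion₂.2 ⟨p, Finset.mem_filter.2 ⟨hp, not_le.1 h2⟩, hxp⟩)
        _ ≤ _ := (measure_union_le _ _).trans (add_le_add ((measure_union_le _ _).trans
            (add_le_add (measure_biUnion_finset_le _ _) hdeg)) hRmμ)
    have e : θ * r ^ (m + 1) = θ / 2 * r ^ (m + 1) + θ / 4 * r ^ (m + 1) + θ / 4 * r ^ (m + 1) := by ring
    rw [e, ENNReal.ofReal_add (by positivity) (by positivity), ENNReal.ofReal_add (by positivity) (by positivity)] at h1
    exact (ENNReal.add_le_add_iff_right ENNReal.ofReal_ne_top).1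
      ((ENNReal.add_le_add_iff_right ENNReal.ofReal_ne_top).1 h1)
  -- colouring
  set bad : (Fin (m + 1) → ℤ) → Finset ℕ := fun p =>
    (Finset.range (J + 2)).filter fun k => k < m0 ∨ ¬ agood F L ε k p with hbad
  obtain ⟨T, hTT1, hcol, hTs⟩ := colour (Γ := Fin (m + 1) → ZMod 4) (fun k p => col k p) (J + 2) T1
    (fun p => μ (X p)) bad (fun p => Finset.filter_subset _ _)
  have hTZ : T ⊆ Z := hTT1.trans (Finset.filter_subset _ _)
  have hsep := latt_sep (F := F) hs hε hL hTZ hcol (fun p hp k hk hkb => by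
    have h1 : ¬ (k < m0 ∨ ¬ agood F L ε k p) := fun h => hkb (Finset.mem_filter.2 ⟨Finset.mem_range.2 hk, h⟩)
    push Not at h1
    refine ⟨h1.2, fun hd => ?_⟩
    exact (Finset.mem_filter.1 (hTT1 hp)).2.1 ⟨k, by omega, h1.1, p, fun _ => rfl, h1.2, hd⟩)
  refine ⟨T, hTZ, hsep, fun p hp => (Finset.mem_filter.1 (hTT1 hp)).2.2, ?_⟩
  have hbc : ∀ p ∈ T, (bad p).card ≤ m0 + N1 := by
    intro p hp
    have h1 := (Finset.mem_filter.1 (hTT1 hp)).2.2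
    have h2 : bad p ⊆ Finset.range m0 ∪ (Finset.range (J + 2)).filter fun k => ¬ agood F L ε k p := by
      intro k hk
      obtain ⟨h3, h4⟩ := Finset.mem_filter.1 hk
      rcases h4 with h4 | h4
      · exact Finset.mem_union_left _ (Finset.mem_range.2 h4)
      · exact Finset.mem_union_right _ (Finset.mem_filter.2 ⟨h3, h4⟩)
    refine (Finset.card_le_card h2).trans ((Finset.card_union_le _ _).trans ?_)
    rw [Finset.card_range]
    unfold cntZ at h1
    omega
  have hcardΓ : Fintype.card (Fin (m + 1) → ZMod 4) = 4 ^ (m + 1) := by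
    rw [Fintype.card_fun, ZMod.card, Fintype.card_fin]
  rw [hcardΓ] at hTs
  have hov := overlap_sum (n := m + 1) T X (⋃ p ∈ T, X p) ((2 * ⌈8 * c / s⌉₊ + 1) ^ (m + 1)) (fun p _ => hXm p)
    (fun p hp => subset_biUnion_of_mem (u := X) (Finset.mem_coe.2 hp)) (Finset.measurableSet_biUnion _ fun p _ => hXm p) (by
      intro x T' hT' hx
      rcases T'.eq_empty_or_nonempty with h0 | ⟨p, hp⟩
      · rw [h0]; simp
      rw [← card_zbox]
      refine Finset.card_le_card_of_injOn (fun q => q - p) ?_ (fun a _ b _ hab => sub_left_injective hab)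
      intro q hq
      rw [Finset.mem_coe, mem_zbox]
      intro i
      have h1 := hsep p (hT' hp) q (hT' hq) i
      have h2 := hXd p x (hx p hp)
      have h3 := hXd q x (hx q hq)
      have h4 := dist_triangle_left (h • F q) (h • F p) x
      rw [dist_eq_norm (h • F q), ← smul_sub, norm_smul, Real.norm_of_nonneg hh.le] at h4
      have h5 : ‖F q - F p‖ ≤ 2 * c := by
        refine le_of_mul_le_mul_left ?_ hh
        linarith
      have h6 : |((q i - p i : ℤ) : ℝ)| ≤ 8 * c / s := by
        rw [le_div_iff₀ hs]
        linarith
      have h7 := h6.trans (Nat.le_ceil _)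
      change |q i - p i| ≤ _
      exact_mod_cast h7)
  calc ENNReal.ofReal (θ / 2 * r ^ (m + 1)) ≤ ∑ p ∈ T, ((4 ^ (m + 1) : ℕ) : ℝ≥0∞) ^ (bad p).card * μ (X p) :=
        hT1μ.trans hTs
    _ ≤ ∑ p ∈ T, ((4 ^ (m + 1) : ℕ) : ℝ≥0∞) ^ (m0 + N1) * μ (X p) := by
        refine Finset.sum_le_sum fun p hp => ?_
        refine mul_le_mul_left (pow_le_pow_right₀ ?_ (hbc p hp)) _
        exact_mod_cast Nat.one_le_pow _ _ (by norm_num)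
    _ = ((4 ^ (m + 1) : ℕ) : ℝ≥0∞) ^ (m0 + N1) * ∑ p ∈ T, μ (X p) := by rw [Finset.mul_sum]
    _ ≤ ((4 ^ (m + 1) : ℕ) : ℝ≥0∞) ^ (m0 + N1) * (((2 * ⌈8 * c / s⌉₊ + 1) ^ (m + 1) : ℕ) * μ (⋃ p ∈ T, X p)) := by
        gcongr
    _ = _ := by
        rw [← mul_assoc]
        congr 1
        push_cast
        ring

lemma goodK_of {m : ℕ} {E FS : Set (Euc (m + 1))} {V : Finset (Euc (m + 1))}
    (hV : ∀ u : Euc (m + 1), ‖u‖ = 1 → ∃ v ∈ V, ‖v - u‖ ≤ 1 / 20)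
    {F : (Fin (m + 1) → ℤ) → Euc (m + 1)} {s ε c h r α : ℝ} {L J K m0 N1 N2 : ℕ} {T : Finset (Fin (m + 1) → ℤ)}
    {X : (Fin (m + 1) → ℤ) → Set (Euc (m + 1))}
    (hs : 0 < s) (hε : ε ≤ 1 / 80) (hh : 0 < h) (hr : r = h * 2 ^ J) (hJ : J = K + m0) (hc : 0 ≤ c)
    (hc0 : 160 * c ≤ 2 ^ m0) (hL : 16 / s ≤ L) (hα : (16 * (m + 1) / s) * α ≤ 1 / 80) (hα0 : 0 ≤ α)
    (hFS : ∀ x ∈ FS, ∃ p ∈ T, x ∈ X p) (hX : ∀ p ∈ T, ∀ x ∈ X p, dist x (h • F p) ≤ c * h)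
    (hsep : ∀ p ∈ T, ∀ q ∈ T, ∀ i, s / 4 * |((q i - p i : ℤ) : ℝ)| ≤ ‖F q - F p‖)
    {p : Fin (m + 1) → ℤ} {x : Euc (m + 1)} (hp : p ∈ T) (hx : x ∈ X p) (hxF : x ∈ FS)
    (hN1 : cntZ F L ε α J p ≤ N1) {P2 : Finset ℕ} (hP2 : P2.card ≤ N2)
    (hb : ∀ t ∈ Finset.range (K + 1), x ∈ Bad1 E FS (r / 2 ^ t) → t ∈ P2) :
    GoodK E V r (2 * N2 + 2 * N1) K x := by
  classical
  set Q := ((Finset.range (J + 2)).filter fun k => ¬ agood F L ε k p).image (fun k => J - k) with hQ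
  set JJ := Finset.univ.biUnion fun i => (jumps α (fun t => avA F i (J - t) p) J).image (· + 1) with hJJ
  refine ⟨(P2 ∪ P2.image (· + 1)) ∪ ((Q ∪ Q.image (· + 1)) ∪ JJ), ?_, ?_⟩
  · have h1 : Q.card ≤ ((Finset.range (J + 2)).filter fun k => ¬ agood F L ε k p).card := Finset.card_image_le
    have h2 : JJ.card ≤ ∑ i, (jumps α (fun t => avA F i (J - t) p) J).card :=
      Finset.card_biUnion_le.trans (Finset.sum_le_sum fun i _ => Finset.card_image_le)
    have h3 : (Q.image (· + 1)).card ≤ Q.card := Finset.card_image_le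
    have h4 : (P2.image (· + 1)).card ≤ P2.card := Finset.card_image_le
    have h5 := Finset.card_union_le (P2 ∪ P2.image (· + 1)) ((Q ∪ Q.image (· + 1)) ∪ JJ)
    have h6 := Finset.card_union_le P2 (P2.image (· + 1))
    have h7 := Finset.card_union_le (Q ∪ Q.image (· + 1)) JJ
    have h8 := Finset.card_union_le Q (Q.image (· + 1))
    unfold cntZ at hN1
    omega
  · intro i j hij hjK hP
    have aux : ∀ S : Finset ℕ, (∀ t ∈ S, t ≤ i ∨ j < t) → (∀ t ∈ S.image (· + 1), t ≤ i ∨ j < t) →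
        ∀ t, i ≤ t → t ≤ j → t ∉ S := by
      intro S h1 h2 t hit htj ht
      have h3 := h1 t ht
      have h4 := h2 (t + 1) (Finset.mem_image_of_mem _ ht)
      omega
    refine run_of hV hs hε hh hr hJ hc hc0 hL hα hα0 hFS hX hsep hp hx hxF hjK ?_ ?_ ?_
    · intro t hit htj
      by_contra hbad
      refine aux Q (fun t ht => hP t ?_) (fun t ht => hP t ?_) t hit htj ?_
      · simp [ht]
      · exact Finset.mem_union_right _ (Finset.mem_union_left _ (Finset.mem_union_right _ ht))
      · refine Finset.mem_image.2 ⟨J - t, Finset.mem_filter.2 ⟨Finset.mem_range.2 (by omega), hbad⟩, by omega⟩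
    · intro t hit htj y hy hyx
      by_contra hbad
      refine aux P2 (fun t ht => hP t ?_) (fun t ht => hP t ?_) t hit htj ?_
      · simp [ht]
      · exact Finset.mem_union_left _ (Finset.mem_union_right _ ht)
      · exact hb t (Finset.mem_range.2 (by omega)) ⟨y, hy, hyx, not_le.1 hbad⟩
    · intro l t hit htj
      refine refs_const hit (J := J) (by omega) fun u hu => ?_
      have := hP (u + 1) (Finset.mem_union_right _ (Finset.mem_union_right _
        (Finset.mem_biUnion.2 ⟨l, Finset.mem_univ _, Finset.mem_image_of_mem _ hu⟩)))
      omega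

/-- lattice point as a vector -/
def zvec {m : ℕ} (h : ℝ) (p : Fin (m + 1) → ℤ) : EuclideanSpace ℝ (Fin (m + 1)) :=
  WithLp.toLp 2 fun i => h * (p i : ℝ)

lemma disc {m : ℕ} {M₀ : ℝ≥0} {ρ : EuclideanSpace ℝ (Fin (m + 1)) → Euc (m + 1)} (hρ : LipschitzWith M₀ ρ)
    {h r : ℝ} {J : ℕ} (hh : 0 < h) (hr : r = h * 2 ^ J) {S : Set (Euc (m + 1))} (hS : MeasurableSet S) :
    ∃ (F : (Fin (m + 1) → ℤ) → Euc (m + 1)) (X : (Fin (m + 1) → ℤ) → Set (Euc (m + 1))),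
      LipZ F (1 + (m + 1) * M₀) ∧ (∀ p, MeasurableSet (X p)) ∧ (∀ p, X p ⊆ S) ∧
      (∀ p, ∀ x ∈ X p, dist x (h • F p) ≤ (1 + (m + 1) * M₀) * h) ∧
      S ∩ ρ '' ball 0 r ⊆ ⋃ p ∈ zbox (m + 1) (2 ^ J), X p := by
  have hF : ∀ p : Fin (m + 1) → ℤ, h • (h⁻¹ • ρ (zvec h p)) = ρ (zvec h p) := fun p => by
    rw [smul_smul, mul_inv_cancel₀ hh.ne', one_smul]
  refine ⟨fun p => h⁻¹ • ρ (zvec h p), fun p => S ∩ ρ '' closedBall (zvec h p) ((m + 1) * h), ?_, ?_, ?_, ?_, ?_⟩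
  · intro p q d hd hpq
    rw [← smul_sub, norm_smul, norm_inv, Real.norm_of_nonneg hh.le]
    have h1 := hρ.dist_le_mul (zvec h p) (zvec h q)
    rw [dist_eq_norm, dist_eq_norm] at h1
    have h2 : ‖zvec h p - zvec h q‖ ≤ (m + 1) * (h * d) := by
      refine euc_norm_le _ (by positivity) fun i => ?_
      have : (zvec h p - zvec h q) i = h * ((p i : ℝ) - q i) := by simp [zvec]; ring
      rw [this, abs_mul, abs_of_pos hh]
      exact mul_le_mul_of_nonneg_left (hpq i) hh.le
    rw [inv_mul_le_iff₀ hh]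
    calc _ ≤ (M₀ : ℝ) * ((m + 1) * (h * d)) := h1.trans (mul_le_mul_of_nonneg_left h2 M₀.2)
      _ ≤ h * ((1 + (m + 1) * M₀) * d) := by nlinarith [mul_nonneg hh.le hd]
  · intro p
    exact hS.inter ((isCompact_closedBall _ _).image hρ.continuous).isClosed.measurableSet
  · exact fun p => inter_subset_left
  · rintro p x ⟨-, z, hz, rfl⟩
    rw [hF]
    have h1 := hρ.dist_le_mul z (zvec h p)
    have h2 := mul_le_mul_of_nonneg_left (mem_closedBall.1 hz) M₀.2
    change (M₀ : ℝ) * _ ≤ M₀ * _ at h2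
    nlinarith
  · rintro x ⟨hxS, z, hz, rfl⟩
    have hzi : ∀ i, |z i| < r := fun i => by
      have h1 : ‖z i‖ ≤ ‖z‖ := PiLp.norm_apply_le z i
      rw [mem_ball_zero_iff] at hz
      exact h1.trans_lt hz
    refine mem_iUnion₂.2 ⟨fun i => ⌊z i / h⌋, mem_zbox.2 fun i => ?_, hxS, z, ?_, rfl⟩
    · have h2 : |z i / h| < 2 ^ J := by
        rw [abs_div, abs_of_pos hh, div_lt_iff₀ hh, mul_comm, ← hr]
        exact hzi i
      rw [abs_lt] at h2
      rw [abs_le]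
      constructor
      · rw [Int.le_floor]; push_cast; exact h2.1.le
      · have : ⌊z i / h⌋ < 2 ^ J := by rw [Int.floor_lt]; push_cast; exact h2.2
        push_cast; exact this.le
    · rw [mem_closedBall, dist_eq_norm]
      refine euc_norm_le _ hh.le fun i => ?_
      have e : (z - zvec h fun i => ⌊z i / h⌋) i = h * (z i / h - ⌊z i / h⌋) := by
        rw [mul_sub, mul_div_cancel₀ _ hh.ne']
        simp [zvec]
      rw [e, abs_mul, abs_of_pos hh]
      have h3 := Int.floor_le (z i / h)
      have h4 := Int.lt_floor_add_one (z i / h)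
      rw [abs_of_nonneg (by linarith)]
      nlinarith

lemma key_fixed (m : ℕ) {CE θ : ℝ} (hCE : 1 ≤ CE) (hθ : 0 < θ) (M₀ : ℝ≥0) (V : Finset (Euc (m + 1)))
    (hV : ∀ u : Euc (m + 1), ‖u‖ = 1 → ∃ v ∈ V, ‖v - u‖ ≤ 1 / 20) : ∃ c : ℝ, 0 < c ∧ ∃ N : ℕ,
    ∀ E : Set (Euc (m + 1)), IsUR (m + 1) E CE θ M₀ → ∀ y ∈ E, ∀ r : ℝ, 0 < r → ENNReal.ofReal r < ediam E →
    ∀ K, ENNReal.ofReal (c * r ^ (m + 1)) ≤ μH[((m + 1 : ℕ) : ℝ)] {x ∈ E ∩ ball y r | GoodK E V r N K x} := by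
  classical
  obtain ⟨CU, hCU, hup⟩ := upper_global (m + 1) CE
  set M : ℝ := 1 + (m + 1) * M₀ with hMdef
  have hM : 1 ≤ M := by
    have : (0 : ℝ) ≤ (m + 1) * M₀ := by positivity
    linarith
  have hM0 : 0 < M := by linarith
  obtain ⟨Cd, hCd, hdeg⟩ := deg_cover m hM hCU
  set s : ℝ := min (1 / 2) (θ / (4 * Cd * 4 ^ (m + 1))) with hsdef
  have hs : 0 < s := lt_min (by norm_num) (by positivity)
  have hs2 : s ≤ 1 / 2 := min_le_left _ _
  have hCds : Cd * s * 4 ^ (m + 1) ≤ θ / 4 := by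
    have h1 : s ≤ θ / (4 * Cd * 4 ^ (m + 1)) := min_le_right _ _
    rw [le_div_iff₀ (by positivity)] at h1
    linarith
  set ε : ℝ := min (s / 2) (1 / 80) with hεdef
  have hε : 0 < ε := lt_min (by positivity) (by norm_num)
  have hεs : ε ≤ s / 2 := min_le_left _ _
  have hε80 : ε ≤ 1 / 80 := min_le_right _ _
  set L : ℕ := ⌈16 / s⌉₊ with hLdef
  have hL : 16 / s ≤ L := Nat.le_ceil _
  have hL2 : 2 ≤ L := by
    have h1 : (32 : ℝ) ≤ 16 / s := by rw [le_div_iff₀ hs]; linarith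
    have h2 : (32 : ℝ) ≤ L := h1.trans hL
    have h3 : 32 ≤ L := by exact_mod_cast h2
    omega
  set α : ℝ := s / (1280 * (m + 1)) with hαdef
  have hα : 0 < α := by positivity
  have hα1 : (16 * (m + 1) / s) * α ≤ 1 / 80 := by
    rw [hαdef]
    apply le_of_eq
    have : (m : ℝ) + 1 ≠ 0 := by positivity
    field_simp
    norm_num
  obtain ⟨m0, hm0⟩ := pow_unbounded_of_one_lt (160 * M / s) (one_lt_two : (1 : ℝ) < 2)
  rw [div_lt_iff₀ hs] at hm0
  have hc0 : 160 * M ≤ 2 ^ m0 := by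
    have : (0 : ℝ) < 2 ^ m0 := by positivity
    nlinarith
  have hcG : ∀ G, m0 ≤ G → 2 * M ≤ s * 2 ^ G := by
    intro G hG
    have : (2 : ℝ) ^ m0 ≤ 2 ^ G := pow_le_pow_right₀ one_le_two hG
    nlinarith
  obtain ⟨C3, hC3, hcnt⟩ := cntZ_sum m hM0.le hε hα (show 1 ≤ L by omega)
  obtain ⟨N1', hN1'⟩ := exists_nat_ge (C3 * (CU * (2 * M) ^ (m + 1)) / (θ / 4))
  set N1 := N1' + 1 with hN1def
  have hN1 : C3 * (CU * (2 * M) ^ (m + 1)) ≤ θ / 4 * N1 := by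
    rw [div_le_iff₀ (by positivity)] at hN1'
    rw [hN1def]; push_cast
    linarith
  set A : ℕ := (4 ^ (m + 1)) ^ (m0 + N1) * (2 * ⌈8 * M / s⌉₊ + 1) ^ (m + 1) with hA
  have hAp : 0 < A := by positivity
  have hAr : (0 : ℝ) < A := by exact_mod_cast hAp
  set c1 : ℝ := θ / (2 * A) with hc1
  have hc1p : 0 < c1 := by positivity
  set C4 : ℝ := (CU * CE * 1280 ^ (m + 1)) * (11 * (CU * 4 ^ (m + 1))) with hC4
  have hC4p : 0 ≤ C4 := by positivity
  obtain ⟨N2', hN2'⟩ := exists_nat_ge (C4 / (c1 / 2))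
  set N2 := N2' + 1 with hN2def
  have hN2 : C4 ≤ c1 / 2 * N2 := by
    rw [div_le_iff₀ (by positivity)] at hN2'
    rw [hN2def]; push_cast
    linarith
  have hN2p : (0 : ℝ) < N2 := by rw [hN2def]; positivity
  refine ⟨c1 / 2, by positivity, 2 * N2 + 2 * N1, fun E hE y hy r hr hrd K => ?_⟩
  have hnt : E.Nontrivial := by
    by_contra h
    rw [not_nontrivial_iff] at h
    rw [ediam_subsingleton h] at hrd
    exact not_lt_zero' hrd
  have up := hup E hE.1 hnt
  obtain ⟨ρ, hρ, hρm⟩ := hE.2.2 y hy r hr hrd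
  set J := K + m0 with hJ
  set h : ℝ := r / 2 ^ J with hhdef
  have hh : 0 < h := by positivity
  have hrh : r = h * 2 ^ J := by rw [hhdef, div_mul_cancel₀]; positivity
  have hSm : MeasurableSet (E ∩ ball y r) := hE.1.1.measurableSet.inter measurableSet_ball
  obtain ⟨F, X, hF, hXm, hXS, hXd, hXc⟩ := disc hρ hh hrh hSm
  obtain ⟨T, hTZ, hsep, hTN, hTμ⟩ := core1 (α := α) (m0 := m0) (N1 := N1) hCU hs hεs hL2 hh hrh hM0 hCd hCds hθ up
    (fun G p hG h1 h2 Y hY hYq => hdeg E up F hF s ε M h L G p hs hs2 hεs hh hM0.le (hcG G hG) (by omega) h1 h2 Y hY hYq)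
    (hcnt F hF J) hN1 (by omega) hXm (fun p => (hXS p).trans inter_subset_left) hXd (hρm.trans (measure_mono hXc))
  set μ : Measure (Euc (m + 1)) := μH[((m + 1 : ℕ) : ℝ)] with hμ
  set FS := ⋃ p ∈ T, X p with hFS
  have hFSm : MeasurableSet FS := Finset.measurableSet_biUnion _ fun p _ => hXm p
  have hFSS : FS ⊆ E ∩ ball y r := iUnion₂_subset fun p _ => hXS p
  have hFSμ : ENNReal.ofReal (c1 * r ^ (m + 1)) ≤ μ FS := by
    have e : ENNReal.ofReal (θ / 2 * r ^ (m + 1)) = (A : ℝ≥0∞) * ENNReal.ofReal (c1 * r ^ (m + 1)) := by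
      rw [← ENNReal.ofReal_natCast, ← ENNReal.ofReal_mul hAr.le]
      congr 1
      rw [hc1]; field_simp
    rw [e] at hTμ
    exact (ENNReal.mul_le_mul_iff_right (by exact_mod_cast hAp.ne') (ENNReal.natCast_ne_top _)).1 hTμ
  obtain ⟨W, hWm, hWF, hWμ, hWP⟩ := cheb μ (I := Finset.range (K + 1)) (B := fun t => Bad1 E FS (r / 2 ^ t)) hFSm
    (fun t => bad1_meas _ _ _) N2
  have hW : μ W ≤ ENNReal.ofReal (c1 / 2 * r ^ (m + 1)) := by
    have h1 := hWμ.trans (bad1_pack hE.1 hCU up hr hrd hFSS K)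
    have h2 : ENNReal.ofReal (C4 * r ^ (m + 1)) ≤ (N2 : ℝ≥0∞) * ENNReal.ofReal (c1 / 2 * r ^ (m + 1)) := by
      rw [← ENNReal.ofReal_natCast, ← ENNReal.ofReal_mul hN2p.le]
      apply ENNReal.ofReal_le_ofReal
      calc C4 * r ^ (m + 1) ≤ c1 / 2 * N2 * r ^ (m + 1) := by gcongr
        _ = _ := by ring
    exact (ENNReal.mul_le_mul_iff_right (by exact_mod_cast hN2p.ne') (ENNReal.natCast_ne_top _)).1 (h1.trans h2)
  have hsub : FS \ W ⊆ {x ∈ E ∩ ball y r | GoodK E V r (2 * N2 + 2 * N1) K x} := by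
    rintro x ⟨hxF, hxW⟩
    refine ⟨hFSS hxF, ?_⟩
    obtain ⟨P2, hP2, hb⟩ := hWP x hxF hxW
    obtain ⟨p, hp, hxp⟩ := mem_iUnion₂.1 hxF
    exact goodK_of hV hs hε80 hh hrh hJ hM0.le hc0 hL hα1 hα.le
      (fun x hx => by obtain ⟨p, hp, hxp⟩ := mem_iUnion₂.1 hx; exact ⟨p, hp, hxp⟩)
      (fun p _ => hXd p) hsep hp hxp hxF (hTN p hp) hP2 hb
  refine le_trans ?_ (measure_mono hsub)
  have h1 : μ FS ≤ μ (FS \ W) + μ W := by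
    refine (measure_mono ?_).trans (measure_union_le _ _)
    rw [diff_union_self]
    exact subset_union_left
  have h2 : ENNReal.ofReal (c1 / 2 * r ^ (m + 1)) + ENNReal.ofReal (c1 / 2 * r ^ (m + 1)) ≤
      μ (FS \ W) + ENNReal.ofReal (c1 / 2 * r ^ (m + 1)) := by
    rw [← ENNReal.ofReal_add (by positivity) (by positivity)]
    refine le_trans (le_of_eq_of_le ?_ hFSμ) (h1.trans (add_le_add le_rfl hW))
    congr 1; ring
  exact (ENNReal.add_le_add_iff_right ENNReal.ofReal_ne_top).1 h2

lemma key_all (m : ℕ) (CE θ : ℝ) (M₀ : ℝ≥0) (V : Finset (Euc (m + 1)))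
    (hV : ∀ u : Euc (m + 1), ‖u‖ = 1 → ∃ v ∈ V, ‖v - u‖ ≤ 1 / 20) : KEY (m + 1) CE θ M₀ V := by
  by_cases hh : 1 ≤ CE ∧ 0 < θ
  swap
  · exact ⟨1, one_pos, 0, fun E hE => absurd ⟨hE.1.2.1, hE.2.1⟩ hh⟩
  obtain ⟨c, hc, N, hk⟩ := key_fixed m hh.1 hh.2 M₀ V hV
  obtain ⟨CU, hCU, hup⟩ := upper_global (m + 1) CE
  refine ⟨c, hc, N, fun E hE y hy r hr hrd => ?_⟩
  have e : {x ∈ E ∩ ball y r | ∀ K, GoodK E V r N K x} = ⋂ K, {x ∈ E ∩ ball y r | GoodK E V r N K x} := by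
    ext x
    simp only [mem_setOf_eq, mem_iInter]
    exact ⟨fun h K => ⟨h.1, h.2 K⟩, fun h => ⟨(h 0).1, fun K => (h K).2⟩⟩
  have hSm : MeasurableSet (E ∩ ball y r) := hE.1.1.measurableSet.inter measurableSet_ball
  rw [e, Antitone.measure_iInter]
  · exact le_iInf fun K => hk E hE y hy r hr hrd K
  · intro K K' hKK x hx
    exact ⟨hx.1, goodK_mono hKK hx.2⟩
  · exact fun K => (hSm.inter (measurableSet_setOf.2 (goodK_measurable E V r N K))).nullMeasurableSet
  · refine ⟨0, ne_top_of_le_ne_top ENNReal.ofReal_ne_top (b := ENNReal.ofReal (CE * r ^ (m + 1))) ?_⟩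
    exact (measure_mono (sep_subset _ _)).trans (hE.1.2.2 y hy r hr hrd).2

lemma exists_V (n : ℕ) : ∃ V : Finset (Euc n), (∀ v ∈ V, ‖v‖ = 1) ∧ V.Nonempty ∧
    ∀ u : Euc n, ‖u‖ = 1 → ∃ v ∈ V, ‖v - u‖ ≤ 1 / 20 := by
  obtain ⟨T, h1, -, h2, -⟩ := exists_net (sphere (0 : Euc n) 1) (s := 1 / 20) (R := 2) (z := 0) (by norm_num) (by norm_num)
    (sphere_subset_ball (by norm_num))
  have h3 : ∀ u : Euc n, ‖u‖ = 1 → ∃ v ∈ T, ‖v - u‖ ≤ 1 / 20 := fun u hu => by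
    obtain ⟨t, ht, hd⟩ := h2 u (by simpa using hu)
    refine ⟨t, ht, ?_⟩
    rw [← dist_eq_norm, dist_comm]
    exact hd.le
  refine ⟨T, fun v hv => by simpa using h1 hv, ?_, h3⟩
  obtain ⟨v, hv, -⟩ := h3 (EuclideanSpace.single 0 1) (by simp)
  exact ⟨v, hv⟩

/-- **Theorem 1 (structure theorem).** Let `n ≥ 1` and let `E ⊆ ℝ^{n+1}` be an
`n`-dimensional uniformly rectifiable set with Christ–David dyadic system `D`.
Then there are constants `c₀ ∈ (0,1)`, `C ≥ 1` (and Harnack chain bounds `Nb`),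
depending only on `n` and the UR character of `E`, such that for every dyadic cube
`Q` there is an open set `Ω̃ ⊆ ℝ^{n+1} ∖ E` with: (1) `diam Ω̃ ≈ diam Q`;
(2) `∂Ω̃` is `n`-dimensional ADR with constant at most `C`; (3) `Ω̃` satisfies the
strong 2-sided corkscrew condition with constant `c₀`; (4) `H^n(∂Ω̃ ∩ Q) ≥ c₀ σ(Q)`;
(5) every connected component of `Ω̃` is an NTA domain with `n`-dimensional ADR
boundary, with NTA and ADR constants controlled by `c₀, C, Nb`. -/
theorem structure_theorem_UR_big_pieces_chord_arc
    (n : ℕ) (hn : 1 ≤ n) (CE θ : ℝ) (M₀ : ℝ≥0) :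
    ∃ (c₀ C : ℝ) (Nb : ℝ → ℕ), 0 < c₀ ∧ c₀ < 1 ∧ 1 ≤ C ∧
      ∀ E : Set (Euc n), IsUR n E CE θ M₀ →
        ∀ D : ChristDavid n E, ∀ Q : CDCube D,
          ∃ Ω' : Set (Euc n), IsOpen Ω' ∧ Ω' ⊆ Eᶜ ∧
            C⁻¹ * Metric.diam Q.set ≤ Metric.diam Ω' ∧
            Metric.diam Ω' ≤ C * Metric.diam Q.set ∧
            IsADR n (frontier Ω') C ∧
            StrongTwoSidedCorkscrew Ω' c₀ ∧
            ENNReal.ofReal c₀ * μH[(n : ℝ)] Q.set ≤ μH[(n : ℝ)] (frontier Ω' ∩ Q.set) ∧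
            ∀ X ∈ Ω', IsNTA (connectedComponentIn Ω' X) c₀ C Nb ∧
              IsADR n (frontier (connectedComponentIn Ω' X)) C := by
  obtain ⟨m, rfl⟩ : ∃ m, n = m + 1 := ⟨n - 1, by omega⟩
  obtain ⟨V, hV1, hV2, hV3⟩ := exists_V (m + 1)
  exact final_of_KEY (m + 1) hn CE θ M₀ V hV1 hV2 (key_all m CE θ M₀ V hV3)
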